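/- arXiv:math/0406165 — 2 statements merged into one kernel-verified Lean document; each statement's English description precedes it below -/
import Mathlib

section
/- Let (R,m) be a noetherian local ring of mixed characteristic with p = char(R/m) (so char(R) = 0 and char(R/m) = p > 0), i ≥ 0, and x_1,…,x_i ∈ R. Then { q ∈ Spec(R) : the images of p, x_1,…,x_i in R/q are part of a system of parameters for R/q } ⊆ Ass_R(D(H^{i+1}_{(p,x_1,…,x_i)R}(R))). -/
open IsLocalRing

/-- The underlying `R`-module of the `i`-th local cohomology of the `R`-module `M`
with support in the ideal `I`. -/
noncomputable abbrev LocalCohomologyModule {R : Type} [CommRing R] (I : Ideal R) (i : ℕ)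
    (M : Type) [AddCommGroup M] [Module R M] : ModuleCat R :=
  (localCohomology I i).obj (ModuleCat.of R M)

/-- `E` is an injective hull of the residue field of the local ring `R`. -/
def IsInjectiveHullOfResidueField (R : Type) [CommRing R] [IsLocalRing R]
    (E : Type) [AddCommGroup E] [Module R E] : Prop :=
  Module.Injective R E ∧
    ∃ f : ResidueField R →ₗ[R] E, Function.Injective f ∧
      ∀ N : Submodule R E, N ≠ ⊥ → N ⊓ LinearMap.range f ≠ ⊥

/-- The images of `x_1,…,x_i` in `R/q` are part of a system of parameters for `R/q`. -/
def IsPartOfSystemOfParameters {R : Type} [CommRing R] [IsLocalRing R]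
    (q : Ideal R) {i : ℕ} (x : Fin i → R) : Prop :=
  ∃ (n : ℕ) (h : i ≤ n) (y : Fin n → R),
    (∀ j : Fin i, y (Fin.castLE h j) = x j) ∧
    ringKrullDim (R ⧸ q) = n ∧
    (q ⊔ Ideal.span (Set.range y)).radical = maximalIdeal R

namespace LocCoh

open CategoryTheory CategoryTheory.Abelian

section Foundations

variable {R : Type} [CommRing R]

/-- The canonical surjection `R / I ^ t ⟶ R / I ^ s` for `s ≤ t`. -/
noncomputable abbrev powProj (I : Ideal R) {s t : ℕ} (h : s ≤ t) :
    ModuleCat.of R (R ⧸ I ^ t) ⟶ ModuleCat.of R (R ⧸ I ^ s) :=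
  ModuleCat.ofHom (Submodule.mapQ (I ^ t) (I ^ s) LinearMap.id (Ideal.pow_le_pow_right h))

lemma powProj_comp (I : Ideal R) {s t u : ℕ} (h : s ≤ t) (h' : t ≤ u) :
    powProj I h' ≫ powProj I h = powProj I (h.trans h') := by
  ext
  rfl

lemma powProj_refl (I : Ideal R) (s : ℕ) : powProj I (le_refl s) = 𝟙 _ := by
  ext
  rfl

variable (I : Ideal R) (i : ℕ) (M : Type) [AddCommGroup M] [Module R M]

/-- The module `Ext^i(R / I ^ t, M)`. -/
abbrev ExtPow (t : ℕ) : Type := Ext (ModuleCat.of R (R ⧸ I ^ t)) (ModuleCat.of R M) i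

/-- The transition maps `Ext^i(R / I ^ s, M) → Ext^i(R / I ^ t, M)`. -/
noncomputable def ExtPow.trans (s t : ℕ) (h : s ≤ t) : ExtPow I i M s →ₗ[R] ExtPow I i M t :=
  (Ext.mk₀ (powProj I h)).precompOfLinear R (ModuleCat.of R M) (zero_add i)

lemma ExtPow.trans_apply {s t : ℕ} (h : s ≤ t) (x : ExtPow I i M s) :
    ExtPow.trans I i M s t h x = (Ext.mk₀ (powProj I h)).comp x (zero_add i) := rfl

instance : DirectedSystem (ExtPow I i M) (ExtPow.trans I i M · · ·) where
  map_self s x := by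
    rw [ExtPow.trans_apply, powProj_refl, Ext.mk₀_id_comp]
  map_map s t u h h' x := by
    simp only [ExtPow.trans_apply, Ext.mk₀_comp_mk₀_assoc, powProj_comp]

/-- Local cohomology as the direct limit of the modules `Ext^i(R / I ^ t, M)`. -/
def Coh : Type := Module.DirectLimit (ExtPow I i M) (ExtPow.trans I i M)

noncomputable instance : AddCommGroup (Coh I i M) :=
  inferInstanceAs (AddCommGroup (Module.DirectLimit (ExtPow I i M) (ExtPow.trans I i M)))

noncomputable instance : Module R (Coh I i M) :=
  inferInstanceAs (Module R (Module.DirectLimit (ExtPow I i M) (ExtPow.trans I i M)))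

/-- The canonical map from the stage `t` of the direct limit. -/
noncomputable def Coh.of (t : ℕ) : ExtPow I i M t →ₗ[R] Coh I i M :=
  Module.DirectLimit.of R ℕ (ExtPow I i M) (ExtPow.trans I i M) t

variable {I i M}

lemma Coh.of_trans {s t : ℕ} (h : s ≤ t) (x : ExtPow I i M s) :
    Coh.of I i M t (ExtPow.trans I i M s t h x) = Coh.of I i M s x :=
  Module.DirectLimit.of_f

lemma Coh.exists_of (z : Coh I i M) : ∃ t x, Coh.of I i M t x = z :=
  Module.DirectLimit.exists_of z

lemma Coh.of_eq_zero {t : ℕ} {x : ExtPow I i M t} (h : Coh.of I i M t x = 0) :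
    ∃ (u : ℕ) (h : t ≤ u), ExtPow.trans I i M t u h x = 0 :=
  Module.DirectLimit.of.zero_exact h

variable {N : Type} [AddCommGroup N] [Module R N] {L : Type} [AddCommGroup L] [Module R L]

/-- Postcomposition with a class of degree `n`, on the direct limit. -/
noncomputable def Coh.postcomp {n j : ℕ} (β : Ext (ModuleCat.of R M) (ModuleCat.of R N) n)
    (h : i + n = j) : Coh I i M →ₗ[R] Coh I j N :=
  Module.DirectLimit.map (fun t ↦ β.postcompOfLinear R (ModuleCat.of R (R ⧸ I ^ t)) h)
    (by
      intro s t hst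
      ext x
      exact (Ext.comp_assoc (Ext.mk₀ (powProj I hst)) x β (zero_add i) h (by omega)))

lemma Coh.postcomp_of {n j : ℕ} (β : Ext (ModuleCat.of R M) (ModuleCat.of R N) n)
    (h : i + n = j) {t : ℕ} (x : ExtPow I i M t) :
    Coh.postcomp β h (Coh.of I i M t x) = Coh.of I j N t (x.comp β h) :=
  Module.DirectLimit.map_apply_of _ _ _

/-- Functoriality of local cohomology in the module. -/
noncomputable def Coh.map (I : Ideal R) (i : ℕ) (f : M →ₗ[R] N) : Coh I i M →ₗ[R] Coh I i N :=
  Coh.postcomp (Ext.mk₀ (ModuleCat.ofHom f)) (add_zero i)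

lemma Coh.map_of (f : M →ₗ[R] N) {t : ℕ} (x : ExtPow I i M t) :
    Coh.map I i f (Coh.of I i M t x) =
      Coh.of I i N t (x.comp (Ext.mk₀ (ModuleCat.ofHom f)) (add_zero i)) :=
  Coh.postcomp_of _ _ _

lemma Coh.map_comp (g : N →ₗ[R] L) (f : M →ₗ[R] N) (z : Coh I i M) :
    Coh.map I i (g ∘ₗ f) z = Coh.map I i g (Coh.map I i f z) := by
  obtain ⟨t, x, rfl⟩ := Coh.exists_of z
  simp only [Coh.map_of, ModuleCat.ofHom_comp]
  rw [Ext.comp_assoc_of_third_deg_zero, Ext.mk₀_comp_mk₀]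

lemma Coh.map_smul_id (r : R) (z : Coh I i M) :
    Coh.map I i (r • (LinearMap.id : M →ₗ[R] M)) z = r • z := by
  obtain ⟨t, x, rfl⟩ := Coh.exists_of z
  rw [Coh.map_of, ← LinearMap.map_smul, Ext.smul_eq_comp_mk₀]
  rfl

lemma Coh.map_id (z : Coh I i M) : Coh.map I i (LinearMap.id : M →ₗ[R] M) z = z := by
  simpa using Coh.map_smul_id (1 : R) z

lemma Coh.map_zero (z : Coh I i M) : Coh.map I i (0 : M →ₗ[R] N) z = 0 := by
  obtain ⟨t, x, rfl⟩ := Coh.exists_of z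
  rw [Coh.map_of]
  have : ModuleCat.ofHom (0 : M →ₗ[R] N) = 0 := rfl
  rw [this, Ext.mk₀_zero, Ext.comp_zero, LinearMap.map_zero]

/-- Local cohomology of isomorphic modules. -/
noncomputable def Coh.congr (I : Ideal R) (i : ℕ) (e : M ≃ₗ[R] N) : Coh I i M ≃ₗ[R] Coh I i N :=
  LinearEquiv.ofLinearMap (Coh.map I i e.toLinearMap) (Coh.map I i e.symm.toLinearMap)
    (by ext z; simp [← Coh.map_comp, Coh.map_id])
    (by ext z; simp [← Coh.map_comp, Coh.map_id])

lemma Coh.subsingleton_of_subsingleton [Subsingleton M] : Subsingleton (Coh I i M) := by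
  refine subsingleton_of_forall_eq 0 fun z ↦ ?_
  rw [← Coh.map_id z, Subsingleton.elim (LinearMap.id : M →ₗ[R] M) 0, Coh.map_zero]

lemma Coh.smul_eq_zero {r : R} (hr : ∀ m : M, r • m = 0) (z : Coh I i M) : r • z = 0 := by
  rw [← Coh.map_smul_id, show r • (LinearMap.id : M →ₗ[R] M) = 0 from LinearMap.ext hr,
    Coh.map_zero]

variable {f : M →ₗ[R] N} {g : N →ₗ[R] L}

lemma shortExact_of (hf : Function.Injective f) (hg : Function.Surjective g)
    (h : Function.Exact f g) :
    (ShortComplex.mk (ModuleCat.ofHom f) (ModuleCat.ofHom g)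
      (by ext x; exact h.apply_apply_eq_zero x)).ShortExact where
  exact := by
    rw [ShortComplex.moduleCat_exact_iff]
    intro x hx
    exact (h x).1 hx
  mono_f := (ModuleCat.mono_iff_injective _).2 hf
  epi_g := (ModuleCat.epi_iff_surjective _).2 hg

lemma Coh.exact_mid (hf : Function.Injective f) (hg : Function.Surjective g)
    (h : Function.Exact f g) : Function.Exact (Coh.map I i f) (Coh.map I i g) := by
  intro z
  constructor
  · intro hz
    obtain ⟨t, x, rfl⟩ := Coh.exists_of z
    rw [Coh.map_of] at hz
    obtain ⟨u, htu, hu⟩ := Coh.of_eq_zero hz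
    have hu' : (ExtPow.trans I i N t u htu x).comp (Ext.mk₀ (ModuleCat.ofHom g)) (add_zero i)
        = 0 := by
      rw [← hu, ExtPow.trans_apply, ExtPow.trans_apply, Ext.comp_assoc_of_third_deg_zero]
    obtain ⟨y, hy⟩ := Ext.covariant_sequence_exact₂ _ (shortExact_of hf hg h) _ hu'
    refine ⟨Coh.of I i M u y, ?_⟩
    rw [Coh.map_of, ← Coh.of_trans htu, ← hy]
  · rintro ⟨y, rfl⟩
    rw [← Coh.map_comp, h.linearMap_comp_eq_zero, Coh.map_zero]

lemma Coh.exists_connecting (I : Ideal R) (i : ℕ) (hf : Function.Injective f)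
    (hg : Function.Surjective g) (h : Function.Exact f g) :
    ∃ δ : Coh I i L →ₗ[R] Coh I (i + 1) M, Function.Exact (Coh.map I i g) δ ∧
      Function.Exact δ (Coh.map I (i + 1) f) := by
  have hS := shortExact_of hf hg h
  refine ⟨Coh.postcomp hS.extClass rfl, fun z ↦ ⟨fun hz ↦ ?_, ?_⟩, fun z ↦ ⟨fun hz ↦ ?_, ?_⟩⟩
  · obtain ⟨t, x, rfl⟩ := Coh.exists_of z
    rw [Coh.postcomp_of] at hz
    obtain ⟨u, htu, hu⟩ := Coh.of_eq_zero hz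
    have hu' : (ExtPow.trans I i L t u htu x).comp hS.extClass rfl = 0 := by
      rw [← hu, ExtPow.trans_apply, ExtPow.trans_apply]
      exact Ext.comp_assoc _ _ _ _ _ (by omega)
    obtain ⟨y, hy⟩ := Ext.covariant_sequence_exact₃ _ hS _ rfl hu'
    refine ⟨Coh.of I i N u y, ?_⟩
    rw [Coh.map_of, ← Coh.of_trans htu, ← hy]
  · rintro ⟨y, rfl⟩
    obtain ⟨t, x, rfl⟩ := Coh.exists_of y
    rw [Coh.map_of, Coh.postcomp_of]
    rw [Ext.comp_assoc_of_second_deg_zero]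
    have := hS.comp_extClass
    dsimp only at this
    rw [this, Ext.comp_zero, LinearMap.map_zero]
  · obtain ⟨t, x, rfl⟩ := Coh.exists_of z
    rw [Coh.map_of] at hz
    obtain ⟨u, htu, hu⟩ := Coh.of_eq_zero hz
    have hu' : (ExtPow.trans I (i + 1) M t u htu x).comp (Ext.mk₀ (ModuleCat.ofHom f))
        (add_zero (i + 1)) = 0 := by
      rw [← hu, ExtPow.trans_apply, ExtPow.trans_apply, Ext.comp_assoc_of_third_deg_zero]
    obtain ⟨y, hy⟩ := Ext.covariant_sequence_exact₁ _ hS _ hu' rfl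
    refine ⟨Coh.of I i L u y, ?_⟩
    rw [Coh.postcomp_of, ← Coh.of_trans htu, ← hy]
  · rintro ⟨y, rfl⟩
    obtain ⟨t, x, rfl⟩ := Coh.exists_of y
    rw [Coh.postcomp_of, Coh.map_of]
    rw [Ext.comp_assoc_of_third_deg_zero]
    have := hS.extClass_comp
    dsimp only at this
    rw [this, Ext.comp_zero, LinearMap.map_zero]

lemma Coh.exists_pow_smul_eq_zero {r : R} (hr : r ∈ I) (z : Coh I i M) :
    ∃ t : ℕ, r ^ t • z = 0 := by
  obtain ⟨t, x, rfl⟩ := Coh.exists_of z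
  refine ⟨t, ?_⟩
  rw [← LinearMap.map_smul]
  have h0 : (r ^ t • 𝟙 (ModuleCat.of R (R ⧸ I ^ t))) = 0 := by
    ext
    change Submodule.Quotient.mk (r ^ t • (1 : R)) = (0 : R ⧸ I ^ t)
    rw [Submodule.Quotient.mk_eq_zero]
    simpa using Ideal.pow_mem_pow hr t
  have : r ^ t • x = 0 := by
    conv_lhs => rw [← Ext.mk₀_id_comp x]
    rw [← Ext.smul_comp, ← Ext.mk₀_smul, h0, Ext.mk₀_zero, Ext.zero_comp]
  rw [this, LinearMap.map_zero]

lemma Coh.eq_zero_of_injective [Module.Injective R M] (z : Coh I (i + 1) M) : z = 0 := by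
  obtain ⟨t, x, rfl⟩ := Coh.exists_of z
  have : CategoryTheory.Injective (ModuleCat.of R M) :=
    Module.injective_object_of_injective_module R M
  rw [Ext.eq_zero_of_injective x, LinearMap.map_zero]

/-- The evaluation `H^0_I(M) → M`. -/
noncomputable def Coh.ev (I : Ideal R) (M : Type) [AddCommGroup M] [Module R M] :
    Coh I 0 M →ₗ[R] M :=
  Module.DirectLimit.lift R ℕ _ _
    (fun t ↦ (LinearMap.applyₗ (R := R) (M₂ := M) (Submodule.Quotient.mk (1 : R) : R ⧸ I ^ t)) ∘ₗ
      (ModuleCat.homLinearEquiv (S := R)).toLinearMap ∘ₗ (Ext.linearEquiv₀ (R := R)).toLinearMap)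
    (by
      intro s t h x
      obtain ⟨f, rfl⟩ := (Ext.linearEquiv₀ (R := R)).symm.surjective x
      rw [ExtPow.trans_apply, Ext.linearEquiv₀_symm_apply]
      simp only [LinearMap.comp_apply, LinearEquiv.coe_coe]
      erw [Ext.mk₀_comp_mk₀]
      erw [← Ext.linearEquiv₀_symm_apply (R := R), ← Ext.linearEquiv₀_symm_apply (R := R)]
      rw [LinearEquiv.apply_symm_apply, LinearEquiv.apply_symm_apply]
      rfl)

lemma Coh.ev_of (t : ℕ) (f : ModuleCat.of R (R ⧸ I ^ t) ⟶ ModuleCat.of R M) :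
    Coh.ev I M (Coh.of I 0 M t (Ext.mk₀ f)) = f.hom (Submodule.Quotient.mk (1 : R)) := by
  refine (Module.DirectLimit.lift_of _ _ _).trans ?_
  simp only [LinearMap.comp_apply, LinearEquiv.coe_coe]
  rw [← Ext.linearEquiv₀_symm_apply (R := R), LinearEquiv.apply_symm_apply]
  rfl

lemma Coh.exists_of_mk₀ (z : Coh I 0 M) :
    ∃ (t : ℕ) (f : ModuleCat.of R (R ⧸ I ^ t) ⟶ ModuleCat.of R M),
      Coh.of I 0 M t (Ext.mk₀ f) = z := by
  obtain ⟨t, x, rfl⟩ := Coh.exists_of z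
  exact ⟨t, Ext.linearEquiv₀ (R := R) x, by rw [Ext.mk₀_linearEquiv₀_apply]⟩

lemma Coh.ev_injective : Function.Injective (Coh.ev I M) := by
  rw [injective_iff_map_eq_zero]
  intro z hz
  obtain ⟨t, f, rfl⟩ := Coh.exists_of_mk₀ z
  rw [Coh.ev_of] at hz
  have : f = 0 := by
    ext
    exact hz
  rw [this, Ext.mk₀_zero, LinearMap.map_zero]

lemma Coh.ev_map (f : M →ₗ[R] N) (z : Coh I 0 M) :
    Coh.ev I N (Coh.map I 0 f z) = f (Coh.ev I M z) := by
  obtain ⟨t, g, rfl⟩ := Coh.exists_of_mk₀ z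
  rw [Coh.map_of, Ext.mk₀_comp_mk₀, Coh.ev_of, Coh.ev_of]
  rfl

lemma Coh.exists_ev_eq {m : M} {t : ℕ} (h : ∀ r ∈ I ^ t, r • m = 0) :
    ∃ z, Coh.ev I M z = m := by
  refine ⟨Coh.of I 0 M t (Ext.mk₀ (ModuleCat.ofHom
    ((I ^ t).liftQ (LinearMap.toSpanSingleton R M m) ?_))), ?_⟩
  · intro r hr
    exact h r hr
  · rw [Coh.ev_of]
    change (1 : R) • m = m
    rw [one_smul]

end Foundations

end LocCoh

namespace LocCoh

open CategoryTheory

section Comparison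

variable {R : Type} [CommRing R] {X : ModuleCat.{0} R} (P : ProjectiveResolution X)
  (Y : ModuleCat.{0} R) (n : ℕ)

/-- The cocycle underlying an element of the cycles of the Hom complex. -/
noncomputable def toCocycle :
    (P.complex.linearYonedaObj R Y).cycles n →ₗ[R] (P.complex.X n ⟶ Y) :=
  ((P.complex.linearYonedaObj R Y).iCycles n).hom

lemma d_toCocycle (z : (P.complex.linearYonedaObj R Y).cycles n) (m : ℕ) :
    P.complex.d m n ≫ toCocycle P Y n z = 0 := by
  have h := (P.complex.linearYonedaObj R Y).iCycles_d n m
  exact congr($(h).hom z)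

lemma exists_toCocycle_eq (f : P.complex.X n ⟶ Y) (hf : P.complex.d (n + 1) n ≫ f = 0) :
    ∃ z, toCocycle P Y n z = f := by
  let k : ModuleCat.of R R ⟶ (P.complex.linearYonedaObj R Y).X n :=
    ModuleCat.ofHom (LinearMap.toSpanSingleton R (P.complex.X n ⟶ Y) f)
  have hk : k ≫ (P.complex.linearYonedaObj R Y).d n (n + 1) = 0 := by
    ext
    change P.complex.d (n + 1) n ≫ ((1 : R) • f) = 0
    rw [one_smul, hf]
  refine ⟨((P.complex.linearYonedaObj R Y).liftCycles k (n + 1) (by simp) hk).hom 1, ?_⟩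
  have h := (P.complex.linearYonedaObj R Y).liftCycles_i k (n + 1) (by simp) hk
  refine (congr($(h).hom 1)).trans ?_
  change (1 : R) • f = f
  rw [one_smul]

/-- The map from cocycles to `Ext`. -/
noncomputable def cyclesToExt :
    (P.complex.linearYonedaObj R Y).cycles n →ₗ[R] Abelian.Ext X Y n where
  toFun z := P.extMk (toCocycle P Y n z) (n + 1) rfl (d_toCocycle P Y n z _)
  map_add' z w := by
    rw [P.add_extMk]
    congr 1
    exact map_add _ _ _
  map_smul' r z := by
    rw [RingHom.id_apply, Abelian.Ext.smul_eq_comp_mk₀, P.extMk_comp_mk₀]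
    congr 1
    rw [map_smul, Linear.comp_smul, Category.comp_id]

lemma toCycles_comp_cyclesToExt :
    ((P.complex.linearYonedaObj R Y).sc n).toCycles ≫
      (ModuleCat.ofHom (cyclesToExt P Y n) : (P.complex.linearYonedaObj R Y).cycles n ⟶ _)
      = 0 := by
  ext w
  have h : ∀ m w, toCocycle P Y n (((P.complex.linearYonedaObj R Y).toCycles m n).hom w) =
      P.complex.d n m ≫ w := by
    intro m w
    have h := (P.complex.linearYonedaObj R Y).toCycles_i m n
    exact congr($(h).hom w)
  change P.extMk (toCocycle P Y n (((P.complex.linearYonedaObj R Y).toCycles _ n).hom w))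
    (n + 1) rfl (d_toCocycle P Y n _ _) = 0
  cases n with
  | zero =>
    have hz : ∀ (m : ℕ) (w : P.complex.X m ⟶ Y), P.complex.d 0 m ≫ w = 0 := fun m w ↦ by
      rw [P.complex.shape _ _ (by simp), Limits.zero_comp]
    have h1 : ∀ (f : P.complex.X 0 ⟶ Y) (hf : P.complex.d (0 + 1) 0 ≫ f = 0) (_ : f = 0),
        P.extMk f (0 + 1) rfl hf = 0 := by
      rintro f hf rfl
      exact P.extMk_zero _ _
    exact h1 _ _ ((h _ w).trans (hz _ w))
  | succ k =>
    rw [P.extMk_eq_zero_iff _ _ _ _ k rfl]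
    have hp : (ComplexShape.up ℕ).prev (k + 1) = k := by simp
    have h0 := h ((ComplexShape.up ℕ).prev (k + 1)) w
    have : ∀ m (_ : m = k) (w : P.complex.X m ⟶ Y), ∃ g : P.complex.X k ⟶ Y,
        P.complex.d (k + 1) k ≫ g = P.complex.d (k + 1) m ≫ w := by
      rintro m rfl w
      exact ⟨w, rfl⟩
    obtain ⟨g, hg⟩ := this _ hp w
    exact ⟨g, hg.trans h0.symm⟩

/-- The map from the cohomology of the Hom complex to `Ext`. -/
noncomputable def homologyToExt :
    (P.complex.linearYonedaObj R Y).homology n ⟶ ModuleCat.of R (Abelian.Ext X Y n) :=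
  ((P.complex.linearYonedaObj R Y).sc n).descHomology
    (ModuleCat.ofHom (cyclesToExt P Y n)) (toCycles_comp_cyclesToExt P Y n)

lemma homologyπ_comp_homologyToExt :
    (P.complex.linearYonedaObj R Y).homologyπ n ≫ homologyToExt P Y n =
      ModuleCat.ofHom (cyclesToExt P Y n) :=
  ShortComplex.π_descHomology _ _ _

lemma homologyToExt_surjective : Function.Surjective (homologyToExt P Y n).hom := by
  intro α
  obtain ⟨f, hf, rfl⟩ := P.extMk_surjective α (n + 1) rfl
  obtain ⟨z, rfl⟩ := exists_toCocycle_eq P Y n f hf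
  exact ⟨((P.complex.linearYonedaObj R Y).homologyπ n).hom z,
    congr($(homologyπ_comp_homologyToExt P Y n).hom z)⟩

variable {P} {X' : ModuleCat.{0} R} {P' : ProjectiveResolution X'} {g : X' ⟶ X}
  (φ : ProjectiveResolution.Hom P' P g)

/-- The map of Hom complexes induced by a map of resolutions. -/
noncomputable def linearYonedaMap :
    P.complex.linearYonedaObj R Y ⟶ P'.complex.linearYonedaObj R Y :=
  (HomologicalComplex.unopFunctor _ _).map
    ((((linearYoneda R (ModuleCat.{0} R)).obj Y).rightOp.mapHomologicalComplex _).map φ.hom).op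

lemma homologyMap_comp_homologyToExt :
    HomologicalComplex.homologyMap (linearYonedaMap Y φ) n ≫ homologyToExt P' Y n =
      homologyToExt P Y n ≫
        ModuleCat.ofHom ((Abelian.Ext.mk₀ g).precompOfLinear R Y (zero_add n)) := by
  rw [← cancel_epi ((P.complex.linearYonedaObj R Y).homologyπ n)]
  rw [HomologicalComplex.homologyπ_naturality_assoc, homologyπ_comp_homologyToExt,
    reassoc_of% (homologyπ_comp_homologyToExt P Y n)]
  ext z
  change P'.extMk (toCocycle P' Y n ((HomologicalComplex.cyclesMap (linearYonedaMap Y φ) n).hom z))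
    (n + 1) rfl (d_toCocycle P' Y n _ _) = (Abelian.Ext.mk₀ g).comp
      (P.extMk (toCocycle P Y n z) (n + 1) rfl (d_toCocycle P Y n z _)) (zero_add n)
  rw [ProjectiveResolution.mk₀_comp_extMk _ _ _ _ φ]
  congr 1
  have h := HomologicalComplex.cyclesMap_i (linearYonedaMap Y φ) n
  exact congr($(h).hom z)

lemma isoExt_hom_naturality :
    (((Ext R (ModuleCat.{0} R) n).map g.op).app Y) ≫ (P'.isoExt n Y).hom =
      (P.isoExt n Y).hom ≫ HomologicalComplex.homologyMap (linearYonedaMap Y φ) n := by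
  have h1 := ProjectiveResolution.isoLeftDerivedObj_inv_naturality g P' P φ.hom
    φ.hom_f_zero_comp_π_f_zero ((linearYoneda R (ModuleCat.{0} R)).obj Y).rightOp n
  have h2 := ShortComplex.homologyOpIso_inv_naturality
    ((HomologicalComplex.shortComplexFunctor _ _ n).map (linearYonedaMap Y φ))
  have h1' := congr(Quiver.Hom.unop $h1)
  have h2' := congr(Quiver.Hom.unop $h2)
  rw [unop_comp, unop_comp] at h1' h2'
  refine (Category.assoc _ _ _).symm.trans ((congrArg (· ≫ _) h1').trans ?_)
  refine (Category.assoc _ _ _).trans (((congrArg (_ ≫ ·) h2'.symm)).trans ?_)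
  exact (Category.assoc _ _ _).symm


/-- The comparison map from `Ext` as a derived functor to `Ext` in the derived category. -/
noncomputable def extComparison (X Y : ModuleCat.{0} R) (n : ℕ) :
    ((Ext R (ModuleCat.{0} R) n).obj (Opposite.op X)).obj Y ⟶
      ModuleCat.of R (Abelian.Ext X Y n) :=
  ((projectiveResolution X).isoExt n Y).hom ≫ homologyToExt (projectiveResolution X) Y n

lemma extComparison_surjective (X Y : ModuleCat.{0} R) (n : ℕ) :
    Function.Surjective (extComparison X Y n).hom := by
  rw [extComparison, ModuleCat.hom_comp]
  exact (homologyToExt_surjective _ Y n).comp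
    ((ModuleCat.epi_iff_surjective ((projectiveResolution X).isoExt n Y).hom).1 inferInstance)

lemma extComparison_naturality {X X' : ModuleCat.{0} R} (g : X' ⟶ X) (Y : ModuleCat.{0} R)
    (n : ℕ) :
    (((Ext R (ModuleCat.{0} R) n).map g.op).app Y) ≫ extComparison X' Y n =
      extComparison X Y n ≫
        ModuleCat.ofHom ((Abelian.Ext.mk₀ g).precompOfLinear R Y (zero_add n)) := by
  let φ : ProjectiveResolution.Hom (projectiveResolution X') (projectiveResolution X) g :=
    ⟨ProjectiveResolution.lift g _ _, ProjectiveResolution.lift_commutes_zero g _ _⟩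
  rw [extComparison, extComparison, ← Category.assoc, isoExt_hom_naturality Y n φ,
    Category.assoc, Category.assoc, homologyMap_comp_homologyToExt]

open Limits localCohomology in
/-- The local cohomology of Mathlib surjects onto the direct limit of `Ext` modules. -/
lemma exists_surjective_localCohomology (I : Ideal R) (i : ℕ) (M : Type) [AddCommGroup M]
    [Module R M] :
    ∃ f : ((localCohomology I i).obj (ModuleCat.of R M)) →ₗ[R] Coh I i M,
      Function.Surjective f := by
  let D := diagram (idealPowersDiagram I) i
  let F := D.flip.obj (ModuleCat.of R M)
  have : HasColimit D := inferInstance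
  let e : (colimit D).obj (ModuleCat.of R M) ≅ colimit F :=
    colimitObjIsoColimitCompEvaluation D (ModuleCat.of R M)
  let c : Cocone F :=
    { pt := ModuleCat.of R (Coh I i M)
      ι :=
        { app t := extComparison (ModuleCat.of R (R ⧸ I ^ t.unop.unop)) (ModuleCat.of R M) i ≫
            ModuleCat.ofHom (Coh.of I i M t.unop.unop)
          naturality s t h := by
            have hst : s.unop.unop ≤ t.unop.unop := h.unop.unop.down.down
            have hn := extComparison_naturality (powProj I hst) (ModuleCat.of R M) i
            refine (congr($hn ≫ ModuleCat.ofHom (Coh.of I i M t.unop.unop))).trans ?_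
            rw [Category.assoc]
            refine (congrArg (extComparison (ModuleCat.of R (R ⧸ I ^ s.unop.unop))
              (ModuleCat.of R M) i ≫ ·) ?_).trans (Category.comp_id _).symm
            ext x
            exact Coh.of_trans hst x } }
  refine ⟨(e.hom ≫ colimit.desc F c).hom, fun z ↦ ?_⟩
  obtain ⟨t, x, rfl⟩ := Coh.exists_of z
  obtain ⟨y, rfl⟩ := extComparison_surjective _ _ _ x
  refine ⟨e.inv.hom ((colimit.ι F (Opposite.op (Opposite.op t))).hom y), ?_⟩
  have h := colimit.ι_desc c (Opposite.op (Opposite.op t))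
  have h' : colimit.ι F (Opposite.op (Opposite.op t)) ≫ e.inv ≫ e.hom ≫ colimit.desc F c =
    c.ι.app (Opposite.op (Opposite.op t)) := by rw [e.inv_hom_id_assoc, h]
  exact congr($(h').hom y)

end Comparison

end LocCoh

namespace LocCoh

open CategoryTheory CategoryTheory.Abelian

section Torsion

variable {R : Type} [CommRing R] {I : Ideal R} {i : ℕ} {M : Type} [AddCommGroup M] [Module R M]
  {N : Type} [AddCommGroup N] [Module R N] {L : Type} [AddCommGroup L] [Module R L]
  {f : M →ₗ[R] N} {g : N →ₗ[R] L}

lemma subsingleton_mid_of_exact {A B C : Type} [AddCommGroup A] [Module R A] [AddCommGroup B]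
    [Module R B] [AddCommGroup C] [Module R C] {u : A →ₗ[R] B} {v : B →ₗ[R] C}
    (h : Function.Exact u v) (hA : Subsingleton A) (hC : Subsingleton C) : Subsingleton B := by
  refine subsingleton_of_forall_eq 0 fun b ↦ ?_
  obtain ⟨a, rfl⟩ := (h b).1 (Subsingleton.elim _ _)
  rw [Subsingleton.elim a 0, map_zero]

lemma Coh.subsingleton_mid (hf : Function.Injective f) (hg : Function.Surjective g)
    (h : Function.Exact f g) (hM : Subsingleton (Coh I i M)) (hL : Subsingleton (Coh I i L)) :
    Subsingleton (Coh I i N) :=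
  subsingleton_mid_of_exact (Coh.exact_mid hf hg h) hM hL

lemma Coh.subsingleton_left (hf : Function.Injective f) (hg : Function.Surjective g)
    (h : Function.Exact f g) (hL : Subsingleton (Coh I i L))
    (hN : Subsingleton (Coh I (i + 1) N)) : Subsingleton (Coh I (i + 1) M) := by
  obtain ⟨δ, -, h₂⟩ := Coh.exists_connecting I i hf hg h
  exact subsingleton_mid_of_exact h₂ hL hN

lemma Coh.map_surjective (hf : Function.Injective f) (hg : Function.Surjective g)
    (h : Function.Exact f g) (hM : Subsingleton (Coh I (i + 1) M)) :
    Function.Surjective (Coh.map I i g) := by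
  obtain ⟨δ, h₁, -⟩ := Coh.exists_connecting I i hf hg h
  exact fun z ↦ (h₁ z).1 (Subsingleton.elim _ _)

lemma Coh.map_injective (hf : Function.Injective f) (hg : Function.Surjective g)
    (h : Function.Exact f g) (hM : Subsingleton (Coh I i M)) :
    Function.Injective (Coh.map I i g) := by
  rw [injective_iff_map_eq_zero]
  intro z hz
  obtain ⟨y, rfl⟩ := (Coh.exact_mid hf hg h z).1 hz
  rw [Subsingleton.elim y 0, LinearMap.map_zero]

lemma exact_subtype_mkQ (P : Submodule R M) : Function.Exact P.subtype P.mkQ := by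
  intro x
  simp

lemma exact_ker_rangeRestrict (f : M →ₗ[R] N) :
    Function.Exact (LinearMap.ker f).subtype f.rangeRestrict := by
  intro x
  simp [Subtype.ext_iff]

/-- Every element of `M` is killed by a power of `I`. -/
def PowTorsion (I : Ideal R) (M : Type) [AddCommGroup M] [Module R M] : Prop :=
  ∀ m : M, ∃ t : ℕ, ∀ r ∈ I ^ t, r • m = 0

lemma PowTorsion.of_surjective (hM : PowTorsion I M) (f : M →ₗ[R] N)
    (hf : Function.Surjective f) : PowTorsion I N := by
  intro n
  obtain ⟨m, rfl⟩ := hf n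
  obtain ⟨t, ht⟩ := hM m
  exact ⟨t, fun r hr ↦ by rw [← map_smul, ht r hr, map_zero]⟩

lemma PowTorsion.of_injective (hN : PowTorsion I N) (f : M →ₗ[R] N)
    (hf : Function.Injective f) : PowTorsion I M := by
  intro m
  obtain ⟨t, ht⟩ := hN (f m)
  exact ⟨t, fun r hr ↦ hf (by rw [map_smul, ht r hr, map_zero])⟩

lemma PowTorsion.mono_radical [IsNoetherianRing R] {J : Ideal R} (hM : PowTorsion J M)
    (h : I ≤ J.radical) : PowTorsion I M := by
  intro m
  obtain ⟨t, ht⟩ := hM m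
  obtain ⟨k, hk⟩ := Ideal.exists_pow_le_of_le_radical_of_fg h (IsNoetherian.noetherian I)
  refine ⟨k * t, fun r hr ↦ ht r ?_⟩
  rw [pow_mul] at hr
  exact Ideal.pow_right_mono hk t hr

lemma Coh.ev_surjective (hM : PowTorsion I M) : Function.Surjective (Coh.ev I M) := by
  intro m
  obtain ⟨t, ht⟩ := hM m
  exact Coh.exists_ev_eq ht

lemma Coh.map_zero_surjective (hM : PowTorsion I M) (hf : Function.Surjective f) :
    Function.Surjective (Coh.map I 0 f) := by
  intro z
  obtain ⟨m, hm⟩ := hf (Coh.ev I N z)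
  obtain ⟨w, rfl⟩ := Coh.ev_surjective hM m
  exact ⟨w, Coh.ev_injective (by rw [Coh.ev_map, hm])⟩

/-- The submodule of elements killed by a power of `I`. -/
def powTorsion (I : Ideal R) (M : Type) [AddCommGroup M] [Module R M] : Submodule R M where
  carrier := {m | ∃ t : ℕ, ∀ r ∈ I ^ t, r • m = 0}
  zero_mem' := ⟨0, by simp⟩
  add_mem' := by
    rintro a b ⟨s, hs⟩ ⟨t, ht⟩
    refine ⟨max s t, fun r hr ↦ ?_⟩
    rw [smul_add, hs r (Ideal.pow_le_pow_right (le_max_left _ _) hr),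
      ht r (Ideal.pow_le_pow_right (le_max_right _ _) hr), add_zero]
  smul_mem' := by
    rintro c a ⟨s, hs⟩
    exact ⟨s, fun r hr ↦ by rw [smul_comm, hs r hr, smul_zero]⟩

lemma powTorsion_powTorsion : PowTorsion I (powTorsion I M) := by
  rintro ⟨m, t, ht⟩
  exact ⟨t, fun r hr ↦ Subtype.ext (ht r hr)⟩

lemma PowTorsion.exists_pow_of_finite (hM : PowTorsion I M) [Module.Finite R M] :
    ∃ t : ℕ, ∀ m : M, ∀ r ∈ I ^ t, r • m = 0 := by
  obtain ⟨s, hs⟩ := Module.Finite.fg_top (R := R) (M := M)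
  choose k hk using hM
  refine ⟨s.sup k, fun m ↦ ?_⟩
  have hm : m ∈ Submodule.span R (s : Set M) := hs ▸ Submodule.mem_top
  induction hm using Submodule.span_induction with
  | mem x hx =>
    exact fun r hr ↦ hk x r (Ideal.pow_le_pow_right (Finset.le_sup (f := k) hx) hr)
  | zero => simp
  | add x y _ _ hx hy => exact fun r hr ↦ by rw [smul_add, hx r hr, hy r hr, add_zero]
  | smul c x _ hx => exact fun r hr ↦ by rw [smul_comm, hx r hr, smul_zero]

lemma map_eq_zero_of_mem_mul {A J : Ideal R} {φ : A →ₗ[R] M} (h : ∀ a : A, ∀ r ∈ J, r • φ a = 0)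
    {x : R} (hx : x ∈ J * A) (hxA : x ∈ A) : φ ⟨x, hxA⟩ = 0 := by
  have h1 : J * A ≤ (LinearMap.ker φ).map A.subtype := by
    rw [Ideal.mul_le]
    intro r hr a ha
    exact ⟨r • ⟨a, ha⟩, by rw [SetLike.mem_coe, LinearMap.mem_ker, map_smul, h _ r hr], rfl⟩
  obtain ⟨y, hy, hyx⟩ := h1 hx
  have : y = ⟨x, hxA⟩ := Subtype.ext hyx
  rw [← this]
  exact hy

lemma exists_pow_inf_le_pow_mul [IsNoetherianRing R] (I A : Ideal R) (t : ℕ) :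
    ∃ k : ℕ, I ^ k ⊓ A ≤ I ^ t * A := by
  obtain ⟨k, hk⟩ := Ideal.exists_pow_inf_eq_pow_smul I (A : Submodule R R)
  refine ⟨t + k, ?_⟩
  have h := hk (t + k) (by omega)
  simp only [smul_eq_mul, Ideal.mul_top, Nat.add_sub_cancel] at h
  rw [h]
  exact Ideal.mul_mono_right inf_le_right

/-- A map from an ideal `A` to an injective module which vanishes on `A ∩ J` is multiplication
by an element killed by `J`. -/
lemma exists_extension_of_vanishing [Module.Injective R M] {A J : Ideal R} (φ : A →ₗ[R] M)
    (h : ∀ a : A, (a : R) ∈ J → φ a = 0) :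
    ∃ m : M, (∀ r ∈ J, r • m = 0) ∧ ∀ a : A, (a : R) • m = φ a := by
  let π : A →ₗ[R] R ⧸ J := J.mkQ ∘ₗ A.subtype
  have hker : LinearMap.ker π ≤ LinearMap.ker φ := by
    intro a ha
    exact h a ((Submodule.Quotient.mk_eq_zero J).1 ha)
  obtain ⟨g, hg⟩ := Module.Injective.out (R := R) (Q := M)
    ((LinearMap.ker π).liftQ π le_rfl)
    (by rw [← LinearMap.ker_eq_bot, Submodule.ker_liftQ_eq_bot _ _ _ le_rfl])
    ((LinearMap.ker π).liftQ _ hker)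
  refine ⟨g (Submodule.Quotient.mk 1), fun r hr ↦ ?_, fun a ↦ ?_⟩
  · rw [← map_smul, ← Submodule.Quotient.mk_smul, smul_eq_mul, mul_one,
      (Submodule.Quotient.mk_eq_zero _).2 hr, map_zero]
  · rw [← map_smul, ← Submodule.Quotient.mk_smul, smul_eq_mul, mul_one]
    exact hg (Submodule.Quotient.mk a)

lemma injective_powTorsion [IsNoetherianRing R] [Module.Injective R M] :
    Module.Injective R (powTorsion I M) := by
  refine Module.Baer.injective fun A φ ↦ ?_
  have hφ : PowTorsion I (LinearMap.range φ) :=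
    powTorsion_powTorsion.of_injective (LinearMap.range φ).subtype Subtype.val_injective
  obtain ⟨t, ht⟩ := hφ.exists_pow_of_finite
  have ht' : ∀ a : A, ∀ r ∈ I ^ t, r • φ a = 0 := fun a r hr ↦
    congrArg Subtype.val (ht ⟨φ a, LinearMap.mem_range_self φ a⟩ r hr)
  obtain ⟨k, hk⟩ := exists_pow_inf_le_pow_mul I A t
  obtain ⟨m, hm, hm'⟩ := exists_extension_of_vanishing (J := I ^ k)
    ((powTorsion I M).subtype ∘ₗ φ) fun a ha ↦ by
      rw [LinearMap.comp_apply, map_eq_zero_of_mem_mul ht' (hk ⟨ha, a.2⟩) a.2, map_zero]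
  exact ⟨LinearMap.toSpanSingleton R _ ⟨m, k, hm⟩, fun a ha ↦ Subtype.ext (hm' ⟨a, ha⟩)⟩

lemma exists_injective_embedding (M : Type) [AddCommGroup M] [Module R M] :
    ∃ (J : Type) (_ : AddCommGroup J) (_ : Module R J) (f : M →ₗ[R] J),
      Module.Injective R J ∧ Function.Injective f := by
  let J := CategoryTheory.Injective.under (ModuleCat.of R M)
  have : CategoryTheory.Injective (ModuleCat.of R J) :=
    inferInstanceAs (CategoryTheory.Injective J)
  exact ⟨J, inferInstance, inferInstance, (CategoryTheory.Injective.ι (ModuleCat.of R M)).hom,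
    Module.injective_module_of_injective_object R J,
    (ModuleCat.mono_iff_injective _).1 inferInstance⟩

theorem Coh.subsingleton_of_powTorsion [IsNoetherianRing R] (hM : PowTorsion I M) :
    Subsingleton (Coh I (i + 1) M) := by
  induction i generalizing M with
  | zero =>
    obtain ⟨J, _, _, f, hJ, hf⟩ := exists_injective_embedding (R := R) M
    let f' : M →ₗ[R] powTorsion I J := f.codRestrict _ fun m ↦ by
      obtain ⟨t, ht⟩ := hM m
      exact ⟨t, fun r hr ↦ by rw [← map_smul, ht r hr, LinearMap.map_zero]⟩
    have hf' : Function.Injective f' := fun a b h ↦ hf (congrArg Subtype.val h)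
    have hJ' : Module.Injective R (powTorsion I J) := injective_powTorsion
    have hs := Submodule.mkQ_surjective (LinearMap.range f')
    have hex : Function.Exact f' (LinearMap.range f').mkQ := LinearMap.exact_map_mkQ_range f'
    obtain ⟨δ, h₁, h₂⟩ := Coh.exists_connecting I 0 hf' hs hex
    refine subsingleton_of_forall_eq 0 fun z ↦ ?_
    obtain ⟨y, rfl⟩ := (h₂ z).1 (Coh.eq_zero_of_injective _)
    exact (h₁ y).2 (Coh.map_zero_surjective powTorsion_powTorsion hs y)
  | succ i ih =>
    obtain ⟨J, _, _, f, hJ, hf⟩ := exists_injective_embedding (R := R) M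
    let f' : M →ₗ[R] powTorsion I J := f.codRestrict _ fun m ↦ by
      obtain ⟨t, ht⟩ := hM m
      exact ⟨t, fun r hr ↦ by rw [← map_smul, ht r hr, LinearMap.map_zero]⟩
    have hf' : Function.Injective f' := fun a b h ↦ hf (congrArg Subtype.val h)
    have hJ' : Module.Injective R (powTorsion I J) := injective_powTorsion
    have hs := Submodule.mkQ_surjective (LinearMap.range f')
    have hex : Function.Exact f' (LinearMap.range f').mkQ := LinearMap.exact_map_mkQ_range f'
    exact Coh.subsingleton_left hf' hs hex (ih (powTorsion_powTorsion.of_surjective _ hs))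
      (subsingleton_of_forall_eq 0 Coh.eq_zero_of_injective)

end Torsion

section Tower

variable {R : Type} [CommRing R] {I J : Ideal R} {i : ℕ} {M : Type} [AddCommGroup M] [Module R M]

/-- The cokernel of `M → M_z`. -/
abbrev QuotLoc (z : R) (M : Type) [AddCommGroup M] [Module R M] : Type :=
  LocalizedModule (Submonoid.powers z) M ⧸
    LinearMap.range (LocalizedModule.mkLinearMap (Submonoid.powers z) M)

lemma smul_localizedModule_mk {S : Submonoid R} (r : R) (m : M) (s : S) :
    r • LocalizedModule.mk m s = LocalizedModule.mk (r • m) s :=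
  LocalizedModule.smul'_mk r m s

/-- The map `m ↦ m / z ^ k` to the cokernel of `M → M_z`. -/
noncomputable def QuotLoc.frac (z : R) (M : Type) [AddCommGroup M] [Module R M] (k : ℕ) :
    M →ₗ[R] QuotLoc z M :=
  Submodule.mkQ _ ∘ₗ
    { toFun m := LocalizedModule.mk m (⟨z ^ k, k, rfl⟩ : Submonoid.powers z)
      map_add' a b := by
        rw [LocalizedModule.mk_add_mk, ← smul_add, LocalizedModule.mk_cancel_common_left]
      map_smul' r a := (smul_localizedModule_mk r a _).symm }

lemma QuotLoc.frac_apply (z : R) (k : ℕ) (m : M) :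
    QuotLoc.frac z M k m =
      Submodule.Quotient.mk (LocalizedModule.mk m (⟨z ^ k, k, rfl⟩ : Submonoid.powers z)) := rfl

lemma QuotLoc.exists_frac (z : R) (u : QuotLoc z M) : ∃ k m, QuotLoc.frac z M k m = u := by
  obtain ⟨v, rfl⟩ := Submodule.mkQ_surjective _ u
  induction v using LocalizedModule.induction_on with
  | h m s =>
    obtain ⟨_, k, rfl⟩ := s
    exact ⟨k, m, rfl⟩

lemma QuotLoc.frac_zero (z : R) (m : M) : QuotLoc.frac z M 0 m = 0 := by
  rw [QuotLoc.frac_apply, Submodule.Quotient.mk_eq_zero]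
  refine ⟨m, ?_⟩
  rw [LocalizedModule.mkLinearMap_apply]
  congr 1
  exact Subtype.ext (pow_zero z).symm

lemma QuotLoc.pow_smul_frac (z : R) (b c : ℕ) (m : M) :
    z ^ c • QuotLoc.frac z M (b + c) m = QuotLoc.frac z M b m := by
  rw [QuotLoc.frac_apply, QuotLoc.frac_apply, ← Submodule.Quotient.mk_smul,
    smul_localizedModule_mk]
  congr 1
  have h := LocalizedModule.mk_cancel_common_left (⟨z ^ c, c, rfl⟩ : Submonoid.powers z)
    (⟨z ^ b, b, rfl⟩ : Submonoid.powers z) m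
  rw [← h]
  congr 1
  exact Subtype.ext (by simp [pow_add, mul_comm])

lemma QuotLoc.exists_pow_smul_eq_zero (z : R) (u : QuotLoc z M) : ∃ t : ℕ, z ^ t • u = 0 := by
  obtain ⟨k, m, rfl⟩ := QuotLoc.exists_frac z u
  refine ⟨k, ?_⟩
  have := QuotLoc.pow_smul_frac z 0 k m
  rw [zero_add] at this
  rw [this, QuotLoc.frac_zero]

lemma QuotLoc.exists_smul_eq (z : R) (u : QuotLoc z M) : ∃ v, z • v = u := by
  obtain ⟨k, m, rfl⟩ := QuotLoc.exists_frac z u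
  refine ⟨QuotLoc.frac z M (k + 1) m, ?_⟩
  have := QuotLoc.pow_smul_frac z k 1 m
  rwa [pow_one] at this

lemma Coh.subsingleton_of_isUnit {z : R} (hz : z ∈ I)
    (h : IsUnit (algebraMap R (Module.End R M) z)) : Subsingleton (Coh I i M) := by
  obtain ⟨φ, hφ⟩ := h.exists_left_inv
  have h1 : ∀ x : Coh I i M, z • x = 0 → x = 0 := by
    intro x hx
    have h2 : φ ∘ₗ (z • LinearMap.id) = LinearMap.id := hφ
    rw [← Coh.map_id x, ← h2, Coh.map_comp, Coh.map_smul_id, hx, LinearMap.map_zero]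
  refine subsingleton_of_forall_eq 0 fun x ↦ ?_
  obtain ⟨t, ht⟩ := Coh.exists_pow_smul_eq_zero hz x
  induction t with
  | zero => simpa using ht
  | succ t ih => exact ih (h1 _ (by rwa [smul_smul, ← pow_succ']))

lemma Coh.subsingleton_localizedModule {z : R} (hz : z ∈ I) :
    Subsingleton (Coh I i (LocalizedModule (Submonoid.powers z) M)) :=
  Coh.subsingleton_of_isUnit hz (IsLocalizedModule.map_units
    (LocalizedModule.mkLinearMap (Submonoid.powers z) M) ⟨z, Submonoid.mem_powers z⟩)

lemma PowTorsion.sup_span_singleton (hM : PowTorsion J M) {z : R}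
    (hz : ∀ m : M, ∃ t : ℕ, z ^ t • m = 0) : PowTorsion (J ⊔ Ideal.span {z}) M := by
  intro m
  obtain ⟨s, hs⟩ := hM m
  obtain ⟨t, ht⟩ := hz m
  refine ⟨s + t, fun r hr ↦ ?_⟩
  have hr' := Ideal.sup_pow_add_le_pow_sup_pow hr
  rw [Ideal.span_singleton_pow] at hr'
  obtain ⟨a, ha, b, hb, rfl⟩ := Submodule.mem_sup.1 hr'
  obtain ⟨c, rfl⟩ := Ideal.mem_span_singleton'.1 hb
  rw [add_smul, hs a ha, mul_smul, ht, smul_zero, add_zero]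

lemma PowTorsion.localizedModule (hM : PowTorsion J M) (S : Submonoid R) :
    PowTorsion J (LocalizedModule S M) := by
  intro v
  induction v using LocalizedModule.induction_on with
  | h m s =>
    obtain ⟨t, ht⟩ := hM m
    exact ⟨t, fun r hr ↦ by
      rw [smul_localizedModule_mk, ht r hr, LocalizedModule.zero_mk]⟩

lemma PowTorsion.quotLoc (hM : PowTorsion J M) (z : R) :
    PowTorsion (J ⊔ Ideal.span {z}) (QuotLoc z M) :=
  ((hM.localizedModule _).of_surjective _ (Submodule.mkQ_surjective _)).sup_span_singleton
    (QuotLoc.exists_pow_smul_eq_zero z)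

lemma PowTorsion.ker_mkLinearMap (hM : PowTorsion J M) (z : R) :
    PowTorsion (J ⊔ Ideal.span {z})
      (LinearMap.ker (LocalizedModule.mkLinearMap (Submonoid.powers z) M)) := by
  refine (hM.of_injective (Submodule.subtype _) Subtype.val_injective).sup_span_singleton ?_
  rintro ⟨m, hm⟩
  obtain ⟨⟨_, t, rfl⟩, ht⟩ := (IsLocalizedModule.eq_zero_iff (Submonoid.powers z)
    (LocalizedModule.mkLinearMap (Submonoid.powers z) M)).1 hm
  exact ⟨t, Subtype.ext ht⟩

lemma exact_range_subtype_mkQ {N : Type} [AddCommGroup N] [Module R N] (f : M →ₗ[R] N) :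
    Function.Exact (LinearMap.range f).subtype (LinearMap.range f).mkQ :=
  exact_subtype_mkQ _

lemma sup_span_cons (J : Ideal R) (z : R) (l : List R) :
    J ⊔ Ideal.span {r | r ∈ z :: l} = J ⊔ Ideal.span {z} ⊔ Ideal.span {r | r ∈ l} := by
  rw [sup_assoc, ← Ideal.span_union]
  congr 2
  ext r
  simp

/-- Local cohomology vanishes above the number of equations. -/
theorem Coh.subsingleton_of_length_lt [IsNoetherianRing R] (l : List R) (hl : ∀ z ∈ l, z ∈ I)
    (hM : PowTorsion J M) (hI : I ≤ (J ⊔ Ideal.span {r | r ∈ l}).radical) (hi : l.length < i) :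
    Subsingleton (Coh I i M) := by
  induction l generalizing J M i with
  | nil =>
    obtain ⟨i, rfl⟩ := Nat.exists_eq_succ_of_ne_zero hi.ne'
    exact Coh.subsingleton_of_powTorsion (hM.mono_radical (by simpa using hI))
  | cons z l ih =>
    rw [sup_span_cons] at hI
    obtain ⟨i, rfl⟩ := Nat.exists_eq_succ_of_ne_zero (Nat.ne_zero_of_lt hi)
    rw [List.length_cons] at hi
    have hl' : ∀ z ∈ l, z ∈ I := fun y hy ↦ hl y (List.mem_cons_of_mem _ hy)
    refine Coh.subsingleton_mid Subtype.val_injective (LinearMap.surjective_rangeRestrict _)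
      (exact_ker_rangeRestrict (LocalizedModule.mkLinearMap (Submonoid.powers z) M))
      (ih hl' (hM.ker_mkLinearMap z) hI (by omega)) ?_
    exact Coh.subsingleton_left Subtype.val_injective (Submodule.mkQ_surjective _)
      (exact_range_subtype_mkQ _) (ih hl' (hM.quotLoc z) hI (by omega))
      (Coh.subsingleton_localizedModule (hl z List.mem_cons_self))

/-- The iterated cokernels of localization maps. -/
noncomputable def tower (l : List R) (M : ModuleCat.{0} R) : ModuleCat.{0} R :=
  l.foldl (fun M z ↦ ModuleCat.of R (QuotLoc z M)) M

lemma tower_append (l l' : List R) (M : ModuleCat.{0} R) :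
    tower (l ++ l') M = tower l' (tower l M) :=
  List.foldl_append

/-- Local cohomology in the top degree as an iterated cokernel of localization maps. -/
theorem Coh.nonempty_equiv_tower [IsNoetherianRing R] (l : List R) (hl : ∀ z ∈ l, z ∈ I)
    (hM : PowTorsion J M) (hI : I ≤ (J ⊔ Ideal.span {r | r ∈ l}).radical) :
    Nonempty (Coh I l.length M ≃ₗ[R] tower l (ModuleCat.of R M)) := by
  induction l generalizing J M with
  | nil =>
    have hM' : PowTorsion I M := hM.mono_radical (by simpa using hI)
    exact ⟨LinearEquiv.ofBijective (Coh.ev I M) ⟨Coh.ev_injective, Coh.ev_surjective hM'⟩⟩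
  | cons z l ih =>
    rw [sup_span_cons] at hI
    have hl' : ∀ z ∈ l, z ∈ I := fun y hy ↦ hl y (List.mem_cons_of_mem _ hy)
    obtain ⟨e⟩ := ih hl' (hM.quotLoc z) hI
    have h₁ := exact_ker_rangeRestrict (LocalizedModule.mkLinearMap (Submonoid.powers z) M)
    have hK : ∀ k, l.length < k → Subsingleton (Coh I k
        (LinearMap.ker (LocalizedModule.mkLinearMap (Submonoid.powers z) M))) := fun k hk ↦
      Coh.subsingleton_of_length_lt l hl' (hM.ker_mkLinearMap z) hI hk
    let e₁ := LinearEquiv.ofBijective (Coh.map I (l.length + 1)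
      (LocalizedModule.mkLinearMap (Submonoid.powers z) M).rangeRestrict)
      ⟨Coh.map_injective Subtype.val_injective (LinearMap.surjective_rangeRestrict _) h₁
        (hK _ (by omega)),
        Coh.map_surjective Subtype.val_injective (LinearMap.surjective_rangeRestrict _) h₁
        (hK _ (by omega))⟩
    obtain ⟨δ, hδ, hδ'⟩ := Coh.exists_connecting I l.length Subtype.val_injective
      (Submodule.mkQ_surjective _)
      (exact_range_subtype_mkQ (LocalizedModule.mkLinearMap (Submonoid.powers z) M))
    have hz : ∀ k, Subsingleton (Coh I k (LocalizedModule (Submonoid.powers z) M)) := fun k ↦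
      Coh.subsingleton_localizedModule (hl z List.mem_cons_self)
    have hbij : Function.Bijective δ := by
      constructor
      · rw [injective_iff_map_eq_zero]
        intro x hx
        obtain ⟨y, rfl⟩ := (hδ x).1 hx
        rw [(hz _).elim y 0, LinearMap.map_zero]
      · exact fun x ↦ (hδ' x).1 ((hz _).elim _ _)
    exact ⟨e₁ ≪≫ₗ (LinearEquiv.ofBijective δ hbij).symm ≪≫ₗ e⟩

/-- The map `m ↦ m / (z₁ ⋯ zₙ) ^ b` to the iterated cokernel. -/
noncomputable def towerFrac : (l : List R) → (M : ModuleCat.{0} R) → ℕ → (M →ₗ[R] tower l M)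
  | [], _, _ => LinearMap.id
  | z :: l, M, b => towerFrac l (ModuleCat.of R (QuotLoc z M)) b ∘ₗ QuotLoc.frac z M b

lemma towerFrac_cons_zero (z : R) (l : List R) (M : ModuleCat.{0} R) (m : M) :
    towerFrac (z :: l) M 0 m = 0 := by
  change towerFrac l (ModuleCat.of R (QuotLoc z M)) 0 (QuotLoc.frac z M 0 m) = 0
  rw [QuotLoc.frac_zero, map_zero]

lemma towerFrac_pow_smul (l : List R) (M : ModuleCat.{0} R) (b c : ℕ) (m : M) :
    towerFrac l M (b + c) (l.prod ^ c • m) = towerFrac l M b m := by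
  induction l generalizing M with
  | nil => simp [towerFrac]
  | cons z l ih =>
    change towerFrac l (ModuleCat.of R (QuotLoc z M)) (b + c) (QuotLoc.frac z M (b + c) _) =
      towerFrac l (ModuleCat.of R (QuotLoc z M)) b (QuotLoc.frac z M b m)
    rw [← ih, ← QuotLoc.pow_smul_frac z b c m, ← map_smul, ← map_smul, smul_smul,
      List.prod_cons, mul_pow, mul_comm]

lemma exists_towerFrac_eq (l : List R) (M : ModuleCat.{0} R) (u : tower l M) :
    ∃ b m, towerFrac l M b m = u := by
  induction l generalizing M with
  | nil => exact ⟨0, u, rfl⟩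
  | cons z l ih =>
    obtain ⟨b, v, rfl⟩ := ih _ u
    obtain ⟨k, m, rfl⟩ := QuotLoc.exists_frac z v
    refine ⟨b + k, l.prod ^ k • z ^ b • m, ?_⟩
    have h : QuotLoc.frac z M (b + k) (l.prod ^ k • z ^ b • m) =
        l.prod ^ k • QuotLoc.frac z M k m := by
      rw [map_smul, map_smul, add_comm b k, QuotLoc.pow_smul_frac]
    exact (congrArg (towerFrac l (ModuleCat.of R (QuotLoc z M)) (b + k)) h).trans
      (towerFrac_pow_smul l (ModuleCat.of R (QuotLoc z M)) b k _)

lemma tower_torsion_divisible {p : R} (l : List R) (M : ModuleCat.{0} R)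
    (h : ∀ m : M, ∃ c : ℕ, p ^ c • m = 0) (h' : ∀ m : M, ∃ m', p • m' = m) :
    (∀ m : tower l M, ∃ c : ℕ, p ^ c • m = 0) ∧ ∀ m : tower l M, ∃ m', p • m' = m := by
  induction l generalizing M with
  | nil => exact ⟨h, h'⟩
  | cons z l ih =>
    refine ih (ModuleCat.of R (QuotLoc z M)) (fun u ↦ ?_) fun u ↦ ?_
    · obtain ⟨k, m, rfl⟩ := QuotLoc.exists_frac z u
      obtain ⟨c, hc⟩ := h m
      exact ⟨c, by rw [← map_smul, hc, map_zero]⟩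
    · obtain ⟨k, m, rfl⟩ := QuotLoc.exists_frac z u
      obtain ⟨m', rfl⟩ := h' m
      exact ⟨QuotLoc.frac z M k m', by rw [← map_smul]⟩

lemma tower_cons_torsion_divisible (p : R) (l : List R) (M : ModuleCat.{0} R) :
    (∀ m : tower (p :: l) M, ∃ c : ℕ, p ^ c • m = 0) ∧
      ∀ m : tower (p :: l) M, ∃ m', p • m' = m :=
  tower_torsion_divisible l (ModuleCat.of R (QuotLoc p M)) (QuotLoc.exists_pow_smul_eq_zero p)
    (QuotLoc.exists_smul_eq p)

end Tower

section Dimension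

variable {R : Type} [CommRing R]

lemma ringKrullDim_quotient_quotient (Q : Ideal R) (r : R) :
    ringKrullDim ((R ⧸ Q) ⧸ Ideal.span {Ideal.Quotient.mk Q r}) =
      ringKrullDim (R ⧸ Q ⊔ Ideal.span {r}) := by
  have h : (Ideal.span {r}).map (Ideal.Quotient.mk Q) = Ideal.span {Ideal.Quotient.mk Q r} := by
    rw [Ideal.map_span, Set.image_singleton]
  rw [← h]
  exact ringKrullDim_eq_of_ringEquiv (DoubleQuot.quotQuotEquivQuotSup Q (Ideal.span {r}))

lemma ringKrullDim_quotient_anti {Q P : Ideal R} (h : Q ≤ P) :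
    ringKrullDim (R ⧸ P) ≤ ringKrullDim (R ⧸ Q) :=
  ringKrullDim_le_of_surjective (Ideal.Quotient.factor h) (Ideal.Quotient.factor_surjective h)

lemma ringKrullDim_quotient_sup_succ_le {P : Ideal R} [P.IsPrime] {r : R} (hr : r ∉ P) :
    ringKrullDim (R ⧸ P ⊔ Ideal.span {r}) + 1 ≤ ringKrullDim (R ⧸ P) := by
  rw [← ringKrullDim_quotient_quotient]
  refine ringKrullDim_quotient_succ_le_of_nonZeroDivisor (mem_nonZeroDivisors_of_ne_zero ?_)
  rwa [Ne, Ideal.Quotient.eq_zero_iff_mem]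

lemma exists_prime_ringKrullDim_eq {Q : Ideal R} {n : ℕ} (h : ringKrullDim (R ⧸ Q) = n) :
    ∃ P : Ideal R, P.IsPrime ∧ Q ≤ P ∧ ringKrullDim (R ⧸ P) = n := by
  have h' := h.ge
  rw [ringKrullDim_quotient, Order.le_krullDim_iff] at h'
  obtain ⟨l, hl⟩ := h'
  have hP : Q ≤ l.head.1.asIdeal := l.head.2
  refine ⟨l.head.1.asIdeal, l.head.1.isPrime, hP,
    le_antisymm ((ringKrullDim_quotient_anti hP).trans h.le) ?_⟩
  rw [ringKrullDim_quotient, Order.le_krullDim_iff]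
  refine ⟨⟨l.length, fun i ↦ ⟨(l i).1, ?_⟩, fun i ↦ l.step i⟩, hl⟩
  exact (l.head_le i : l.head ≤ l i)

variable [IsLocalRing R] [IsNoetherianRing R]

lemma ringKrullDim_quotient_le_sup_succ {Q : Ideal R} (hQ : Q ≤ maximalIdeal R) {r : R}
    (hr : r ∈ maximalIdeal R) :
    ringKrullDim (R ⧸ Q) ≤ ringKrullDim (R ⧸ Q ⊔ Ideal.span {r}) + 1 := by
  have : Nontrivial (R ⧸ Q) := Ideal.Quotient.nontrivial_iff.2
    (ne_top_of_le_ne_top (maximalIdeal.isMaximal R).ne_top hQ)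
  have : IsLocalRing (R ⧸ Q) := .of_surjective' _ Ideal.Quotient.mk_surjective
  rw [← ringKrullDim_quotient_quotient]
  have h := ringKrullDim_le_ringKrullDim_quotient_add_card {Ideal.Quotient.mk Q r} ?_
  · rw [Finset.coe_singleton, Finset.card_singleton, Nat.cast_one] at h
    exact h
  · rw [ringJacobson_eq_maximalIdeal]
    have : IsLocalHom (Ideal.Quotient.mk Q) := .of_surjective _ Ideal.Quotient.mk_surjective
    simpa using hr

lemma exists_list_le_radical {Q : Ideal R} (hQ : Q ≤ maximalIdeal R) {d : ℕ}
    (hd : ringKrullDim (R ⧸ Q) ≤ d) :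
    ∃ l : List R, l.length ≤ d ∧ (∀ z ∈ l, z ∈ maximalIdeal R) ∧
      maximalIdeal R ≤ (Q ⊔ Ideal.span {r | r ∈ l}).radical := by
  have : Nontrivial (R ⧸ Q) := Ideal.Quotient.nontrivial_iff.2
    (ne_top_of_le_ne_top (maximalIdeal.isMaximal R).ne_top hQ)
  have : IsLocalRing (R ⧸ Q) := .of_surjective' _ Ideal.Quotient.mk_surjective
  have : IsLocalHom (Ideal.Quotient.mk Q) := .of_surjective _ Ideal.Quotient.mk_surjective
  obtain ⟨s, hs, hs'⟩ := (maximalIdeal (R ⧸ Q)).exists_finset_card_eq_height_of_isNoetherianRing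
  choose g hg using Ideal.Quotient.mk_surjective (I := Q)
  have hcomap : Q ⊔ Ideal.span {r | r ∈ s.toList.map g} =
      (Ideal.span (s : Set (R ⧸ Q))).comap (Ideal.Quotient.mk Q) := by
    have : Ideal.span (s : Set (R ⧸ Q)) =
        (Ideal.span {r | r ∈ s.toList.map g}).map (Ideal.Quotient.mk Q) := by
      rw [Ideal.map_span]
      congr 1
      ext x
      simp [hg]
    rw [this, Ideal.comap_map_of_surjective' _ Ideal.Quotient.mk_surjective, Ideal.mk_ker, sup_comm]
  refine ⟨s.toList.map g, ?_, ?_, ?_⟩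
  · rw [List.length_map, Finset.length_toList]
    have : ((s.card : ℕ∞) : WithBot ℕ∞) ≤ d := by
      rw [hs', maximalIdeal_height_eq_ringKrullDim]
      exact hd
    exact_mod_cast this
  · intro z hz
    obtain ⟨y, hy, rfl⟩ := List.mem_map.1 hz
    have h1 : y ∈ maximalIdeal (R ⧸ Q) := hs.1.2 (Ideal.subset_span (by simpa using hy))
    rw [← hg y] at h1
    simpa using h1
  · rw [hcomap, ← Ideal.comap_radical]
    intro x hx
    rw [Ideal.mem_comap, Ideal.radical_eq_sInf, Submodule.mem_sInf]
    rintro P ⟨hP, hP'⟩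
    refine hs.2 ⟨hP', hP⟩ (le_maximalIdeal hP'.ne_top) ?_
    simpa using hx

end Dimension

section Melkersson

variable {R : Type} [CommRing R] {T : Type} [AddCommGroup T] [Module R T]

lemma exists_forall_ge_eq [IsArtinian R T] (V : ℕ → Submodule R T) (hV : Antitone V) :
    ∃ n, ∀ m, n ≤ m → V m = V n := by
  obtain ⟨n, hn⟩ := IsArtinian.monotone_stabilizes (R := R) (M := T)
    ⟨fun j ↦ OrderDual.toDual (V j), fun a b h ↦ hV h⟩
  exact ⟨n, fun m hm ↦ (congrArg OrderDual.ofDual (hn m hm)).symm⟩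

lemma exists_forall_ge_eq₂ [IsArtinian R T] (V : ℕ → ℕ → Submodule R T)
    (h₁ : ∀ j, Antitone fun s ↦ V s j) (h₂ : ∀ s, Antitone (V s)) :
    ∃ n, ∀ m, n ≤ m → ∀ s, V s m = V s n := by
  obtain ⟨N, hN⟩ := exists_forall_ge_eq (fun n ↦ V n n)
    fun a b h ↦ (h₁ b h).trans (h₂ a h)
  choose k hk using fun s ↦ exists_forall_ge_eq (V s) (h₂ s)
  have hdiag : ∀ s j, N ≤ s → N ≤ j → V s j = V N N := by
    intro s j hs hj
    refine le_antisymm ((h₁ j hs).trans (h₂ N hj)) ?_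
    rw [← hN (max s j) (hs.trans (le_max_left _ _))]
    exact (h₁ _ (le_max_left s j)).trans (h₂ s (le_max_right s j))
  refine ⟨max N ((Finset.range N).sup k), fun m hm s ↦ ?_⟩
  have hNm : N ≤ m := (le_max_left _ _).trans hm
  by_cases hs : s < N
  · have h : k s ≤ (Finset.range N).sup k := Finset.le_sup (f := k) (Finset.mem_range.2 hs)
    rw [hk s m (h.trans ((le_max_right _ _).trans hm)), hk s _ (h.trans (le_max_right _ _))]
  · rw [hdiag s m (not_lt.1 hs) hNm, hdiag s _ (not_lt.1 hs) (le_max_left _ _)]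

/-- Melkersson's criterion: a module which is torsion with respect to `r` and in which the
kernel of `r` is Artinian is Artinian. -/
theorem isArtinian_of_ker_smul {r : R} (hT : ∀ x : T, ∃ t : ℕ, r ^ t • x = 0) {K : Submodule R T}
    (hK : ∀ x : T, r • x = 0 → x ∈ K) [IsArtinian R K] : IsArtinian R T := by
  rw [← monotone_stabilizes_iff_artinian]
  intro F
  let L : ℕ → Submodule R T := fun j ↦ OrderDual.ofDual (F j)
  have hL : Antitone L := fun a b h ↦ F.monotone h
  let V : ℕ → ℕ → Submodule R K := fun s j ↦
    ((L j).map (r ^ s • (LinearMap.id : T →ₗ[R] T))).comap K.subtype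
  have hV : ∀ s j (y : K), y ∈ V s j ↔ ∃ x ∈ L j, r ^ s • x = y := fun s j y ↦ Iff.rfl
  obtain ⟨n, hn⟩ := exists_forall_ge_eq₂ V
    (by
      intro j a b h y
      simp only [hV]
      rintro ⟨x, hx, hxy⟩
      refine ⟨r ^ (b - a) • x, (L j).smul_mem _ hx, ?_⟩
      rw [smul_smul, ← pow_add, Nat.add_sub_cancel' h, hxy])
    (by
      intro s a b h y
      simp only [hV]
      rintro ⟨x, hx, hxy⟩
      exact ⟨x, hL h hx, hxy⟩)
  refine ⟨n, fun m hm ↦ ?_⟩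
  change L n = L m
  refine le_antisymm (fun x hx ↦ ?_) (hL hm)
  obtain ⟨t, ht⟩ := hT x
  induction t generalizing x with
  | zero =>
    rw [pow_zero, one_smul] at ht
    rw [ht]
    exact zero_mem _
  | succ t ih =>
    have hmem : (⟨r ^ t • x, hK _ (by rwa [smul_smul, ← pow_succ'])⟩ : K) ∈ V t m := by
      rw [hn m hm]
      exact ⟨x, hx, rfl⟩
    obtain ⟨x', hx', h⟩ := hmem
    have h' : r ^ t • x' = r ^ t • x := h
    have := ih (x - x') (sub_mem hx (hL hm hx')) (by rw [smul_sub, h', sub_self])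
    simpa using add_mem this hx'

end Melkersson

section Artinian

variable {R : Type} [CommRing R]

lemma exact_smul_mkQ (M : Type) [AddCommGroup M] [Module R M] (r : R) :
    Function.Exact (r • (LinearMap.id : M →ₗ[R] M))
      (LinearMap.range (r • (LinearMap.id : M →ₗ[R] M))).mkQ :=
  LinearMap.exact_map_mkQ_range _

lemma smul_quotient_injective {P : Ideal R} [P.IsPrime] {r : R} (hr : r ∉ P) :
    Function.Injective (r • (LinearMap.id : (R ⧸ P) →ₗ[R] R ⧸ P)) := by
  rw [injective_iff_map_eq_zero]
  intro x hx
  obtain ⟨a, rfl⟩ := Ideal.Quotient.mk_surjective x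
  have h : Ideal.Quotient.mk P (r * a) = 0 := hx
  rw [Ideal.Quotient.eq_zero_iff_mem] at h ⊢
  exact (Ideal.IsPrime.mem_or_mem ‹_› h).resolve_left hr

lemma smul_quotient_eq_zero {P : Ideal R} {r : R} (hr : r ∈ P) (x : R ⧸ P) : r • x = 0 := by
  obtain ⟨a, rfl⟩ := Ideal.Quotient.mk_surjective x
  change Ideal.Quotient.mk P (r * a) = 0
  exact Ideal.Quotient.eq_zero_iff_mem.2 (P.mul_mem_right a hr)

lemma powTorsion_of_smul_eq_zero {J : Ideal R} {M : Type} [AddCommGroup M] [Module R M]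
    (h : ∀ r ∈ J, ∀ m : M, r • m = 0) : PowTorsion J M :=
  fun m ↦ ⟨1, fun r hr ↦ h r (by rwa [pow_one] at hr) m⟩

variable [IsLocalRing R] [IsNoetherianRing R]

/-- Local cohomology modules of finitely generated modules are Artinian. -/
theorem Coh.isArtinian (i : ℕ) (M : Type) [AddCommGroup M] [Module R M] [Module.Finite R M] :
    IsArtinian R (Coh (maximalIdeal R) i M) := by
  induction i generalizing M with
  | zero =>
    induction ‹Module.Finite R M› using
      IsNoetherianRing.induction_on_isQuotientEquivQuotientPrime R with
    | subsingleton N =>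
      have : Subsingleton (Coh (maximalIdeal R) 0 N) := Coh.subsingleton_of_subsingleton
      infer_instance
    | quotient N P e =>
      suffices IsArtinian R (Coh (maximalIdeal R) 0 (R ⧸ P.1)) from
        isArtinian_of_linearEquiv (Coh.congr _ _ e).symm
      by_cases hP : P.1 = maximalIdeal R
      · rw [hP]
        have : IsSimpleModule R (R ⧸ maximalIdeal R) :=
          isSimpleModule_iff_isCoatom.2 (maximalIdeal.isMaximal R).out
        exact isArtinian_of_injective (Coh.ev (maximalIdeal R) (R ⧸ maximalIdeal R)) Coh.ev_injective
      · obtain ⟨r, hr, hrP⟩ := SetLike.exists_of_lt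
          ((le_maximalIdeal P.2.ne_top).lt_of_ne hP)
        refine isArtinian_of_ker_smul (K := ⊥) (Coh.exists_pow_smul_eq_zero hr) fun x hx ↦ ?_
        rw [Submodule.mem_bot]
        have := P.2
        refine Coh.ev_injective (smul_quotient_injective hrP ?_)
        change r • Coh.ev (maximalIdeal R) (R ⧸ P.1) x = r • Coh.ev (maximalIdeal R) (R ⧸ P.1) 0
        rw [← map_smul, hx, LinearMap.map_zero, smul_zero]
    | exact N₁ N₂ N₃ f g hf hg hfg h₁ h₃ =>
      exact isArtinian_of_range_eq_ker (Coh.map _ _ f) (Coh.map _ _ g)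
        (Coh.exact_mid hf hg hfg).linearMap_ker_eq.symm
  | succ i ih =>
    induction ‹Module.Finite R M› using
      IsNoetherianRing.induction_on_isQuotientEquivQuotientPrime R with
    | subsingleton N =>
      have : Subsingleton (Coh (maximalIdeal R) (i + 1) N) := Coh.subsingleton_of_subsingleton
      infer_instance
    | quotient N P e =>
      suffices IsArtinian R (Coh (maximalIdeal R) (i + 1) (R ⧸ P.1)) from
        isArtinian_of_linearEquiv (Coh.congr _ _ e).symm
      by_cases hP : P.1 = maximalIdeal R
      · rw [hP]
        have : Subsingleton (Coh (maximalIdeal R) (i + 1) (R ⧸ maximalIdeal R)) :=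
          Coh.subsingleton_of_powTorsion
            (powTorsion_of_smul_eq_zero fun _ hr ↦ smul_quotient_eq_zero hr)
        infer_instance
      · obtain ⟨r, hr, hrP⟩ := SetLike.exists_of_lt
          ((le_maximalIdeal P.2.ne_top).lt_of_ne hP)
        have := P.2
        obtain ⟨δ, -, h₂⟩ := Coh.exists_connecting (maximalIdeal R) i
          (smul_quotient_injective hrP) (Submodule.mkQ_surjective _) (exact_smul_mkQ _ r)
        have := ih ((R ⧸ P.1) ⧸ LinearMap.range (r • (LinearMap.id : (R ⧸ P.1) →ₗ[R] _)))
        have : IsArtinian R (LinearMap.range δ) :=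
          isArtinian_of_surjective _ δ.rangeRestrict δ.surjective_rangeRestrict
        refine isArtinian_of_ker_smul (K := LinearMap.range δ)
          (Coh.exists_pow_smul_eq_zero hr) fun x hx ↦ ?_
        exact (h₂ x).1 (by rw [Coh.map_smul_id, hx])
    | exact N₁ N₂ N₃ f g hf hg hfg h₁ h₃ =>
      exact isArtinian_of_range_eq_ker (Coh.map _ _ f) (Coh.map _ _ g)
        (Coh.exact_mid hf hg hfg).linearMap_ker_eq.symm

end Artinian

section NonVanishing

variable {R : Type} [CommRing R]

lemma le_of_add_one_le_natCast {x : WithBot ℕ∞} {n : ℕ} (h : x + 1 ≤ ((n + 1 : ℕ) : WithBot ℕ∞)) :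
    x ≤ n :=
  ENat.WithBot.add_le_add_natCast_right_iff.mp h

lemma smul_quotient_range_eq_zero {P : Ideal R} {r a : R} (ha : a ∈ P ⊔ Ideal.span {r})
    (x : (R ⧸ P) ⧸ LinearMap.range (r • (LinearMap.id : (R ⧸ P) →ₗ[R] R ⧸ P))) :
    a • x = 0 := by
  obtain ⟨b, hb, c, hc, rfl⟩ := Submodule.mem_sup.1 ha
  obtain ⟨d, rfl⟩ := Ideal.mem_span_singleton'.1 hc
  obtain ⟨y, rfl⟩ := Submodule.mkQ_surjective _ x
  rw [← map_smul, add_smul, smul_quotient_eq_zero hb, zero_add, ← LinearMap.mem_ker,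
    Submodule.ker_mkQ]
  exact ⟨d • y, by simp [smul_smul, mul_comm]⟩

variable [IsLocalRing R] [IsNoetherianRing R]

lemma Coh.subsingleton_of_ringKrullDim_le {Q : Ideal R} (hQ : Q ≤ maximalIdeal R) {d i : ℕ}
    (hd : ringKrullDim (R ⧸ Q) ≤ d) (hi : d < i) {M : Type} [AddCommGroup M] [Module R M]
    (hM : ∀ r ∈ Q, ∀ m : M, r • m = 0) : Subsingleton (Coh (maximalIdeal R) i M) := by
  obtain ⟨l, hl, hlm, hrad⟩ := exists_list_le_radical hQ hd
  exact Coh.subsingleton_of_length_lt l hlm (powTorsion_of_smul_eq_zero hM) hrad (hl.trans_lt hi)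

lemma Coh.map_surjective_of_subsingleton {q : Ideal R} [hq : q.IsPrime] {r : R}
    (hr : r ∈ maximalIdeal R) (hrq : r ∉ q) {n : ℕ} (hn : ringKrullDim (R ⧸ q) ≤ (n + 1 : ℕ))
    (h : Subsingleton (Coh (maximalIdeal R) (n + 1) (R ⧸ q)))
    {M : Type} [AddCommGroup M] [Module R M] {f : (R ⧸ q) →ₗ[R] M} (hf : Function.Surjective f)
    (hM : ∀ m : M, r • m = 0) : Function.Surjective (Coh.map (maximalIdeal R) n f) := by
  have h₁ := Coh.map_surjective (smul_quotient_injective hrq) (Submodule.mkQ_surjective _)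
    (exact_smul_mkQ (R ⧸ q) r) h
  let g := (LinearMap.range (r • (LinearMap.id : (R ⧸ q) →ₗ[R] R ⧸ q))).liftQ f (by
    rintro _ ⟨y, rfl⟩
    simp [hM])
  have hg : Function.Surjective g := fun m ↦ by
    obtain ⟨y, rfl⟩ := hf m
    exact ⟨Submodule.mkQ _ y, rfl⟩
  have h₂ : Subsingleton (Coh (maximalIdeal R) (n + 1) (LinearMap.ker g)) := by
    refine Coh.subsingleton_of_ringKrullDim_le (Q := q ⊔ Ideal.span {r}) (d := n)
      (sup_le (le_maximalIdeal hq.ne_top) (by simpa [Ideal.span_le] using hr))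
      (le_of_add_one_le_natCast ((ringKrullDim_quotient_sup_succ_le hrq).trans hn))
      (Nat.lt_succ_self n) fun a ha m ↦ Subtype.ext (smul_quotient_range_eq_zero ha m.1)
  have h₃ := Coh.map_surjective (LinearMap.ker g).injective_subtype hg
    (LinearMap.exact_subtype_ker_map g) h₂
  intro z
  obtain ⟨y, rfl⟩ := h₃ z
  obtain ⟨x, rfl⟩ := h₁ y
  exact ⟨x, by rw [← Coh.map_comp]; rfl⟩

lemma Coh.exists_smul_eq {P : Ideal R} [hP : P.IsPrime] {n : ℕ}
    (hn : ringKrullDim (R ⧸ P) ≤ n) {r : R} (hr : r ∉ P)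
    (z : Coh (maximalIdeal R) n (R ⧸ P)) : ∃ w, r • w = z := by
  by_cases hrm : r ∈ maximalIdeal R
  · have hQ : P ⊔ Ideal.span {r} ≤ maximalIdeal R :=
      sup_le (le_maximalIdeal hP.ne_top) (by simpa [Ideal.span_le] using hrm)
    have : Nontrivial (R ⧸ P ⊔ Ideal.span {r}) := Ideal.Quotient.nontrivial_iff.2
      (ne_top_of_le_ne_top (maximalIdeal.isMaximal R).ne_top hQ)
    have hdim := (ringKrullDim_quotient_sup_succ_le hr).trans hn
    cases n with
    | zero =>
      have h0 : (0 : WithBot ℕ∞) ≤ ringKrullDim (R ⧸ P ⊔ Ideal.span {r}) :=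
        ringKrullDim_nonneg_of_nontrivial
      have : (1 : WithBot ℕ∞) ≤ 0 := by
        simpa using (add_le_add_left h0 1).trans hdim
      exact absurd this (by decide)
    | succ n =>
      have : Subsingleton (Coh (maximalIdeal R) (n + 1) ((R ⧸ P) ⧸ LinearMap.range
          (r • (LinearMap.id : (R ⧸ P) →ₗ[R] R ⧸ P)))) :=
        Coh.subsingleton_of_ringKrullDim_le hQ (le_of_add_one_le_natCast hdim)
          (Nat.lt_succ_self n) fun a ha m ↦ smul_quotient_range_eq_zero ha m
      obtain ⟨w, hw⟩ := (Coh.exact_mid (smul_quotient_injective hr) (Submodule.mkQ_surjective _)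
        (exact_smul_mkQ (R ⧸ P) r) z).1 (Subsingleton.elim _ _)
      exact ⟨w, by rw [← hw, Coh.map_smul_id]⟩
  · obtain ⟨u, rfl⟩ : IsUnit r := by simpa using hrm
    exact ⟨(↑u⁻¹ : R) • z, by rw [smul_smul, Units.mul_inv, one_smul]⟩

end NonVanishing

section NonVanishing

variable {R : Type} [CommRing R]

lemma eq_of_le_of_ringKrullDim_le {Q P : Ideal R} [Q.IsPrime] (h : Q ≤ P) {n : ℕ}
    (hQ : ringKrullDim (R ⧸ Q) ≤ n) (hP : n ≤ ringKrullDim (R ⧸ P)) : Q = P := by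
  by_contra hne
  obtain ⟨r, hr, hrQ⟩ := SetLike.exists_of_lt (h.lt_of_ne hne)
  have h₁ : (n : WithBot ℕ∞) ≤ ringKrullDim (R ⧸ Q ⊔ Ideal.span {r}) :=
    hP.trans (ringKrullDim_quotient_anti (sup_le h (by simpa [Ideal.span_le] using hr)))
  have h₂ : ((n + 1 : ℕ) : WithBot ℕ∞) ≤ n := by
    rw [Nat.cast_add, Nat.cast_one]
    exact (ENat.WithBot.add_le_add_one_right_iff.2 h₁).trans
      ((ringKrullDim_quotient_sup_succ_le hrQ).trans hQ)
  have : n + 1 ≤ n := by exact_mod_cast h₂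
  omega

variable [IsLocalRing R]

lemma ringKrullDim_quotient_maximalIdeal : ringKrullDim (R ⧸ maximalIdeal R) = 0 :=
  ringKrullDim_eq_zero_of_field (ResidueField R)

lemma ne_maximalIdeal_of_ringKrullDim_eq {P : Ideal R} {n : ℕ}
    (h : ringKrullDim (R ⧸ P) = (n + 1 : ℕ)) : P ≠ maximalIdeal R := by
  rintro rfl
  rw [ringKrullDim_quotient_maximalIdeal] at h
  have : 0 = n + 1 := by exact_mod_cast h
  omega

lemma Coh.nontrivial_zero_residue : Nontrivial (Coh (maximalIdeal R) 0 (R ⧸ maximalIdeal R)) :=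
  (Coh.ev_surjective (powTorsion_of_smul_eq_zero fun _ hr ↦ smul_quotient_eq_zero hr)).nontrivial

lemma Coh.subsingleton_zero {q : Ideal R} [q.IsPrime] (hq : q ≠ maximalIdeal R) :
    Subsingleton (Coh (maximalIdeal R) 0 (R ⧸ q)) := by
  obtain ⟨r, hr, hrq⟩ := SetLike.exists_of_lt
    ((le_maximalIdeal (Ideal.IsPrime.ne_top ‹_›)).lt_of_ne hq)
  refine subsingleton_of_forall_eq 0 fun x ↦ ?_
  obtain ⟨t, ht⟩ := Coh.exists_pow_smul_eq_zero hr x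
  have hrt : r ^ t ∉ q := fun h ↦ hrq (Ideal.IsPrime.mem_of_pow_mem ‹_› t h)
  refine Coh.ev_injective (smul_quotient_injective hrt ?_)
  change r ^ t • Coh.ev (maximalIdeal R) (R ⧸ q) x = r ^ t • Coh.ev (maximalIdeal R) (R ⧸ q) 0
  rw [← map_smul, ht, LinearMap.map_zero, smul_zero]

variable [IsNoetherianRing R]

/-- If `H^{k+2}_m(R/q)` vanished, then only finitely many primes `P ⊇ q` would have
`dim R/P = k + 1`. -/
lemma Coh.finite_of_subsingleton {q : Ideal R} [q.IsPrime] {k : ℕ}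
    (h : ringKrullDim (R ⧸ q) = (k + 2 : ℕ))
    (hsub : Subsingleton (Coh (maximalIdeal R) (k + 2) (R ⧸ q)))
    (ih : ∀ P : Ideal R, P.IsPrime → ringKrullDim (R ⧸ P) = (k + 1 : ℕ) →
      Nontrivial (Coh (maximalIdeal R) (k + 1) (R ⧸ P))) :
    {P : Ideal R | P.IsPrime ∧ q ≤ P ∧ ringKrullDim (R ⧸ P) = (k + 1 : ℕ)}.Finite := by
  classical
  let G := {P : Ideal R // P.IsPrime ∧ q ≤ P ∧ ringKrullDim (R ⧸ P) = (k + 1 : ℕ)}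
  let π : ∀ P : G, (R ⧸ q) →ₗ[R] R ⧸ P.1 := fun P ↦ Submodule.factor P.2.2.1
  let K : G → Submodule R (Coh (maximalIdeal R) (k + 1) (R ⧸ q)) :=
    fun P ↦ LinearMap.ker (Coh.map (maximalIdeal R) (k + 1) (π P))
  have hsurj : ∀ P : G, Function.Surjective (Coh.map (maximalIdeal R) (k + 1) (π P)) := by
    intro P
    have hne : q ≠ P.1 := by
      intro hqP
      have h' := h
      rw [hqP, P.2.2.2] at h'
      have : k + 1 = k + 2 := by exact_mod_cast h'
      omega
    obtain ⟨r, hr, hrq⟩ := SetLike.exists_of_lt (P.2.2.1.lt_of_ne hne)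
    exact Coh.map_surjective_of_subsingleton (le_maximalIdeal P.2.1.ne_top hr) hrq h.le hsub
      (Submodule.factor_surjective _) (smul_quotient_eq_zero hr)
  have := Coh.isArtinian (R := R) (k + 1) (R ⧸ q)
  obtain ⟨_, ⟨F, rfl⟩, hF⟩ := IsArtinian.set_has_minimal (R := R)
    (Set.range fun F : Finset G ↦ F.inf K) (Set.range_nonempty _)
  have hFK : ∀ P, F.inf K ≤ K P := by
    intro P
    have h₁ : (insert P F).inf K ≤ F.inf K := Finset.inf_mono (Finset.subset_insert P F)
    have h₂ := eq_of_le_of_not_lt h₁ (hF _ ⟨insert P F, rfl⟩)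
    rw [← h₂]
    exact Finset.inf_le (Finset.mem_insert_self P F)
  suffices hmem : ∀ P : G, P ∈ F from
    (F.image Subtype.val).finite_toSet.subset fun P hP ↦
      Finset.mem_coe.2 (Finset.mem_image_of_mem Subtype.val (hmem ⟨P, hP⟩))
  intro P
  have hP := P.2.1
  by_contra hPF
  obtain ⟨s, hs, hsP⟩ : ∃ s ∈ F.inf Subtype.val, s ∉ P.1 := by
    refine SetLike.not_le_iff_exists.1 fun hle ↦ ?_
    obtain ⟨P', hP', hle'⟩ := (Ideal.IsPrime.inf_le' hP).1 hle
    have := P'.2.1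
    have heq := eq_of_le_of_ringKrullDim_le hle' P'.2.2.2.le P.2.2.2.ge
    exact hPF (Subtype.ext heq ▸ hP')
  have := ih P.1 P.2.1 P.2.2.2
  obtain ⟨z, hz⟩ := exists_ne (0 : Coh (maximalIdeal R) (k + 1) (R ⧸ P.1))
  obtain ⟨w, rfl⟩ := Coh.exists_smul_eq P.2.2.2.le hsP z
  obtain ⟨t, rfl⟩ := hsurj P w
  refine hz ?_
  rw [← map_smul]
  refine hFK P ((Submodule.mem_finsetInf).2 fun P' hP' ↦ ?_)
  change Coh.map _ _ (π P') (s • t) = 0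
  rw [map_smul]
  exact Coh.smul_eq_zero (smul_quotient_eq_zero ((Submodule.mem_finsetInf).1 hs P' hP')) _

/-- Grothendieck's non-vanishing theorem for quotients by prime ideals. -/
theorem Coh.nontrivial_of_ringKrullDim_eq (n : ℕ) {q : Ideal R} (hq : q.IsPrime)
    (h : ringKrullDim (R ⧸ q) = n) : Nontrivial (Coh (maximalIdeal R) n (R ⧸ q)) := by
  classical
  induction n generalizing q with
  | zero =>
    obtain rfl := eq_of_le_of_ringKrullDim_le (le_maximalIdeal hq.ne_top) h.le
      ringKrullDim_quotient_maximalIdeal.ge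
    exact Coh.nontrivial_zero_residue
  | succ n ih =>
    have hne := ne_maximalIdeal_of_ringKrullDim_eq h
    by_contra hsub
    rw [not_nontrivial_iff_subsingleton] at hsub
    cases n with
    | zero =>
      obtain ⟨r, hr, hrq⟩ := SetLike.exists_of_lt ((le_maximalIdeal hq.ne_top).lt_of_ne hne)
      have := Coh.map_surjective_of_subsingleton hr hrq h.le hsub
        (f := Submodule.factor (le_maximalIdeal hq.ne_top)) (Submodule.factor_surjective _)
        (smul_quotient_eq_zero hr)
      have h₀ := Coh.subsingleton_zero hne
      have h₁ := this.subsingleton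
      exact not_nontrivial_iff_subsingleton.2 h₁ Coh.nontrivial_zero_residue
    | succ k =>
      have hfin := Coh.finite_of_subsingleton h hsub fun P hP hd ↦ ih hP hd
      obtain ⟨r, hr, hrS⟩ : ∃ r ∈ maximalIdeal R, ∀ P ∈ insert q hfin.toFinset, r ∉ P := by
        by_contra! hcon
        obtain ⟨P, hP, hle⟩ := (Ideal.subset_union_prime (s := insert q hfin.toFinset)
          (f := fun P ↦ P) (I := maximalIdeal R) q q (fun P hP hPq _ ↦
            (hfin.mem_toFinset.1 ((Finset.mem_insert.1 hP).resolve_left hPq)).1)).1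
          (fun r hr ↦ by simpa using hcon r hr)
        have hP' : P ≠ maximalIdeal R ∧ P ≠ ⊤ := by
          rcases Finset.mem_insert.1 hP with rfl | hP
          · exact ⟨hne, hq.ne_top⟩
          · have := hfin.mem_toFinset.1 hP
            exact ⟨ne_maximalIdeal_of_ringKrullDim_eq this.2.2, this.1.ne_top⟩
        exact hP'.1 (le_antisymm (le_maximalIdeal hP'.2) hle)
      have hrq := hrS q (Finset.mem_insert_self _ _)
      have hd : ringKrullDim (R ⧸ q ⊔ Ideal.span {r}) = (k + 1 : ℕ) := by
        refine le_antisymm (le_of_add_one_le_natCast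
          ((ringKrullDim_quotient_sup_succ_le hrq).trans h.le)) ?_
        have := h.ge.trans (ringKrullDim_quotient_le_sup_succ (le_maximalIdeal hq.ne_top) hr)
        exact ENat.WithBot.add_le_add_natCast_right_iff.mp this
      obtain ⟨P, hP, hle, hPd⟩ := exists_prime_ringKrullDim_eq hd
      refine hrS P (Finset.mem_insert_of_mem
        (hfin.mem_toFinset.2 ⟨hP, le_sup_left.trans hle, hPd⟩)) (hle ?_)
      exact Ideal.mem_sup_right (Ideal.mem_span_singleton_self r)

end NonVanishing

section Assembly

variable {R : Type} [CommRing R] {N U E : Type} [AddCommGroup N] [Module R N] [AddCommGroup U]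
  [Module R U] [AddCommGroup E] [Module R E]

/-- The sum `h ↦ ∑ₛ φ (τ_{s²} (p^{s²} h))` of a system of maps out of a `p`-torsion module. -/
noncomputable def squareSum (p : R) (hp : ∀ h : N, ∃ c : ℕ, p ^ c • h = 0)
    (φ : ℕ → (N →ₗ[R] E)) : N →ₗ[R] E :=
  have hfin (h : N) : (Function.support fun s ↦ φ (s ^ 2) (p ^ s ^ 2 • h)).Finite := by
    obtain ⟨c, hc⟩ := hp h
    refine (Set.finite_lt_nat c).subset fun s hs ↦ ?_
    by_contra hsc
    have hle : c ≤ s ^ 2 := (not_lt.1 hsc).trans (Nat.le_self_pow two_ne_zero s)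
    refine hs ?_
    change φ (s ^ 2) (p ^ s ^ 2 • h) = 0
    rw [← Nat.sub_add_cancel hle, pow_add, mul_smul, hc, smul_zero, map_zero]
  { toFun := fun h ↦ ∑ᶠ s, φ (s ^ 2) (p ^ s ^ 2 • h)
    map_add' := fun a b ↦ by
      rw [← finsum_add_distrib (hfin a) (hfin b)]
      simp
    map_smul' := fun r a ↦ by
      rw [RingHom.id_apply, smul_finsum' r (hfin a)]
      refine finsum_congr fun s ↦ ?_
      rw [smul_comm, map_smul] }

lemma squareSum_apply (p : R) (hp : ∀ h : N, ∃ c : ℕ, p ^ c • h = 0)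
    (φ : ℕ → (N →ₗ[R] E)) (h : N) : squareSum p hp φ h = ∑ᶠ s, φ (s ^ 2) (p ^ s ^ 2 • h) :=
  rfl

lemma exists_pow_smul_eq {p : R} (hp : ∀ h : N, ∃ h', p • h' = h) (k : ℕ) (h : N) :
    ∃ h', p ^ k • h' = h := by
  induction k generalizing h with
  | zero => exact ⟨h, by simp⟩
  | succ k ih =>
    obtain ⟨a, rfl⟩ := ih h
    obtain ⟨b, rfl⟩ := hp a
    exact ⟨b, by rw [pow_succ, mul_smul]⟩

/-- Every element of the image of `φ` is a value of `squareSum`. -/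
lemma exists_squareSum_eq {p ω : R} (hp : ∀ h : N, ∃ c : ℕ, p ^ c • h = 0)
    (hp' : ∀ h : N, ∃ h', p • h' = h) (τ : ℕ → (N →ₗ[R] U)) (hτ₀ : ∀ h, τ 0 h = 0)
    (hτ : ∀ b c h, τ (b + c) (ω ^ c • h) = τ b h) (hτs : ∀ u, ∃ b h, τ b h = u)
    (φ : U →ₗ[R] E) (u : U) : ∃ h, squareSum p hp (fun s ↦ φ ∘ₗ τ s) h = φ u := by
  obtain ⟨b, g, rfl⟩ := hτs u
  obtain ⟨c, hc⟩ := hp g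
  obtain ⟨t, htb, htc⟩ : ∃ t, b ≤ 2 * t + 1 ∧ c ≤ 2 * t + 3 := ⟨b + c, by omega, by omega⟩
  obtain ⟨h, hh⟩ := exists_pow_smul_eq hp' ((t + 1) ^ 2) (ω ^ (2 * t + 1 - b) • g)
  refine ⟨ω ^ t ^ 2 • h, ?_⟩
  rw [squareSum_apply, finsum_eq_single _ (t + 1)]
  · rw [smul_comm, hh, show (t + 1) ^ 2 = (2 * t + 1) + t ^ 2 by ring, LinearMap.comp_apply, hτ]
    obtain ⟨d, hd⟩ := Nat.exists_eq_add_of_le htb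
    rw [hd, Nat.add_sub_cancel_left, hτ]
  · intro k hk
    rcases Nat.lt_or_gt_of_ne hk with hk | hk
    · obtain ⟨d, hd⟩ := Nat.exists_eq_add_of_le (Nat.pow_le_pow_left (Nat.lt_succ_iff.1 hk) 2)
      have := hτ 0 (k ^ 2) (ω ^ d • p ^ k ^ 2 • h)
      rw [zero_add, hτ₀, smul_smul, ← pow_add, ← hd] at this
      rw [smul_comm, LinearMap.comp_apply, this, map_zero]
    · have hle : c + (t + 1) ^ 2 ≤ k ^ 2 := by nlinarith
      have h₀ : p ^ k ^ 2 • h = 0 := by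
        rw [← Nat.sub_add_cancel hle, pow_add, mul_smul, pow_add, mul_smul, hh,
          smul_comm (p ^ c), hc, smul_zero, smul_zero]
      rw [smul_comm, h₀, smul_zero, map_zero]

lemma exists_apply_ne_zero [IsLocalRing R] (hE : IsInjectiveHullOfResidueField R E) {u : U}
    (hu : u ≠ 0) : ∃ φ : U →ₗ[R] E, φ u ≠ 0 := by
  obtain ⟨hinj, f, hf, -⟩ := hE
  have hker : LinearMap.ker (LinearMap.toSpanSingleton R U u) ≤
      LinearMap.ker (Algebra.linearMap R (ResidueField R)) := by
    intro r hr
    change residue R r = 0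
    rw [residue_eq_zero_iff]
    by_contra hrm
    obtain ⟨v, rfl⟩ : IsUnit r := by simpa using hrm
    refine hu ?_
    have : (v : R) • u = 0 := hr
    rw [← one_smul R u, ← Units.inv_mul v, mul_smul, this, smul_zero]
  obtain ⟨φ, hφ⟩ := hinj.out
    ((LinearMap.ker (LinearMap.toSpanSingleton R U u)).liftQ _ le_rfl)
    (LinearMap.ker_eq_bot.1 (Submodule.ker_liftQ_eq_bot _ _ _ le_rfl))
    (f ∘ₗ (LinearMap.ker (LinearMap.toSpanSingleton R U u)).liftQ _ hker)
  refine ⟨φ, fun h ↦ ?_⟩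
  have := hφ (Submodule.mkQ _ 1)
  simp only [Submodule.mkQ_apply, Submodule.liftQ_apply, LinearMap.toSpanSingleton_apply, one_smul,
    LinearMap.comp_apply, h, Algebra.linearMap_apply, map_one] at this
  exact one_ne_zero (hf (this.symm.trans f.map_zero.symm))

variable [IsLocalRing R] [IsNoetherianRing R]

lemma exists_hom_tower (hE : IsInjectiveHullOfResidueField R E) {q : Ideal R} [q.IsPrime]
    {l : List R} (hd : ringKrullDim (R ⧸ q) = l.length) (hl : ∀ z ∈ l, z ∈ maximalIdeal R)
    (hrad : maximalIdeal R ≤ (q ⊔ Ideal.span {r | r ∈ l}).radical) :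
    ∃ φ : tower l (ModuleCat.of R (R ⧸ q)) →ₗ[R] E, ∀ r : R, (∀ u, r • φ u = 0) → r ∈ q := by
  obtain ⟨e⟩ := Coh.nonempty_equiv_tower l hl
    (powTorsion_of_smul_eq_zero fun _ hr ↦ smul_quotient_eq_zero hr) hrad
  have := Coh.nontrivial_of_ringKrullDim_eq l.length ‹q.IsPrime› hd
  obtain ⟨z, hz⟩ := exists_ne (0 : Coh (maximalIdeal R) l.length (R ⧸ q))
  obtain ⟨φ, hφ⟩ := exists_apply_ne_zero (u := e z) hE (by simpa using hz)
  refine ⟨φ, fun r hr ↦ ?_⟩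
  by_contra hrq
  obtain ⟨w, rfl⟩ := Coh.exists_smul_eq hd.le hrq z
  exact hφ (by rw [map_smul, map_smul, hr])

lemma exists_hom_tower_of_append (hE : IsInjectiveHullOfResidueField R E) {q : Ideal R} [q.IsPrime]
    {p : R} {l l' : List R} (hd : ringKrullDim (R ⧸ q) = (p :: l ++ l').length)
    (hl : ∀ z ∈ p :: l ++ l', z ∈ maximalIdeal R)
    (hrad : maximalIdeal R ≤ (q ⊔ Ideal.span {r | r ∈ p :: l ++ l'}).radical) :
    ∃ φ : tower (p :: l) (ModuleCat.of R (R ⧸ q)) →ₗ[R] E,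
      ∀ r : R, (∀ u, r • φ u = 0) → r ∈ q := by
  have h := exists_hom_tower hE hd hl hrad
  rw [tower_append] at h
  obtain ⟨φ, hφ⟩ := h
  cases l' with
  | nil => exact ⟨φ, hφ⟩
  | cons z l' =>
    obtain ⟨h₁, h₂⟩ := tower_cons_torsion_divisible p l (ModuleCat.of R (R ⧸ q))
    refine ⟨squareSum p h₁ fun s ↦ φ ∘ₗ towerFrac (z :: l') _ s, fun r hr ↦ hφ r fun u ↦ ?_⟩
    obtain ⟨h, hh⟩ := exists_squareSum_eq h₁ h₂ (towerFrac (z :: l') _)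
      (towerFrac_cons_zero z l' _) (towerFrac_pow_smul (z :: l') _)
      (exists_towerFrac_eq (z :: l') _) φ u
    rw [← hh, hr]

end Assembly

section Duality

variable {R : Type} [CommRing R] [IsNoetherianRing R] {E : Type} [AddCommGroup E] [Module R E]

/-- A map from the top local cohomology of `R / q` whose annihilator is `q` exhibits `q` as an
associated prime of the Matlis dual of the top local cohomology of `R`. -/
lemma mem_associatedPrimes_of_hom_tower {I q : Ideal R} [hq : q.IsPrime] {l : List R}
    (hl : Ideal.span {r | r ∈ l} = I)
    (φ : tower l (ModuleCat.of R (R ⧸ q)) →ₗ[R] E) (hφ : ∀ r : R, (∀ u, r • φ u = 0) → r ∈ q) :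
    q ∈ associatedPrimes R (LocalCohomologyModule I l.length R →ₗ[R] E) := by
  have hlI : ∀ z ∈ l, z ∈ I := fun z hz ↦ hl ▸ Ideal.subset_span hz
  have hrad : I ≤ ((⊥ : Ideal R) ⊔ Ideal.span {r | r ∈ l}).radical := by
    rw [bot_sup_eq, hl]
    exact Ideal.le_radical
  have htor (M : Type) [AddCommGroup M] [Module R M] : PowTorsion (⊥ : Ideal R) M :=
    powTorsion_of_smul_eq_zero fun r hr m ↦ by rw [Ideal.mem_bot.1 hr, zero_smul]
  obtain ⟨f, hf⟩ := exists_surjective_localCohomology I l.length R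
  have hg : Function.Surjective (Coh.map I l.length (Submodule.mkQ q)) :=
    Coh.map_surjective q.injective_subtype q.mkQ_surjective (exact_subtype_mkQ q)
      (Coh.subsingleton_of_length_lt l hlI (htor _) hrad (Nat.lt_succ_self _))
  obtain ⟨e⟩ := Coh.nonempty_equiv_tower l hlI (htor (R ⧸ q)) hrad
  let ψ : LocalCohomologyModule I l.length R →ₗ[R] E :=
    φ ∘ₗ e.toLinearMap ∘ₗ Coh.map I l.length (Submodule.mkQ q) ∘ₗ f
  have hψ : (⊥ : Submodule R (LocalCohomologyModule I l.length R →ₗ[R] E)).colon {ψ} = q := by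
    ext r
    rw [Submodule.mem_colon_singleton, Submodule.mem_bot]
    constructor
    · refine fun h ↦ hφ r fun u ↦ ?_
      obtain ⟨y, rfl⟩ := e.surjective u
      obtain ⟨z, rfl⟩ := hg y
      obtain ⟨x, rfl⟩ := hf z
      exact LinearMap.congr_fun h x
    · intro h
      ext x
      change r • φ (e _) = 0
      rw [← map_smul, ← map_smul, Coh.smul_eq_zero (smul_quotient_eq_zero h),
        LinearEquiv.map_zero, LinearMap.map_zero]
  exact Submodule.isAssociatedPrime_def.2 ⟨hq, ψ, by rw [hψ, hq.radical]⟩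

end Duality

lemma exists_list_of_isPartOfSystemOfParameters {R : Type} [CommRing R] [IsLocalRing R]
    {q : Ideal R} {i : ℕ} {x : Fin i → R} (h : IsPartOfSystemOfParameters q x) :
    ∃ l : List R, ringKrullDim (R ⧸ q) = (List.ofFn x ++ l).length ∧
      (∀ z ∈ List.ofFn x ++ l, z ∈ maximalIdeal R) ∧
      maximalIdeal R ≤ (q ⊔ Ideal.span {r | r ∈ List.ofFn x ++ l}).radical := by
  obtain ⟨n, hin, y, hy, hd, hrad⟩ := h
  obtain ⟨k, rfl⟩ := Nat.exists_eq_add_of_le hin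
  have happ : List.ofFn x ++ List.ofFn (fun j : Fin k ↦ y (Fin.natAdd i j)) = List.ofFn y := by
    rw [← List.ofFn_fin_append]
    congr 1
    funext j
    refine Fin.addCases (fun j ↦ ?_) (fun j ↦ ?_) j
    · rw [Fin.append_left, ← hy j]
      rfl
    · rw [Fin.append_right]
  have hset : {r | r ∈ List.ofFn y} = Set.range y := by
    ext r
    simp
  refine ⟨List.ofFn fun j : Fin k ↦ y (Fin.natAdd i j), ?_⟩
  rw [happ, List.length_ofFn, hset]
  refine ⟨hd, fun z hz ↦ ?_, hrad.ge⟩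
  rw [← hrad]
  exact Ideal.le_radical (Ideal.mem_sup_right (Ideal.subset_span (hset ▸ hz)))

end LocCoh

/-- Theorem 2.2.3, first inclusion: Let `(R,m)` be a noetherian local ring of
mixed characteristic with `p = char(R/m)` (so `char R = 0` and `char (R/m) = p > 0`),
`i ≥ 0` and `x_1,…,x_i ∈ R`.  Then every prime `q` such that `p, x_1,…,x_i` is part of a
system of parameters for `R/q` is an associated prime of `D(H^{i+1}_{(p,x_1,…,x_i)R}(R))`. -/
theorem stmt10 (R : Type) [CommRing R] [IsLocalRing R] [IsNoetherianRing R] [CharZero R]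
    (p : ℕ) (hp : p.Prime) [CharP (ResidueField R) p]
    (i : ℕ) (x : Fin i → R)
    (E : Type) [AddCommGroup E] [Module R E] (hE : IsInjectiveHullOfResidueField R E) :
    { q : Ideal R | q.IsPrime ∧ IsPartOfSystemOfParameters q (Fin.cons (p : R) x) } ⊆
      associatedPrimes R
        (LocalCohomologyModule (Ideal.span ({(p : R)} ∪ Set.range x)) (i + 1) R →ₗ[R] E) := by
  rintro q ⟨hq, hsop⟩
  obtain ⟨l, hd, hl, hrad⟩ := LocCoh.exists_list_of_isPartOfSystemOfParameters hsop
  rw [List.ofFn_cons] at hd hl hrad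
  obtain ⟨φ, hφ⟩ := LocCoh.exists_hom_tower_of_append hE hd hl hrad
  have hspan : Ideal.span {r | r ∈ (p : R) :: List.ofFn x} =
      Ideal.span ({(p : R)} ∪ Set.range x) := by
    congr 1
    ext r
    simp
  have h := LocCoh.mem_associatedPrimes_of_hom_tower hspan φ hφ
  rwa [List.length_cons, List.length_ofFn] at h
end

section
/- Let (R,m) be a noetherian local ring of mixed characteristic with p = char(R/m) (so char(R) = 0 and char(R/m) = p > 0), i ≥ 1, and x_1,…,x_i ∈ R. Then { q ∈ Spec(R) : the images of p, x_1,…,x_i in R/q are part of a system of parameters for R/q } ⊆ Ass_R(D(H^i_{(x_1,…,x_i)R}(R))). -/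
open IsLocalRing

open CategoryTheory Limits

section Generic
variable {D : Type*} [Category* D]

lemma exists_exact_of_isos [HasZeroMorphisms D] {A₁ A₂ A₃ B₁ B₂ B₃ : D} (e₁ : A₁ ≅ B₁) (e₂ : A₂ ≅ B₂)
    (e₃ : A₃ ≅ B₃)
    {f : A₁ ⟶ A₂} {g : A₂ ⟶ A₃} {f' : B₁ ⟶ B₂} {g' : B₂ ⟶ B₃} (w' : f' ≫ g' = 0)
    (hex : (ShortComplex.mk f' g' w').Exact) (hf : f = e₁.hom ≫ f' ≫ e₂.inv)
    (hg : g = e₂.hom ≫ g' ≫ e₃.inv) : ∃ w, (ShortComplex.mk f g w).Exact := by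
  subst hf hg
  refine ⟨by simp [reassoc_of% w'], (ShortComplex.exact_iff_of_iso
    (ShortComplex.isoMk e₁ e₂ e₃ ?_ ?_)).mpr hex⟩ <;> simp

lemma conj_naturality {X₃ Y₃ X₁ Y₁ A₃ B₃ A₁ B₁ : D} (eX₃ : X₃ ≅ A₃) (eY₃ : Y₃ ≅ B₃)
    (eX₁ : X₁ ≅ A₁) (eY₁ : Y₁ ≅ B₁) {F₃ : X₃ ⟶ Y₃} {F₁ : X₁ ⟶ Y₁} {m₃ : A₃ ⟶ B₃} {m₁ : A₁ ⟶ B₁}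
    {dX : A₃ ⟶ A₁} {dY : B₃ ⟶ B₁} (h₃ : F₃ ≫ eY₃.hom = eX₃.hom ≫ m₃)
    (h₁ : eX₁.inv ≫ F₁ = m₁ ≫ eY₁.inv) (h : dX ≫ m₁ = m₃ ≫ dY) :
    F₃ ≫ (eY₃.hom ≫ dY ≫ eY₁.inv) = (eX₃.hom ≫ dX ≫ eX₁.inv) ≫ F₁ := by
  rw [reassoc_of% h₃, Category.assoc, Category.assoc, h₁, reassoc_of% h]
end Generic

section LeftDerivedSequence

variable {C D : Type*} [Category* C] [Category* D] [Abelian C] [HasProjectiveResolutions C]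
  [Abelian D] {F₁ F₂ F₃ : C ⥤ D} [F₁.Additive] [F₂.Additive] [F₃.Additive]

/-- A pair of natural transformations whose composition vanishes, evaluated on the terms of a
projective resolution. -/
noncomputable def leftDerivedShortComplex (α : F₁ ⟶ F₂) (β : F₂ ⟶ F₃) (w : α ≫ β = 0)
    {X : C} (P : ProjectiveResolution X) : ShortComplex (ChainComplex D ℕ) :=
  ShortComplex.mk ((NatTrans.mapHomologicalComplex α _).app P.complex)
    ((NatTrans.mapHomologicalComplex β _).app P.complex) (by
      ext i
      exact congr_app w (P.complex.X i))

lemma leftDerivedShortComplex_shortExact (α : F₁ ⟶ F₂) (β : F₂ ⟶ F₃) (w : α ≫ β = 0)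
    (h : ∀ (Q : C) [Projective Q],
      (ShortComplex.mk (α.app Q) (β.app Q) (congr_app w Q)).ShortExact)
    {X : C} (P : ProjectiveResolution X) :
    (leftDerivedShortComplex α β w P).ShortExact :=
  HomologicalComplex.shortExact_of_degreewise_shortExact _ fun i => h (P.complex.X i)

lemma exists_leftDerived_connecting (α : F₁ ⟶ F₂) (β : F₂ ⟶ F₃) (w : α ≫ β = 0)
    (h : ∀ (Q : C) [Projective Q],
      (ShortComplex.mk (α.app Q) (β.app Q) (congr_app w Q)).ShortExact) (n : ℕ) :
    ∃ (δ : F₃.leftDerived (n + 1) ⟶ F₁.leftDerived n),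
      (∀ X, ∃ e, (ShortComplex.mk ((NatTrans.leftDerived β (n + 1)).app X) (δ.app X) e).Exact) ∧
      (∀ X, ∃ e, (ShortComplex.mk (δ.app X) ((NatTrans.leftDerived α n).app X) e).Exact) := by
  let S := fun X => leftDerivedShortComplex α β w (projectiveResolution X)
  have hS : ∀ X, (S X).ShortExact := fun X => leftDerivedShortComplex_shortExact α β w h _
  let d : ∀ X, (F₃.leftDerived (n + 1)).obj X ⟶ (F₁.leftDerived n).obj X := fun X =>
    ((projectiveResolution X).isoLeftDerivedObj F₃ (n + 1)).hom ≫
      (hS X).δ (n + 1) n (by simp) ≫ ((projectiveResolution X).isoLeftDerivedObj F₁ n).inv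
  refine ⟨⟨d, ?_⟩, ?_, ?_⟩
  · intro X Y f
    obtain ⟨φ, comm⟩ : ∃ φ : (projectiveResolution X).complex ⟶ (projectiveResolution Y).complex,
        φ.f 0 ≫ (projectiveResolution Y).π.f 0 = (projectiveResolution X).π.f 0 ≫ f :=
      ⟨ProjectiveResolution.lift f (projectiveResolution X) (projectiveResolution Y),
        ProjectiveResolution.lift_commutes_zero _ _ _⟩
    let Φ : S X ⟶ S Y :=
      { τ₁ := (F₁.mapHomologicalComplex _).map φ
        τ₂ := (F₂.mapHomologicalComplex _).map φ
        τ₃ := (F₃.mapHomologicalComplex _).map φ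
        comm₁₂ := (NatTrans.mapHomologicalComplex α _).naturality φ
        comm₂₃ := (NatTrans.mapHomologicalComplex β _).naturality φ }
    have hnat := HomologicalComplex.HomologySequence.δ_naturality Φ (hS X) (hS Y) (n + 1) n
      (by simp)
    have h3 := ProjectiveResolution.isoLeftDerivedObj_hom_naturality f _ _ φ comm F₃ (n + 1)
    have h1 := ProjectiveResolution.isoLeftDerivedObj_inv_naturality f _ _ φ comm F₁ n
    exact conj_naturality _ _ _ _ h3 h1 hnat
  · intro X
    exact exists_exact_of_isos _ _ _ _ ((hS X).homology_exact₃ (n + 1) n (by simp))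
      (ProjectiveResolution.leftDerived_app_eq β (projectiveResolution X) (n + 1)) rfl
  · intro X
    exact exists_exact_of_isos _ _ _ _ ((hS X).homology_exact₁ (n + 1) n (by simp)) rfl
      (ProjectiveResolution.leftDerived_app_eq α (projectiveResolution X) n)

lemma leftDerived_exact (α : F₁ ⟶ F₂) (β : F₂ ⟶ F₃) (w : α ≫ β = 0)
    (h : ∀ (Q : C) [Projective Q],
      (ShortComplex.mk (α.app Q) (β.app Q) (congr_app w Q)).ShortExact) (n : ℕ) (X : C) :
    ∃ e, (ShortComplex.mk ((NatTrans.leftDerived α n).app X)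
      ((NatTrans.leftDerived β n).app X) e).Exact :=
  exists_exact_of_isos _ _ _ _
    ((leftDerivedShortComplex_shortExact α β w h (projectiveResolution X)).homology_exact₂ n)
    (ProjectiveResolution.leftDerived_app_eq α (projectiveResolution X) n)
    (ProjectiveResolution.leftDerived_app_eq β (projectiveResolution X) n)

end LeftDerivedSequence

section ExtSequence

variable {R : Type} [CommRing R]

lemma linearYoneda_map_comp_eq_zero (S : ShortComplex (ModuleCat.{0} R)) :
    (linearYoneda R (ModuleCat.{0} R)).map S.f ≫ (linearYoneda R (ModuleCat.{0} R)).map S.g = 0 := by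
  rw [← Functor.map_comp, S.zero]
  ext Q (k : Q.unop ⟶ S.X₁)
  exact Limits.comp_zero (X := Q.unop) (Y := S.X₁)

lemma rightOp_linearYoneda_map_comp_eq_zero (S : ShortComplex (ModuleCat.{0} R)) :
    NatTrans.rightOp ((linearYoneda R (ModuleCat.{0} R)).map S.g) ≫
      NatTrans.rightOp ((linearYoneda R (ModuleCat.{0} R)).map S.f) = 0 := by
  ext Q
  exact congrArg Quiver.Hom.op (congr_app (linearYoneda_map_comp_eq_zero S) (Opposite.op Q))

lemma linearYoneda_map_shortExact (S : ShortComplex (ModuleCat.{0} R)) (hS : S.ShortExact)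
    (Q : ModuleCat.{0} R) [Projective Q] :
    (ShortComplex.mk (((linearYoneda R (ModuleCat.{0} R)).map S.f).app (Opposite.op Q))
      (((linearYoneda R (ModuleCat.{0} R)).map S.g).app (Opposite.op Q)) (congr_app
        (linearYoneda_map_comp_eq_zero S) (Opposite.op Q))).ShortExact := by
  have := hS.mono_f
  have := hS.epi_g
  refine ShortComplex.ShortExact.mk' ?_ ?_ ?_
  · rw [ShortComplex.moduleCat_exact_iff]
    intro (k : Q ⟶ S.X₂) (hk : k ≫ S.g = 0)
    exact ⟨hS.exact.lift k hk, hS.exact.lift_f k hk⟩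
  · rw [ModuleCat.mono_iff_injective]
    intro (a : Q ⟶ S.X₁) (b : Q ⟶ S.X₁) (hab : a ≫ S.f = b ≫ S.f)
    exact (cancel_mono S.f).mp hab
  · rw [ModuleCat.epi_iff_surjective]
    intro (b : Q ⟶ S.X₃)
    exact ⟨Projective.factorThru b S.g, Projective.factorThru_comp b S.g⟩

lemma exists_Ext_connecting (S : ShortComplex (ModuleCat.{0} R)) (hS : S.ShortExact) (n : ℕ) :
    ∃ δ : (Ext R (ModuleCat.{0} R) n).flip.obj S.X₃ ⟶
        (Ext R (ModuleCat.{0} R) (n + 1)).flip.obj S.X₁,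
      ∀ X, (∃ e, (ShortComplex.mk (((Ext R (ModuleCat.{0} R) n).obj X).map S.g)
          (δ.app X) e).Exact) ∧
        (∃ e, (ShortComplex.mk (δ.app X)
          (((Ext R (ModuleCat.{0} R) (n + 1)).obj X).map S.f) e).Exact) := by
  obtain ⟨δ, h1, h2⟩ := exists_leftDerived_connecting
    (NatTrans.rightOp ((linearYoneda R (ModuleCat.{0} R)).map S.g))
    (NatTrans.rightOp ((linearYoneda R (ModuleCat.{0} R)).map S.f))
    (rightOp_linearYoneda_map_comp_eq_zero S)
    (fun Q _ => (linearYoneda_map_shortExact S hS Q).op) n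
  refine ⟨NatTrans.leftOp δ, fun X => ⟨?_, ?_⟩⟩
  · obtain ⟨e, he⟩ := h2 X.unop
    exact ⟨_, he.unop⟩
  · obtain ⟨e, he⟩ := h1 X.unop
    exact ⟨_, he.unop⟩

lemma Ext_exact (S : ShortComplex (ModuleCat.{0} R)) (hS : S.ShortExact) (n : ℕ) (X) :
    ∃ e, (ShortComplex.mk (((Ext R (ModuleCat.{0} R) n).obj X).map S.f)
      (((Ext R (ModuleCat.{0} R) n).obj X).map S.g) e).Exact := by
  obtain ⟨e, he⟩ := leftDerived_exact
    (NatTrans.rightOp ((linearYoneda R (ModuleCat.{0} R)).map S.g))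
    (NatTrans.rightOp ((linearYoneda R (ModuleCat.{0} R)).map S.f))
    (rightOp_linearYoneda_map_comp_eq_zero S)
    (fun Q _ => (linearYoneda_map_shortExact S hS Q).op) n X.unop
  exact ⟨_, he.unop⟩

end ExtSequence

section ScalarAction

lemma homologyMap_eq_natTrans_app {D : Type*} [Category* D] [Abelian D] (ρ : 𝟭 D ⟶ 𝟭 D)
    {ι : Type*} {c : ComplexShape ι} (K : HomologicalComplex D c) (f : K ⟶ K)
    (hf : ∀ i, f.f i = ρ.app (K.X i)) (i : ι) :
    HomologicalComplex.homologyMap f i = ρ.app (K.homology i) := by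
  have h1 : HomologicalComplex.cyclesMap f i = ρ.app (K.cycles i) := by
    rw [← cancel_mono (K.iCycles i), HomologicalComplex.cyclesMap_i, hf]
    exact (ρ.naturality (K.iCycles i)).trans rfl
  rw [← cancel_epi (K.homologyπ i), HomologicalComplex.homologyπ_naturality, h1]
  exact (ρ.naturality (K.homologyπ i)).symm.trans rfl

lemma conj_natTrans_app {D : Type*} [Category* D] (ρ : 𝟭 D ⟶ 𝟭 D) {X Y : D} (e : X ≅ Y)
    {f : X ⟶ X} {g : Y ⟶ Y} (hf : f = e.hom ≫ g ≫ e.inv) (hg : g = ρ.app Y) : f = ρ.app X := by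
  subst hf hg
  have h : ρ.app Y ≫ e.inv = e.inv ≫ ρ.app X := (ρ.naturality e.inv).symm
  rw [h, e.hom_inv_id_assoc]

lemma leftDerived_app_eq_natTrans_app {C D : Type*} [Category* C] [Category* D] [Abelian C]
    [HasProjectiveResolutions C] [Abelian D] {F : C ⥤ D} [F.Additive] (ρ : 𝟭 D ⟶ 𝟭 D)
    (α : F ⟶ F) (h : ∀ Q, α.app Q = ρ.app (F.obj Q)) (n : ℕ) (X : C) :
    (NatTrans.leftDerived α n).app X = ρ.app ((F.leftDerived n).obj X) :=
  conj_natTrans_app ρ _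
    (ProjectiveResolution.leftDerived_app_eq α (projectiveResolution X) n)
    (homologyMap_eq_natTrans_app ρ _ _ (fun _ => h _) n)

variable {R : Type} [CommRing R]

/-- Multiplication by a scalar, as an endomorphism of the identity functor of modules. -/
def smulNatTrans (r : R) : 𝟭 (ModuleCat.{0} R) ⟶ 𝟭 (ModuleCat.{0} R) where
  app M := r • 𝟙 M
  naturality X Y f := by
    change f ≫ (r • 𝟙 Y) = (r • 𝟙 X) ≫ f
    rw [Linear.comp_smul, Linear.smul_comp, Category.comp_id, Category.id_comp]

/-- Multiplication by a scalar, as an endomorphism of the identity functor of the opposite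
category of modules. -/
def smulNatTransOp (r : R) : 𝟭 (ModuleCat.{0} R)ᵒᵖ ⟶ 𝟭 (ModuleCat.{0} R)ᵒᵖ where
  app M := (r • 𝟙 M.unop).op
  naturality _ _ f := congrArg Quiver.Hom.op ((smulNatTrans r).naturality f.unop).symm

lemma Ext_map_smul (r : R) (n : ℕ) (X : (ModuleCat.{0} R)ᵒᵖ) (M : ModuleCat.{0} R) :
    ((Ext R (ModuleCat.{0} R) n).obj X).map (r • 𝟙 M) =
      r • 𝟙 (((Ext R (ModuleCat.{0} R) n).obj X).obj M) := by
  refine congrArg Quiver.Hom.unop (leftDerived_app_eq_natTrans_app (smulNatTransOp r)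
    (NatTrans.rightOp ((linearYoneda R (ModuleCat.{0} R)).map (r • 𝟙 M))) (fun Q => ?_) n X.unop)
  refine congrArg Quiver.Hom.op ?_
  ext (k : Q ⟶ M)
  have h : k ≫ (r • 𝟙 M) = r • k := by rw [Linear.comp_smul, Category.comp_id]
  exact h

end ScalarAction

section ExtZero

lemma leftDerived_app_zero_naturality {C D : Type*} [Category* C] [Category* D] [Abelian C]
    [HasProjectiveResolutions C] [Abelian D] {F G : C ⥤ D} [F.Additive] [G.Additive]
    (α : F ⟶ G) (X : C) :
    (NatTrans.leftDerived α 0).app X ≫ G.fromLeftDerivedZero.app X =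
      F.fromLeftDerivedZero.app X ≫ α.app X := by
  let P := projectiveResolution X
  let a := (NatTrans.mapHomologicalComplex α (ComplexShape.down ℕ)).app P.complex
  have h1 : HomologicalComplex.opcyclesMap a 0 ≫ P.fromLeftDerivedZero' G =
      P.fromLeftDerivedZero' F ≫ α.app X := by
    rw [← cancel_epi (HomologicalComplex.pOpcycles _ _), HomologicalComplex.p_opcyclesMap_assoc,
      ProjectiveResolution.pOpcycles_comp_fromLeftDerivedZero'_assoc,
      ProjectiveResolution.pOpcycles_comp_fromLeftDerivedZero']
    exact (α.naturality _).symm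
  have h2 : HomologicalComplex.homologyMap a 0 ≫ (ChainComplex.isoHomologyι₀ _).hom =
      (ChainComplex.isoHomologyι₀ _).hom ≫ HomologicalComplex.opcyclesMap a 0 := by
    simp [ChainComplex.isoHomologyι₀]
  have h3 := ProjectiveResolution.leftDerived_app_eq α P 0
  have h4 : ∀ {A A' B B' C₁ C₂ Z W : D} (e : A ≅ A') (e' : B ≅ B') (f : A ⟶ B) (m : A' ⟶ B')
    (i : A' ⟶ C₁) (i' : B' ⟶ C₂) (o : C₁ ⟶ C₂) (z : C₁ ⟶ Z) (z' : C₂ ⟶ W) (t : Z ⟶ W),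
    f = e.hom ≫ m ≫ e'.inv → m ≫ i' = i ≫ o → o ≫ z' = z ≫ t →
      f ≫ e'.hom ≫ i' ≫ z' = (e.hom ≫ i ≫ z) ≫ t := by
    intro A A' B B' C₁ C₂ Z W e e' f m i i' o z z' t hf h1 h2
    simp [hf, reassoc_of% h1, h2]
  rw [P.fromLeftDerivedZero_eq, P.fromLeftDerivedZero_eq]
  exact h4 _ _ _ _ _ _ _ _ _ _ h3 h2 h1

variable {R : Type} [CommRing R]

instance (M : ModuleCat.{0} R) :
    PreservesFiniteLimits ((linearYoneda R (ModuleCat.{0} R)).obj M) := by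
  have : PreservesLimits ((linearYoneda R (ModuleCat.{0} R)).obj M ⋙ forget (ModuleCat.{0} R)) :=
    inferInstanceAs (PreservesLimits (yoneda.obj M))
  have := preservesLimits_of_reflects_of_preserves
    ((linearYoneda R (ModuleCat.{0} R)).obj M) (forget (ModuleCat.{0} R))
  infer_instance

instance (M : ModuleCat.{0} R) :
    PreservesFiniteColimits ((linearYoneda R (ModuleCat.{0} R)).obj M).rightOp :=
  preservesFiniteColimits_rightOp _

/-- In degree zero, `Ext` is given by morphisms. -/
noncomputable def extZeroIso (X M : ModuleCat.{0} R) :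
    ((Ext R (ModuleCat.{0} R) 0).obj (Opposite.op X)).obj M ≅ ModuleCat.of R (X ⟶ M) :=
  ((((linearYoneda R (ModuleCat.{0} R)).obj M).rightOp.leftDerivedZeroIsoSelf).app X).unop.symm

lemma extZeroIso_naturality_left {X Y : ModuleCat.{0} R} (f : X ⟶ Y) (M : ModuleCat.{0} R)
    (u : Y ⟶ M) :
    ((Ext R (ModuleCat.{0} R) 0).map f.op).app M ((extZeroIso Y M).inv u) =
      (extZeroIso X M).inv (f ≫ u) := by
  have := congrArg Quiver.Hom.unop ((((linearYoneda R (ModuleCat.{0} R)).obj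
    M).rightOp.fromLeftDerivedZero).naturality f)
  exact ConcreteCategory.congr_hom this u

lemma extZeroIso_naturality_right (X : ModuleCat.{0} R) {M N : ModuleCat.{0} R} (f : M ⟶ N)
    (u : X ⟶ M) :
    ((Ext R (ModuleCat.{0} R) 0).obj (Opposite.op X)).map f ((extZeroIso X M).inv u) =
      (extZeroIso X N).inv (u ≫ f) := by
  have := congrArg Quiver.Hom.unop (leftDerived_app_zero_naturality (NatTrans.rightOp
    ((linearYoneda R (ModuleCat.{0} R)).map f)) X)
  exact ConcreteCategory.congr_hom this u

end ExtZero

section ExtInjective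

variable {R : Type} [CommRing R]

lemma isZero_Ext_succ_of_injective (X J : ModuleCat.{0} R) [Injective J] (n : ℕ) :
    IsZero (((Ext R (ModuleCat.{0} R) (n + 1)).obj (Opposite.op X)).obj J) := by
  let P := projectiveResolution X
  refine IsZero.of_iso ?_ (P.isoExt (n + 1) J)
  rw [← HomologicalComplex.exactAt_iff_isZero_homology,
    HomologicalComplex.exactAt_iff' _ n (n + 1) (n + 2) (by simp) (by simp),
    ShortComplex.moduleCat_exact_iff]
  intro (u : P.complex.X (n + 1) ⟶ J) (hu : P.complex.d (n + 2) (n + 1) ≫ u = 0)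
  have hP : (P.complex.sc' (n + 2) (n + 1) n).Exact := P.exact_succ n
  exact ⟨hP.descToInjective u hu, hP.comp_descToInjective u hu⟩

end ExtInjective

section FilteredColimits

variable {R : Type} [CommRing R]

lemma exact_of_isColimit {J : Type} [SmallCategory J] [IsFiltered J] {A B C : J ⥤ ModuleCat.{0} R}
    {cA : Cocone A} {cB : Cocone B} {cC : Cocone C} (hA : IsColimit cA) (hB : IsColimit cB)
    (hC : IsColimit cC) (F : A ⟶ B) (G : B ⟶ C) (f : cA.pt ⟶ cB.pt) (g : cB.pt ⟶ cC.pt)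
    (hf : ∀ j, cA.ι.app j ≫ f = F.app j ≫ cB.ι.app j)
    (hg : ∀ j, cB.ι.app j ≫ g = G.app j ≫ cC.ι.app j)
    (hex : ∀ j, ∃ e, (ShortComplex.mk (F.app j) (G.app j) e).Exact) :
    Function.Exact f.hom g.hom := by
  have hf' : ∀ j x, f (cA.ι.app j x) = cB.ι.app j (F.app j x) :=
    fun j x => ConcreteCategory.congr_hom (hf j) x
  have hg' : ∀ j x, g (cB.ι.app j x) = cC.ι.app j (G.app j x) :=
    fun j x => ConcreteCategory.congr_hom (hg j) x
  intro y
  constructor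
  · intro hy
    obtain ⟨j, y, rfl⟩ := Concrete.isColimit_exists_rep B hB y
    have h0 : cC.ι.app j (G.app j y) = cC.ι.app j 0 := by
      rw [map_zero, ← hg' j y]
      exact hy
    obtain ⟨k, s, t, hst⟩ := Concrete.isColimit_exists_of_rep_eq C hC _ _ h0
    obtain ⟨e, he⟩ := hex k
    rw [ShortComplex.moduleCat_exact_iff] at he
    obtain ⟨x, hx⟩ := he (B.map s y) (by
      have := ConcreteCategory.congr_hom (G.naturality s) y
      refine this.trans (hst.trans ?_)
      exact map_zero _)
    refine ⟨cA.ι.app k x, ?_⟩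
    refine (hf' k x).trans ?_
    refine (congrArg (cB.ι.app k) hx).trans ?_
    exact ConcreteCategory.congr_hom (cB.w s) y
  · rintro ⟨x, rfl⟩
    obtain ⟨j, x, rfl⟩ := Concrete.isColimit_exists_rep A hA x
    obtain ⟨e, he⟩ := hex j
    have h1 : G.app j (F.app j x) = 0 := ConcreteCategory.congr_hom e x
    refine (congrArg g (hf' j x)).trans ((hg' j _).trans ?_)
    rw [h1, map_zero]

end FilteredColimits

section LocalCohomology

variable {R : Type} [CommRing R] (I : Ideal R)

/-- The directed system of modules `Ext^n(R/I^t, M)`. -/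
noncomputable abbrev extSystem (n : ℕ) (M : ModuleCat.{0} R) : (ℕᵒᵖ)ᵒᵖ ⥤ ModuleCat.{0} R :=
  (localCohomology.diagram (localCohomology.idealPowersDiagram I) n).flip.obj M

/-- The cocone exhibiting local cohomology as a colimit of `Ext` modules. -/
noncomputable def localCohomologyCocone (n : ℕ) (M : ModuleCat.{0} R) :
    Cocone (extSystem I n M) where
  pt := (localCohomology I n).obj M
  ι := (((evaluation _ _).obj M).mapCocone
    (colimit.cocone (localCohomology.diagram (localCohomology.idealPowersDiagram I) n))).ι

/-- Local cohomology is a colimit of `Ext` modules. -/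
noncomputable def localCohomologyCoconeIsColimit (n : ℕ) (M : ModuleCat.{0} R) :
    IsColimit (localCohomologyCocone I n M) :=
  isColimitOfPreserves ((evaluation _ _).obj M)
    (colimit.isColimit (localCohomology.diagram (localCohomology.idealPowersDiagram I) n))

lemma localCohomologyCocone_naturality (n : ℕ) {M N : ModuleCat.{0} R} (f : M ⟶ N) (t) :
    (localCohomologyCocone I n M).ι.app t ≫ (localCohomology I n).map f =
      ((localCohomology.diagram (localCohomology.idealPowersDiagram I) n).flip.map f).app t ≫
        (localCohomologyCocone I n N).ι.app t :=
  (((colimit.cocone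
    (localCohomology.diagram (localCohomology.idealPowersDiagram I) n)).ι.app t).naturality f).symm

lemma localCohomology_exact (S : ShortComplex (ModuleCat.{0} R)) (hS : S.ShortExact) (n : ℕ) :
    Function.Exact ((localCohomology I n).map S.f).hom ((localCohomology I n).map S.g).hom :=
  exact_of_isColimit (localCohomologyCoconeIsColimit I n _) (localCohomologyCoconeIsColimit I n _)
    (localCohomologyCoconeIsColimit I n _)
    ((localCohomology.diagram (localCohomology.idealPowersDiagram I) n).flip.map S.f)
    ((localCohomology.diagram (localCohomology.idealPowersDiagram I) n).flip.map S.g)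
    _ _ (localCohomologyCocone_naturality I n _) (localCohomologyCocone_naturality I n _)
    (fun _ => Ext_exact S hS n _)

lemma exists_localCohomology_connecting (S : ShortComplex (ModuleCat.{0} R)) (hS : S.ShortExact)
    (n : ℕ) :
    ∃ δ : (localCohomology I n).obj S.X₃ ⟶ (localCohomology I (n + 1)).obj S.X₁,
      Function.Exact ((localCohomology I n).map S.g).hom δ.hom ∧
      Function.Exact δ.hom ((localCohomology I (n + 1)).map S.f).hom := by
  obtain ⟨δ, hδ⟩ := exists_Ext_connecting S hS n
  let d : extSystem I n S.X₃ ⟶ extSystem I (n + 1) S.X₁ := Functor.whiskerLeft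
    (localCohomology.ringModIdeals (localCohomology.idealPowersDiagram I)).op δ
  have hd : ∀ t, _ := (localCohomologyCoconeIsColimit I n S.X₃).fac
    ((Cocone.precompose d).obj (localCohomologyCocone I (n + 1) S.X₁))
  refine ⟨(localCohomologyCoconeIsColimit I n S.X₃).desc
    ((Cocone.precompose d).obj (localCohomologyCocone I (n + 1) S.X₁)), ?_, ?_⟩
  · exact exact_of_isColimit (localCohomologyCoconeIsColimit I n _)
      (localCohomologyCoconeIsColimit I n _) (localCohomologyCoconeIsColimit I (n + 1) _)
      ((localCohomology.diagram (localCohomology.idealPowersDiagram I) n).flip.map S.g) d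
      _ _ (localCohomologyCocone_naturality I n _) hd (fun _ => (hδ _).1)
  · exact exact_of_isColimit (localCohomologyCoconeIsColimit I n _)
      (localCohomologyCoconeIsColimit I (n + 1) _) (localCohomologyCoconeIsColimit I (n + 1) _) d
      ((localCohomology.diagram (localCohomology.idealPowersDiagram I) (n + 1)).flip.map S.f)
      _ _ hd (localCohomologyCocone_naturality I (n + 1) _) (fun _ => (hδ _).2)

lemma localCohomology_map_smul (r : R) (n : ℕ) (M : ModuleCat.{0} R) :
    (localCohomology I n).map (r • 𝟙 M) = r • 𝟙 _ := by
  refine (localCohomologyCoconeIsColimit I n M).hom_ext fun t => ?_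
  rw [localCohomologyCocone_naturality]
  have : ((localCohomology.diagram (localCohomology.idealPowersDiagram I) n).flip.map
    (r • 𝟙 M)).app t = r • 𝟙 _ := Ext_map_smul r n _ M
  rw [this, Linear.smul_comp, Category.id_comp]
  have h : ∀ {X Y : ModuleCat.{0} R} (f : X ⟶ Y), r • f = f ≫ (r • 𝟙 Y) := by
    intro X Y f; rw [Linear.comp_smul, Category.comp_id]
  exact h _

lemma localCohomology_eq_zero_of_injective (n : ℕ) (M : ModuleCat.{0} R) [Injective M]
    (z : (localCohomology I (n + 1)).obj M) : z = 0 := by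
  obtain ⟨t, y, rfl⟩ := Concrete.isColimit_exists_rep _
    (localCohomologyCoconeIsColimit I (n + 1) M) z
  have h := isZero_Ext_succ_of_injective (((localCohomology.ringModIdeals
    (localCohomology.idealPowersDiagram I)).op.obj t).unop) M n
  have : Subsingleton (((Ext R (ModuleCat.{0} R) (n + 1)).obj
    (Opposite.op (((localCohomology.ringModIdeals
      (localCohomology.idealPowersDiagram I)).op.obj t).unop))).obj M) :=
    ModuleCat.subsingleton_of_isZero h
  have hy : y = 0 := this.elim _ _
  rw [hy, map_zero]
  rfl

end LocalCohomology

section LocalCohomologyZero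

variable {R : Type} [CommRing R] (I : Ideal R)

lemma extZeroIso_hom_naturality_left {X Y : ModuleCat.{0} R} (f : X ⟶ Y) (M : ModuleCat.{0} R)
    (v) : (extZeroIso X M).hom (((Ext R (ModuleCat.{0} R) 0).map f.op).app M v) =
      f ≫ (extZeroIso Y M).hom v := by
  obtain ⟨u, rfl⟩ : ∃ u, (extZeroIso Y M).inv u = v := ⟨(extZeroIso Y M).hom v, by simp⟩
  rw [extZeroIso_naturality_left]
  simp

lemma extZeroIso_hom_naturality_right (X : ModuleCat.{0} R) {M N : ModuleCat.{0} R} (f : M ⟶ N)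
    (v) : (extZeroIso X N).hom (((Ext R (ModuleCat.{0} R) 0).obj (Opposite.op X)).map f v) =
      (extZeroIso X M).hom v ≫ f := by
  obtain ⟨u, rfl⟩ : ∃ u, (extZeroIso X M).inv u = v := ⟨(extZeroIso X M).hom v, by simp⟩
  rw [extZeroIso_naturality_right]
  simp

/-- The ideal `I ^ t`, for `t` in the index category of the direct system defining
local cohomology. -/
abbrev indexIdeal (t : (ℕᵒᵖ)ᵒᵖ) : Ideal R := I ^ t.unop.unop

/-- Morphisms `R/I^t ⟶ M`, evaluated at `1`. -/
def quotientEvalOne (t : (ℕᵒᵖ)ᵒᵖ) (M : ModuleCat.{0} R) :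
    ModuleCat.of R (ModuleCat.of R (R ⧸ indexIdeal I t) ⟶ M) ⟶ M :=
  ModuleCat.ofHom
    { toFun := fun u => u.hom (Submodule.Quotient.mk 1)
      map_add' := fun _ _ => rfl
      map_smul' := fun _ _ => rfl }

/-- Degree zero local cohomology as a submodule: the canonical cocone. -/
noncomputable def zeroCocone (M : ModuleCat.{0} R) : Cocone (extSystem I 0 M) where
  pt := M
  ι :=
    { app t := (extZeroIso (ModuleCat.of R (R ⧸ indexIdeal I t)) M).hom ≫ quotientEvalOne I t M
      naturality s t f := by
        ext v
        have := extZeroIso_hom_naturality_left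
          ((localCohomology.ringModIdeals (localCohomology.idealPowersDiagram I)).map f.unop) M v
        exact congrArg (quotientEvalOne I t M) this }

/-- The canonical map from degree zero local cohomology of a module to the module. -/
noncomputable def zeroToSelf (M : ModuleCat.{0} R) : (localCohomology I 0).obj M ⟶ M :=
  (localCohomologyCoconeIsColimit I 0 M).desc (zeroCocone I M)

lemma zeroToSelf_ι (M : ModuleCat.{0} R) (t) (y) :
    zeroToSelf I M ((localCohomologyCocone I 0 M).ι.app t y) = (zeroCocone I M).ι.app t y :=
  ConcreteCategory.congr_hom ((localCohomologyCoconeIsColimit I 0 M).fac (zeroCocone I M) t) y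

lemma zeroToSelf_naturality {M N : ModuleCat.{0} R} (f : M ⟶ N) (z) :
    zeroToSelf I N ((localCohomology I 0).map f z) = f (zeroToSelf I M z) := by
  obtain ⟨t, y, rfl⟩ := Concrete.isColimit_exists_rep _ (localCohomologyCoconeIsColimit I 0 M) z
  have h1 := ConcreteCategory.congr_hom (localCohomologyCocone_naturality I 0 f t) y
  refine (congrArg (zeroToSelf I N) h1).trans ((zeroToSelf_ι I N t _).trans ?_)
  refine Eq.trans ?_ (congrArg f (zeroToSelf_ι I M t y)).symm
  exact congrArg (quotientEvalOne I t N) (extZeroIso_hom_naturality_right _ f y)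

lemma zeroToSelf_injective (M : ModuleCat.{0} R) : Function.Injective (zeroToSelf I M) := by
  rw [injective_iff_map_eq_zero]
  intro z hz
  obtain ⟨t, y, rfl⟩ := Concrete.isColimit_exists_rep _ (localCohomologyCoconeIsColimit I 0 M) z
  have h1 : quotientEvalOne I t M ((extZeroIso (ModuleCat.of R (R ⧸ indexIdeal I t)) M).hom y) = 0 :=
    (zeroToSelf_ι I M t y).symm.trans hz
  have h2 : (extZeroIso (ModuleCat.of R (R ⧸ indexIdeal I t)) M).hom y = 0 := by
    refine ModuleCat.hom_ext (LinearMap.ext fun a => ?_)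
    obtain ⟨r, rfl⟩ := Submodule.Quotient.mk_surjective _ a
    have : (Submodule.Quotient.mk r : R ⧸ indexIdeal I t) = r • Submodule.Quotient.mk 1 := by
      rw [← Submodule.Quotient.mk_smul, smul_eq_mul, mul_one]
    refine (congrArg _ this).trans ((map_smul _ _ _).trans ?_)
    exact (congrArg (r • ·) h1).trans (smul_zero r)
  have h3 : y = 0 := by
    have := congrArg (extZeroIso (ModuleCat.of R (R ⧸ indexIdeal I t)) M).inv h2
    rw [map_zero] at this
    exact (ConcreteCategory.congr_hom (extZeroIso _ M).hom_inv_id y).symm.trans this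
  rw [h3, map_zero]
  rfl

lemma mem_range_zeroToSelf_iff (M : ModuleCat.{0} R) (x : M) :
    (∃ z, zeroToSelf I M z = x) ↔ ∃ t : ℕ, ∀ r ∈ I ^ t, r • x = 0 := by
  constructor
  · rintro ⟨z, rfl⟩
    obtain ⟨t, y, rfl⟩ := Concrete.isColimit_exists_rep _ (localCohomologyCoconeIsColimit I 0 M) z
    refine ⟨t.unop.unop, fun r hr => ?_⟩
    let u := ((extZeroIso (ModuleCat.of R (R ⧸ indexIdeal I t)) M).hom y).hom
    refine (congrArg (r • ·) (zeroToSelf_ι I M t y)).trans ?_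
    change r • u (Submodule.Quotient.mk 1) = 0
    rw [← map_smul, ← Submodule.Quotient.mk_smul, smul_eq_mul, mul_one,
      (Submodule.Quotient.mk_eq_zero _).mpr hr, map_zero]
  · rintro ⟨t, ht⟩
    let t' : (ℕᵒᵖ)ᵒᵖ := Opposite.op (Opposite.op t)
    let u : ModuleCat.of R (R ⧸ indexIdeal I t') ⟶ M := ModuleCat.ofHom
      (Submodule.liftQ _ (LinearMap.toSpanSingleton R M x) fun r hr => ht r hr)
    let y := (extZeroIso (ModuleCat.of R (R ⧸ indexIdeal I t')) M).inv u
    refine ⟨(localCohomologyCocone I 0 M).ι.app t' y, (zeroToSelf_ι I M t' y).trans ?_⟩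
    have : (extZeroIso (ModuleCat.of R (R ⧸ indexIdeal I t')) M).hom y = u :=
      ConcreteCategory.congr_hom (extZeroIso _ M).inv_hom_id u
    refine (congrArg (quotientEvalOne I t' M) this).trans ?_
    exact one_smul R x

end LocalCohomologyZero

section Interface

variable {R : Type} [CommRing R] (I : Ideal R) (n : ℕ)
  (M : Type) [AddCommGroup M] [Module R M] {N : Type} [AddCommGroup N] [Module R N]
  {P : Type} [AddCommGroup P] [Module R P]

/-- The local cohomology module as a plain type. -/
def LC : Type := LocalCohomologyModule I n M

noncomputable instance : AddCommGroup (LC I n M) :=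
  inferInstanceAs (AddCommGroup (LocalCohomologyModule I n M))

noncomputable instance : Module R (LC I n M) :=
  inferInstanceAs (Module R (LocalCohomologyModule I n M))

namespace LC

variable {M}

/-- Functoriality of local cohomology. -/
noncomputable def map (f : M →ₗ[R] N) : LC I n M →ₗ[R] LC I n N :=
  ((localCohomology I n).map (ModuleCat.ofHom f)).hom

variable (M) in
lemma map_id : map I n (LinearMap.id : M →ₗ[R] M) = LinearMap.id :=
  congrArg ModuleCat.Hom.hom ((localCohomology I n).map_id (ModuleCat.of R M))

lemma map_comp (g : N →ₗ[R] P) (f : M →ₗ[R] N) : map I n (g ∘ₗ f) = map I n g ∘ₗ map I n f :=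
  congrArg ModuleCat.Hom.hom
    ((localCohomology I n).map_comp (ModuleCat.ofHom f) (ModuleCat.ofHom g))

lemma map_smul_id (r : R) : map I n (r • (LinearMap.id : M →ₗ[R] M)) = r • LinearMap.id :=
  congrArg ModuleCat.Hom.hom (localCohomology_map_smul I r n (ModuleCat.of R M))

lemma map_smul (r : R) (f : M →ₗ[R] N) : map I n (r • f) = r • map I n f := by
  have : r • f = (r • LinearMap.id) ∘ₗ f := by ext; rfl
  rw [this, map_comp, map_smul_id]
  ext; rfl

lemma map_zero : map I n (0 : M →ₗ[R] N) = 0 := by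
  simpa using map_smul I n 0 (0 : M →ₗ[R] N)

/-- Isomorphic modules have isomorphic local cohomology. -/
noncomputable def congr (e : M ≃ₗ[R] N) : LC I n M ≃ₗ[R] LC I n N :=
  LinearEquiv.ofLinearMap (map I n e.toLinearMap) (map I n e.symm.toLinearMap)
    (by rw [← map_comp, LinearEquiv.comp_symm, map_id])
    (by rw [← map_comp, LinearEquiv.symm_comp, map_id])

lemma shortExact_ofHom {f : M →ₗ[R] N} {g : N →ₗ[R] P} (hf : Function.Injective f)
    (hg : Function.Surjective g) (hfg : Function.Exact f g) :
    (ShortComplex.mk (ModuleCat.ofHom f) (ModuleCat.ofHom g)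
      (by ext x; exact hfg.apply_apply_eq_zero x)).ShortExact := by
  have : Mono (ModuleCat.ofHom f) := (ModuleCat.mono_iff_injective _).mpr hf
  have : Epi (ModuleCat.ofHom g) := (ModuleCat.epi_iff_surjective _).mpr hg
  refine ShortComplex.ShortExact.mk' ?_ ‹_› ‹_›
  rw [ShortComplex.moduleCat_exact_iff]
  exact fun x hx => (hfg x).mp hx

lemma exact_map {f : M →ₗ[R] N} {g : N →ₗ[R] P} (hf : Function.Injective f)
    (hg : Function.Surjective g) (hfg : Function.Exact f g) :
    Function.Exact (map I n f) (map I n g) :=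
  localCohomology_exact I _ (shortExact_ofHom hf hg hfg) n

lemma exists_connecting {f : M →ₗ[R] N} {g : N →ₗ[R] P} (hf : Function.Injective f)
    (hg : Function.Surjective g) (hfg : Function.Exact f g) :
    ∃ δ : LC I n P →ₗ[R] LC I (n + 1) M,
      Function.Exact (map I n g) δ ∧ Function.Exact δ (map I (n + 1) f) := by
  obtain ⟨δ, h⟩ := exists_localCohomology_connecting I _ (shortExact_ofHom hf hg hfg) n
  exact ⟨δ.hom, h⟩

lemma subsingleton_of_injective [Module.Injective R M] : Subsingleton (LC I (n + 1) M) := by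
  have : Injective (ModuleCat.of R M) := Module.injective_object_of_injective_module R M
  exact subsingleton_of_forall_eq 0 (localCohomology_eq_zero_of_injective I n (ModuleCat.of R M))

variable (M) in
/-- The canonical map from degree zero local cohomology to the module. -/
noncomputable def toSelf : LC I 0 M →ₗ[R] M := (zeroToSelf I (ModuleCat.of R M)).hom

variable (M) in
lemma toSelf_injective : Function.Injective (toSelf I M) := zeroToSelf_injective I _

lemma toSelf_map (f : M →ₗ[R] N) (z : LC I 0 M) :
    toSelf I N (map I 0 f z) = f (toSelf I M z) := zeroToSelf_naturality I (ModuleCat.ofHom f) z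

lemma exists_toSelf_eq_iff (x : M) :
    (∃ z, toSelf I M z = x) ↔ ∃ t : ℕ, ∀ r ∈ I ^ t, r • x = 0 :=
  mem_range_zeroToSelf_iff I (ModuleCat.of R M) x

end LC

end Interface

section Torsion

variable {R : Type} [CommRing R]

/-- Every element of `M` is killed by a power of each element of `𝔟`. -/
def IsIdealTorsion (𝔟 : Ideal R) (M : Type) [AddCommGroup M] [Module R M] : Prop :=
  ∀ x : M, ∀ b ∈ 𝔟, ∃ n : ℕ, b ^ n • x = 0

namespace IsIdealTorsion

variable {𝔟 𝔠 : Ideal R} {M N : Type} [AddCommGroup M] [Module R M] [AddCommGroup N] [Module R N]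

lemma iff_le_radical :
    IsIdealTorsion 𝔟 M ↔ ∀ x : M, 𝔟 ≤ (Ideal.torsionOf R M x).radical := Iff.rfl

lemma of_injective (h : IsIdealTorsion 𝔟 N) (f : M →ₗ[R] N) (hf : Function.Injective f) :
    IsIdealTorsion 𝔟 M := fun x b hb => by
  obtain ⟨n, hn⟩ := h (f x) b hb
  exact ⟨n, hf (by rw [map_smul, hn, map_zero])⟩

lemma of_surjective (h : IsIdealTorsion 𝔟 M) (f : M →ₗ[R] N) (hf : Function.Surjective f) :
    IsIdealTorsion 𝔟 N := fun x b hb => by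
  obtain ⟨x, rfl⟩ := hf x
  obtain ⟨n, hn⟩ := h x b hb
  exact ⟨n, by rw [← map_smul, hn, map_zero]⟩

lemma mono (h : IsIdealTorsion 𝔟 M) (hle : 𝔠 ≤ 𝔟.radical) : IsIdealTorsion 𝔠 M :=
  iff_le_radical.mpr fun x => hle.trans
    (Ideal.radical_le_radical_iff.mpr (iff_le_radical.mp h x))

lemma sup (h : IsIdealTorsion 𝔟 M) (h' : IsIdealTorsion 𝔠 M) : IsIdealTorsion (𝔟 ⊔ 𝔠) M :=
  iff_le_radical.mpr fun x => sup_le (h x) (h' x)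

lemma span_singleton {y : R} (h : ∀ x : M, ∃ n : ℕ, y ^ n • x = 0) :
    IsIdealTorsion (Ideal.span {y}) M :=
  iff_le_radical.mpr fun x => (Ideal.span_singleton_le_iff_mem _).mpr (h x)

lemma bot : IsIdealTorsion (⊥ : Ideal R) M := fun x b hb => ⟨1, by
  rw [(Submodule.mem_bot R).mp hb, pow_one, zero_smul]⟩

lemma exists_pow_smul_eq_zero [IsNoetherianRing R] (h : IsIdealTorsion 𝔟 M) (x : M) :
    ∃ t : ℕ, ∀ r ∈ 𝔟 ^ t, r • x = 0 := by
  obtain ⟨t, ht⟩ := Ideal.exists_pow_le_of_le_radical_of_fg (iff_le_radical.mp h x)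
    (IsNoetherian.noetherian 𝔟)
  exact ⟨t, fun r hr => ht hr⟩

lemma of_exists_pow (h : ∀ x : M, ∃ t : ℕ, ∀ r ∈ 𝔟 ^ t, r • x = 0) : IsIdealTorsion 𝔟 M :=
  fun x b hb => by
    obtain ⟨t, ht⟩ := h x
    exact ⟨t, ht _ (Ideal.pow_mem_pow hb t)⟩

lemma of_smul_eq_zero (h : ∀ b ∈ 𝔟, ∀ x : M, b • x = 0) : IsIdealTorsion 𝔟 M :=
  fun x b hb => ⟨1, by rw [pow_one, h b hb]⟩

end IsIdealTorsion

lemma exists_injective_embedding (M : Type) [AddCommGroup M] [Module R M] :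
    ∃ (J : Type) (_ : AddCommGroup J) (_ : Module R J) (f : M →ₗ[R] J),
      Module.Injective R J ∧ Function.Injective f :=
  let J : ModuleCat R := Injective.under (ModuleCat.of R M)
  have : Injective J := inferInstanceAs (Injective (Injective.under _))
  ⟨J, inferInstance, inferInstance, (Injective.ι (ModuleCat.of R M)).hom,
    Module.injective_module_of_injective_object R J,
    (ModuleCat.mono_iff_injective (Injective.ι (ModuleCat.of R M))).mp inferInstance⟩

lemma LC.isIdealTorsion (I : Ideal R) (n : ℕ) (M : Type) [AddCommGroup M] [Module R M] :
    IsIdealTorsion I (LC I n M) := by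
  induction n generalizing M with
  | zero =>
    refine .of_exists_pow fun z => ?_
    obtain ⟨t, ht⟩ := (exists_toSelf_eq_iff I (toSelf I M z)).mp ⟨z, rfl⟩
    exact ⟨t, fun r hr => toSelf_injective I M (by rw [_root_.map_smul, ht r hr, _root_.map_zero])⟩
  | succ n ih =>
    obtain ⟨J, _, _, f, _, hf⟩ := exists_injective_embedding (R := R) M
    obtain ⟨δ, -, hδ⟩ := LC.exists_connecting I n hf (Submodule.mkQ_surjective (LinearMap.range f))
      (LinearMap.exact_map_mkQ_range f)
    have := LC.subsingleton_of_injective I n (M := J)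
    exact (ih (J ⧸ LinearMap.range f)).of_surjective δ
      fun z => (hδ z).mp (Subsingleton.elim _ _)

end Torsion

section TorsionPart

variable {R : Type} [CommRing R]

/-- The submodule of elements killed by a power of `I`. -/
def idealTorsionPart (I : Ideal R) (M : Type) [AddCommGroup M] [Module R M] : Submodule R M where
  carrier := {x | ∃ t : ℕ, ∀ r ∈ I ^ t, r • x = 0}
  zero_mem' := ⟨0, fun r _ => smul_zero r⟩
  add_mem' := by
    rintro a b ⟨s, hs⟩ ⟨t, ht⟩
    refine ⟨s + t, fun r hr => ?_⟩
    rw [smul_add, hs r (Ideal.pow_le_pow_right (Nat.le_add_right s t) hr),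
      ht r (Ideal.pow_le_pow_right (Nat.le_add_left t s) hr), add_zero]
  smul_mem' := by
    rintro c a ⟨t, ht⟩
    exact ⟨t, fun r hr => by rw [smul_comm, ht r hr, smul_zero]⟩

lemma idealTorsionPart_isIdealTorsion (I : Ideal R) (M : Type) [AddCommGroup M] [Module R M] :
    IsIdealTorsion I (idealTorsionPart I M) := .of_exists_pow fun x => by
  obtain ⟨t, ht⟩ := x.2
  exact ⟨t, fun r hr => Subtype.ext (ht r hr)⟩

variable {I : Ideal R} {M : Type} [AddCommGroup M] [Module R M]

lemma LC.subsingleton_of_bijective_smul {x : R} (hx : x ∈ I) (n : ℕ)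
    (h : Function.Bijective (x • (LinearMap.id : M →ₗ[R] M))) : Subsingleton (LC I n M) := by
  refine subsingleton_of_forall_eq 0 fun z => ?_
  obtain ⟨k, hk⟩ := LC.isIdealTorsion I n M z x hx
  let e := LinearEquiv.ofBijective _ h
  have he : ∀ z : LC I n M, x • z = 0 → z = 0 := fun z hz => by
    refine (LC.congr I n e).injective (Eq.trans ?_ (_root_.map_zero _).symm)
    exact (DFunLike.congr_fun (LC.map_smul_id I n x) z).trans hz
  induction k with
  | zero => simpa using hk
  | succ k ih => exact ih (he _ (by rwa [smul_smul, ← pow_succ']))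

variable [IsNoetherianRing R]

lemma IsIdealTorsion.exists_pow_smul_eq_zero_of_fg [Module.Finite R M] (h : IsIdealTorsion I M) :
    ∃ t : ℕ, ∀ r ∈ I ^ t, ∀ x : M, r • x = 0 := by
  obtain ⟨S, hS⟩ := Module.Finite.fg_top (R := R) (M := M)
  choose t ht using h.exists_pow_smul_eq_zero
  refine ⟨S.sup t, fun r hr x => ?_⟩
  have hle : Submodule.span R (S : Set M) ≤ LinearMap.ker (r • (LinearMap.id : M →ₗ[R] M)) :=
    Submodule.span_le.mpr fun y hy =>
      ht y r (Ideal.pow_le_pow_right (Finset.le_sup (f := t) hy) hr)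
  exact hle (hS ▸ Submodule.mem_top (x := x))

instance idealTorsionPart_injective (I : Ideal R) (J : Type) [AddCommGroup J] [Module R J]
    [Module.Injective R J] : Module.Injective R (idealTorsionPart I J) := by
  refine Module.Baer.injective fun 𝔞 g => ?_
  obtain ⟨t, ht⟩ := ((idealTorsionPart_isIdealTorsion I J).of_injective
    (LinearMap.range g).subtype (Submodule.subtype_injective _)).exists_pow_smul_eq_zero_of_fg
  obtain ⟨k, hk⟩ := I.exists_pow_inf_eq_pow_smul 𝔞
  have hle : I ^ (k + t) ⊓ 𝔞 ≤ I ^ t • 𝔞 := by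
    have := hk (k + t) (Nat.le_add_right k t)
    rw [Nat.add_sub_cancel_left, smul_eq_mul, Ideal.mul_top] at this
    rw [this]
    exact Submodule.smul_mono le_rfl inf_le_right
  have hg : ∀ a : 𝔞, (a : R) ∈ I ^ (k + t) → g a = 0 := by
    intro a ha
    have hmem : a ∈ I ^ t • (⊤ : Submodule R 𝔞) := by
      have : (a : R) ∈ (I ^ t • (⊤ : Submodule R 𝔞)).map 𝔞.subtype := by
        rw [Submodule.map_smul'', Submodule.map_subtype_top]
        exact hle ⟨ha, a.2⟩
      obtain ⟨b, hb, hba⟩ := this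
      rwa [← Subtype.ext hba]
    refine Submodule.smul_induction_on hmem (fun r hr n _ => ?_) fun x y hx hy => ?_
    · rw [map_smul]
      exact congrArg Subtype.val (ht r hr ⟨g n, n, rfl⟩)
    · rw [map_add, hx, hy, add_zero]
  let f₁ : R →ₗ.[R] J := ⟨𝔞, (idealTorsionPart I J).subtype ∘ₗ g⟩
  let f₂ : R →ₗ.[R] J := ⟨I ^ (k + t), 0⟩
  have hf : ∀ (a : f₁.domain) (b : f₂.domain), (a : R) = b → f₁ a = f₂ b := fun a b hab =>
    congrArg Subtype.val (hg a (hab ▸ b.2))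
  obtain ⟨h, hh⟩ := Module.Injective.out (f₁.sup f₂ hf).domain.subtype
    (Submodule.subtype_injective _) (f₁.sup f₂ hf).toFun
  have h₁ : ∀ a : 𝔞, h a = g a := fun a =>
    (hh ⟨a, (LinearPMap.left_le_sup f₁ f₂ hf).1 a.2⟩).trans
      ((LinearPMap.left_le_sup f₁ f₂ hf).2 (x := a) rfl).symm
  have h₂ : ∀ r ∈ I ^ (k + t), h r = 0 := fun r hr =>
    (hh ⟨r, (LinearPMap.right_le_sup f₁ f₂ hf).1 hr⟩).trans
      ((LinearPMap.right_le_sup f₁ f₂ hf).2 (x := ⟨r, hr⟩) rfl).symm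
  refine ⟨h.codRestrict _ fun c => ⟨k + t, fun r hr => ?_⟩, fun x hx => Subtype.ext (h₁ ⟨x, hx⟩)⟩
  rw [← map_smul, smul_eq_mul]
  exact h₂ _ (Ideal.mul_mem_right _ _ hr)

namespace LC

lemma toSelf_bijective (h : IsIdealTorsion I M) : Function.Bijective (toSelf I M) :=
  ⟨toSelf_injective I M, fun x => (exists_toSelf_eq_iff I x).mpr (h.exists_pow_smul_eq_zero x)⟩

/-- The zeroth local cohomology of a torsion module is the module itself. -/
noncomputable def zeroEquiv (h : IsIdealTorsion I M) : LC I 0 M ≃ₗ[R] M :=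
  LinearEquiv.ofBijective (toSelf I M) (toSelf_bijective h)

lemma exists_isIdealTorsion_injective_embedding (h : IsIdealTorsion I M) :
    ∃ (J : Type) (_ : AddCommGroup J) (_ : Module R J) (f : M →ₗ[R] J),
      Module.Injective R J ∧ IsIdealTorsion I J ∧ Function.Injective f := by
  obtain ⟨J, _, _, f, hJ, hf⟩ := exists_injective_embedding (R := R) M
  refine ⟨idealTorsionPart I J, inferInstance, inferInstance,
    f.codRestrict _ fun x => ?_, inferInstance, idealTorsionPart_isIdealTorsion I J,
    fun x y hxy => hf (congrArg Subtype.val hxy)⟩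
  obtain ⟨t, ht⟩ := h.exists_pow_smul_eq_zero x
  exact ⟨t, fun r hr => by rw [← _root_.map_smul, ht r hr, _root_.map_zero]⟩

lemma subsingleton_of_isIdealTorsion (n : ℕ) (h : IsIdealTorsion I M) :
    Subsingleton (LC I (n + 1) M) := by
  induction n generalizing M with
  | zero =>
    obtain ⟨J, _, _, f, hJ, hJt, hf⟩ := exists_isIdealTorsion_injective_embedding h
    obtain ⟨δ, h₁, h₂⟩ := LC.exists_connecting I 0 hf
      (Submodule.mkQ_surjective (LinearMap.range f)) (LinearMap.exact_map_mkQ_range f)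
    have := LC.subsingleton_of_injective I 0 (M := J)
    refine subsingleton_of_forall_eq 0 fun z => ?_
    obtain ⟨w, rfl⟩ := (h₂ z).mp (Subsingleton.elim _ _)
    refine (h₁ w).mpr ?_
    obtain ⟨j, hj⟩ := Submodule.mkQ_surjective _ (toSelf I _ w)
    obtain ⟨v, rfl⟩ := (toSelf_bijective hJt).2 j
    exact ⟨v, toSelf_injective I _ ((toSelf_map I _ v).trans hj)⟩
  | succ n ih =>
    obtain ⟨J, _, _, f, hJ, hJt, hf⟩ := exists_isIdealTorsion_injective_embedding h
    obtain ⟨δ, -, h₂⟩ := LC.exists_connecting I (n + 1) hf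
      (Submodule.mkQ_surjective (LinearMap.range f)) (LinearMap.exact_map_mkQ_range f)
    have := LC.subsingleton_of_injective I (n + 1) (M := J)
    have := ih (hJt.of_surjective _ (Submodule.mkQ_surjective (LinearMap.range f)))
    refine subsingleton_of_forall_eq 0 fun z => ?_
    obtain ⟨w, rfl⟩ := (h₂ z).mp (Subsingleton.elim _ _)
    rw [Subsingleton.elim w 0, _root_.map_zero]

end LC

end TorsionPart

section LongExactSequence

variable {R : Type} [CommRing R] {I : Ideal R} {n : ℕ}
  {M : Type} [AddCommGroup M] [Module R M] {N : Type} [AddCommGroup N] [Module R N]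
  {P : Type} [AddCommGroup P] [Module R P]

namespace LC

lemma map_surjective {g : M →ₗ[R] N} (hg : Function.Surjective g)
    (h : Subsingleton (LC I (n + 1) (LinearMap.ker g))) : Function.Surjective (map I n g) := by
  obtain ⟨δ, h₁, -⟩ := exists_connecting I n (LinearMap.ker g).injective_subtype hg
    g.exact_subtype_ker_map
  exact fun z => (h₁ z).mp (Subsingleton.elim _ _)

lemma map_bijective {g : M →ₗ[R] N} (hg : Function.Surjective g)
    (h : Subsingleton (LC I n (LinearMap.ker g)))
    (h' : Subsingleton (LC I (n + 1) (LinearMap.ker g))) : Function.Bijective (map I n g) := by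
  refine ⟨(injective_iff_map_eq_zero _).mpr fun z hz => ?_, map_surjective hg h'⟩
  obtain ⟨w, rfl⟩ := (exact_map I n (LinearMap.ker g).injective_subtype hg
    g.exact_subtype_ker_map z).mp hz
  rw [Subsingleton.elim w 0, _root_.map_zero]

lemma smul_surjective (r : R)
    (h : Subsingleton (LC I n (M ⧸ LinearMap.range (r • (LinearMap.id : M →ₗ[R] M)))))
    (h' : Subsingleton (LC I (n + 1) (LinearMap.ker (r • (LinearMap.id : M →ₗ[R] M)))))
    (z : LC I n M) : ∃ w : LC I n M, r • w = z := by
  set f := r • (LinearMap.id : M →ₗ[R] M) with hf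
  obtain ⟨u, rfl⟩ := (exact_map I n (LinearMap.range f).injective_subtype
    (Submodule.mkQ_surjective _) (LinearMap.exact_subtype_mkQ _) z).mp (Subsingleton.elim _ _)
  obtain ⟨w, rfl⟩ := map_surjective (I := I) (n := n) f.surjective_rangeRestrict
    (by rwa [LinearMap.ker_rangeRestrict]) u
  refine ⟨w, (DFunLike.congr_fun (map_smul_id I n r) w).symm.trans ?_⟩
  exact DFunLike.congr_fun (map_comp I n (LinearMap.range f).subtype f.rangeRestrict) w

end LC

end LongExactSequence

section LocalizationQuotient

variable {R : Type} [CommRing R] (y : R) (M : Type) [AddCommGroup M] [Module R M]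

/-- The cokernel of the localization map `M → M_y`. -/
def LocalizationQuotient : Type :=
  LocalizedModule (Submonoid.powers y) M ⧸
    LinearMap.range (LocalizedModule.mkLinearMap (Submonoid.powers y) M)

noncomputable instance : AddCommGroup (LocalizationQuotient y M) :=
  inferInstanceAs (AddCommGroup (_ ⧸ LinearMap.range _))

noncomputable instance : Module R (LocalizationQuotient y M) :=
  inferInstanceAs (Module R (_ ⧸ LinearMap.range _))

namespace LocalizationQuotient

/-- The projection `M_y → M_y / M`. -/
noncomputable def proj : LocalizedModule (Submonoid.powers y) M →ₗ[R] LocalizationQuotient y M :=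
  (LinearMap.range (LocalizedModule.mkLinearMap (Submonoid.powers y) M)).mkQ

lemma proj_surjective : Function.Surjective (proj y M) := Submodule.mkQ_surjective _

lemma exact_subtype_proj : Function.Exact
    (LinearMap.range (LocalizedModule.mkLinearMap (Submonoid.powers y) M)).subtype (proj y M) :=
  LinearMap.exact_subtype_mkQ _

lemma proj_mk_one (v : M) : proj y M (LocalizedModule.mk v 1) = 0 :=
  (Submodule.Quotient.mk_eq_zero _).mpr ⟨v, rfl⟩

/-- The power `y ^ a` as an element of the submonoid of powers of `y`. -/
def powersElem (a : ℕ) : Submonoid.powers y := ⟨y ^ a, Submonoid.mem_powers_iff _ _ |>.mpr ⟨a, rfl⟩⟩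

/-- The map `v ↦ v / y ^ a`. -/
noncomputable def divPow (a : ℕ) : M →ₗ[R] LocalizationQuotient y M :=
  proj y M ∘ₗ LocalizedModule.divBy (powersElem y a) ∘ₗ
    LocalizedModule.mkLinearMap (Submonoid.powers y) M

lemma divPow_apply (a : ℕ) (v : M) :
    divPow y M a v = proj y M (LocalizedModule.mk v (powersElem y a)) := by
  rw [divPow, LinearMap.comp_apply, LinearMap.comp_apply, LocalizedModule.mkLinearMap_apply,
    LocalizedModule.divBy_apply, LocalizedModule.liftOn_mk, one_mul]

lemma divPow_zero : divPow y M 0 = 0 := by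
  ext v
  rw [divPow_apply, LinearMap.zero_apply, ← proj_mk_one y M v]
  congr 2
  exact Subtype.ext (pow_zero y)

lemma smul_divPow_succ (a : ℕ) : y • divPow y M (a + 1) = divPow y M a := by
  ext v
  rw [LinearMap.smul_apply, divPow_apply, divPow_apply, ← _root_.map_smul]
  congr 1
  rw [LocalizedModule.smul'_mk, LocalizedModule.mk_eq]
  refine ⟨1, ?_⟩
  simp [Submonoid.smul_def, smul_smul, pow_succ, powersElem]

lemma exists_divPow_eq (c : LocalizationQuotient y M) : ∃ a v, divPow y M a v = c := by
  obtain ⟨z, rfl⟩ := proj_surjective y M c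
  induction z using LocalizedModule.induction_on with
  | h v s =>
    obtain ⟨_, a, rfl⟩ := s
    exact ⟨a, v, divPow_apply y M a v⟩

lemma pow_smul_divPow (a : ℕ) (v : M) : y ^ a • divPow y M a v = 0 := by
  induction a with
  | zero => rw [divPow_zero]; simp
  | succ a ih =>
    rw [pow_succ, mul_smul, ← LinearMap.smul_apply y, smul_divPow_succ, ih]

variable {M}

lemma isIdealTorsion {𝔟 : Ideal R} (h : IsIdealTorsion 𝔟 M) :
    IsIdealTorsion (𝔟 ⊔ Ideal.span {y}) (LocalizationQuotient y M) := by
  refine .sup (fun c b hb => ?_) (.span_singleton fun c => ?_)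
  · obtain ⟨a, v, rfl⟩ := exists_divPow_eq y M c
    obtain ⟨n, hn⟩ := h v b hb
    exact ⟨n, by rw [← _root_.map_smul, hn, _root_.map_zero]⟩
  · obtain ⟨a, v, rfl⟩ := exists_divPow_eq y M c
    exact ⟨a, pow_smul_divPow y M a v⟩

lemma isIdealTorsion_ker {𝔟 : Ideal R} (h : IsIdealTorsion 𝔟 M) :
    IsIdealTorsion (𝔟 ⊔ Ideal.span {y})
      (LinearMap.ker (LocalizedModule.mkLinearMap (Submonoid.powers y) M)) := by
  refine .sup (h.of_injective _ (Submodule.injective_subtype _)) (.span_singleton fun c => ?_)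
  obtain ⟨_, ⟨a, rfl⟩, ha⟩ := (LocalizedModule.mem_ker_mkLinearMap_iff).mp c.2
  exact ⟨a, Subtype.ext ha⟩

lemma nonempty_LC_equiv {I : Ideal R} {y : R} (hy : y ∈ I) (k : ℕ)
    (h : Subsingleton (LC I (k + 1)
      (LinearMap.ker (LocalizedModule.mkLinearMap (Submonoid.powers y) M))))
    (h' : Subsingleton (LC I (k + 1 + 1)
      (LinearMap.ker (LocalizedModule.mkLinearMap (Submonoid.powers y) M)))) :
    Nonempty (LC I k (LocalizationQuotient y M) ≃ₗ[R] LC I (k + 1) M) := by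
  set f := LocalizedModule.mkLinearMap (Submonoid.powers y) M with hf
  have h₁ := LC.map_bijective (I := I) (n := k + 1) f.surjective_rangeRestrict
    (by rwa [LinearMap.ker_rangeRestrict]) (by rwa [LinearMap.ker_rangeRestrict])
  obtain ⟨δ, h₂, h₃⟩ := LC.exists_connecting I k (LinearMap.range f).injective_subtype
    (proj_surjective y M) (exact_subtype_proj y M)
  have hbij : Function.Bijective
      (y • (LinearMap.id : LocalizedModule (Submonoid.powers y) M →ₗ[R] _)) :=
    (Module.End.isUnit_iff _).mp
      (IsLocalizedModule.map_units f (⟨y, Submonoid.mem_powers y⟩ : Submonoid.powers y))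
  have h₀ := fun n => LC.subsingleton_of_bijective_smul hy n hbij
  have h₄ : Function.Bijective δ := by
    refine ⟨(injective_iff_map_eq_zero _).mpr fun z hz => ?_,
      fun z => (h₃ z).mp ((h₀ _).elim _ _)⟩
    obtain ⟨w, rfl⟩ := (h₂ z).mp hz
    rw [(h₀ _).elim w 0, _root_.map_zero]
  exact ⟨LinearEquiv.ofBijective δ h₄ ≪≫ₗ (LinearEquiv.ofBijective _ h₁).symm⟩

end LocalizationQuotient

end LocalizationQuotient

section CechLikeIteration

variable {R : Type} [CommRing R]

lemma eq_pow_smul_of_smul_succ {M : Type} [AddCommGroup M] [Module R M] {r : R} {ρ : ℕ → M}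
    (h : ∀ a, r • ρ (a + 1) = ρ a) (a l : ℕ) : ρ a = r ^ l • ρ (a + l) := by
  induction l with
  | zero => simp
  | succ l ih => rw [ih, ← h (a + l), smul_smul, pow_succ, add_assoc]

variable [IsNoetherianRing R]

/-- Local cohomology vanishes above the number of elements needed to cut out the support. -/
lemma LC.subsingleton_of_length_lt {I : Ideal R} (ys : List R) (hys : ∀ y ∈ ys, y ∈ I)
    {𝔟 : Ideal R} {M : Type} [AddCommGroup M] [Module R M] (hM : IsIdealTorsion 𝔟 M)
    (hI : I ≤ (𝔟 ⊔ Ideal.ofList ys).radical) {j : ℕ} (hj : ys.length < j) :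
    Subsingleton (LC I j M) := by
  induction ys generalizing 𝔟 M j with
  | nil =>
    obtain ⟨j, rfl⟩ := Nat.exists_eq_succ_of_ne_zero (Nat.ne_of_gt hj)
    exact subsingleton_of_isIdealTorsion j (hM.mono (by simpa using hI))
  | cons y ys ih =>
    obtain ⟨j, rfl⟩ := Nat.exists_eq_succ_of_ne_zero (Nat.ne_of_gt (Nat.zero_lt_of_lt hj))
    rw [List.length_cons, Nat.succ_lt_succ_iff] at hj
    rw [Ideal.ofList_cons, ← sup_assoc] at hI
    have hys' : ∀ y ∈ ys, y ∈ I := fun z hz => hys z (List.mem_cons_of_mem _ hz)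
    have hΓ := LocalizationQuotient.isIdealTorsion_ker y hM
    obtain ⟨e⟩ := LocalizationQuotient.nonempty_LC_equiv (hys y List.mem_cons_self) j
      (ih hys' hΓ hI (by lia)) (ih hys' hΓ hI (by lia))
    have := ih hys' (LocalizationQuotient.isIdealTorsion y hM) hI hj
    exact e.symm.toEquiv.subsingleton

/-- Iterating the construction `M ↦ M_y / M` along a list `zs` gives a module computing top local
cohomology, together with maps `v ↦ v / zs.prod ^ a` into it. -/
lemma exists_iterated_localizationQuotient (zs : List R) (M : Type) [AddCommGroup M] [Module R M] :
    ∃ (T : Type) (_ : AddCommGroup T) (_ : Module R T) (ρ : ℕ → M →ₗ[R] T),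
      (∀ a, zs.prod • ρ (a + 1) = ρ a) ∧ (zs ≠ [] → ρ 0 = 0) ∧ (∀ c, ∃ a v, ρ a v = c) ∧
      ∀ 𝔟 : Ideal R, IsIdealTorsion 𝔟 M → IsIdealTorsion (𝔟 ⊔ Ideal.ofList zs) T ∧
        ∀ (I : Ideal R) (ws : List R), (∀ z ∈ zs, z ∈ I) → (∀ w ∈ ws, w ∈ I) →
          I ≤ (𝔟 ⊔ Ideal.ofList (zs ++ ws)).radical →
          Nonempty (LC I (zs.length + ws.length) M ≃ₗ[R] LC I ws.length T) := by
  induction zs generalizing M with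
  | nil =>
    refine ⟨M, inferInstance, inferInstance, fun _ => LinearMap.id, fun _ => one_smul _ _,
      fun h => (h rfl).elim, fun c => ⟨0, c, rfl⟩, fun 𝔟 h => ⟨by simpa using h, ?_⟩⟩
    intro I ws _ _ _
    rw [List.length_nil, Nat.zero_add]
    exact ⟨LinearEquiv.refl R _⟩
  | cons y zs ih =>
    obtain ⟨T, _, _, ρ, h₁, -, h₃, h₄⟩ := ih (LocalizationQuotient y M)
    refine ⟨T, inferInstance, inferInstance, fun a => ρ a ∘ₗ LocalizationQuotient.divPow y M a,
      fun a => ?_, fun _ => ?_, fun c => ?_, fun 𝔟 h => ?_⟩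
    · beta_reduce
      rw [← h₁ a, ← LocalizationQuotient.smul_divPow_succ y M a]
      ext v
      simp only [LinearMap.smul_apply, LinearMap.comp_apply, _root_.map_smul, List.prod_cons,
        smul_smul, mul_comm y]
    · change ρ 0 ∘ₗ LocalizationQuotient.divPow y M 0 = 0
      rw [LocalizationQuotient.divPow_zero, LinearMap.comp_zero]
    · obtain ⟨a, u, rfl⟩ := h₃ c
      obtain ⟨b, v, rfl⟩ := LocalizationQuotient.exists_divPow_eq y M u
      rcases le_total a b with h | h
      · obtain ⟨l, rfl⟩ := Nat.exists_eq_add_of_le h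
        refine ⟨a + l, zs.prod ^ l • v, ?_⟩
        rw [eq_pow_smul_of_smul_succ h₁ a l]
        simp
      · obtain ⟨l, rfl⟩ := Nat.exists_eq_add_of_le h
        refine ⟨b + l, y ^ l • v, ?_⟩
        rw [eq_pow_smul_of_smul_succ (LocalizationQuotient.smul_divPow_succ y M) b l]
        simp
    · obtain ⟨h₅, h₆⟩ := h₄ _ (LocalizationQuotient.isIdealTorsion y h)
      refine ⟨by rwa [Ideal.ofList_cons, ← sup_assoc], fun I ws hzs hws hI => ?_⟩
      rw [List.cons_append, Ideal.ofList_cons, ← sup_assoc] at hI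
      have hzs' : ∀ z ∈ zs, z ∈ I := fun z hz => hzs z (List.mem_cons_of_mem _ hz)
      obtain ⟨e⟩ := h₆ I ws hzs' hws hI
      have hΓ := LocalizationQuotient.isIdealTorsion_ker y h
      have hmem : ∀ z ∈ zs ++ ws, z ∈ I := fun z hz =>
        (List.mem_append.mp hz).elim (hzs' z) (hws z)
      obtain ⟨e'⟩ := LocalizationQuotient.nonempty_LC_equiv (hzs y List.mem_cons_self)
        (zs.length + ws.length)
        (LC.subsingleton_of_length_lt _ hmem hΓ hI (by rw [List.length_append]; lia))
        (LC.subsingleton_of_length_lt _ hmem hΓ hI (by rw [List.length_append]; lia))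
      rw [List.length_cons, Nat.add_right_comm]
      exact ⟨e'.symm ≪≫ₗ e⟩

end CechLikeIteration

section Artinian

variable {R : Type} [CommRing R]

/-- Melkersson's criterion: if `K` is `x`-torsion and the kernel of `x` on `K` is artinian, then
`K` is artinian. -/
lemma isArtinian_of_isArtinian_ker_smul {K : Type} [AddCommGroup K] [Module R K] (x : R)
    (hK : ∀ v : K, ∃ n : ℕ, x ^ n • v = 0)
    (h : IsArtinian R (LinearMap.ker (x • (LinearMap.id : K →ₗ[R] K)))) : IsArtinian R K := by
  let P := LinearMap.ker (x • (LinearMap.id : K →ₗ[R] K))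
  let W : ℕ → Submodule R K → Submodule R P := fun l N =>
    (N.map (x ^ l • (LinearMap.id : K →ₗ[R] K))).comap P.subtype
  have mem_W : ∀ l N (v : P), v ∈ W l N ↔ ∃ u ∈ N, x ^ l • u = v := fun l N v => Iff.rfl
  have W_mono : ∀ l l' N N', l' ≤ l → N ≤ N' → W l N ≤ W l' N' := by
    intro l l' N N' hl hN v hv
    obtain ⟨u, hu, huv⟩ := (mem_W _ _ _).mp hv
    refine (mem_W _ _ _).mpr ⟨x ^ (l - l') • u, N'.smul_mem _ (hN hu), ?_⟩
    rw [smul_smul, ← pow_add, Nat.add_sub_cancel' hl, huv]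
  have W_inj : ∀ N N', N ≤ N' → (∀ l, W l N' ≤ W l N) → N' ≤ N := by
    intro N N' hN hW v hv
    obtain ⟨e, he⟩ := hK v
    induction e generalizing v with
    | zero => rw [pow_zero, one_smul] at he; rw [he]; exact N.zero_mem
    | succ e ih =>
      have hmem : x ^ e • v ∈ P := by
        change x • x ^ e • v = 0
        rwa [smul_smul, ← pow_succ']
      obtain ⟨u, hu, huv⟩ := (mem_W e N ⟨_, hmem⟩).mp
        (hW e ((mem_W e N' ⟨_, hmem⟩).mpr ⟨v, hv, rfl⟩))
      have := ih (N'.sub_mem hv (hN hu)) (by rw [smul_sub, huv, sub_self])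
      simpa using N.add_mem this hu
  rw [← monotone_stabilizes_iff_artinian] at h ⊢
  intro f
  let g : ℕ → Submodule R K := fun a => OrderDual.ofDual (f a)
  have hg : Antitone g := fun a b hab => f.monotone hab
  have stab : ∀ V : ℕ → Submodule R P, Antitone V → ∃ n, ∀ m ≥ n, V n = V m :=
    fun V hV => h ⟨fun j => OrderDual.toDual (V j), hV⟩
  obtain ⟨D, hD⟩ := stab (fun j => W j (g j)) fun a b hab => W_mono _ _ _ _ hab (hg hab)
  have hl : ∀ l, ∃ J, ∀ j ≥ J, W l (g J) = W l (g j) := fun l =>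
    stab (fun j => W l (g j)) fun a b hab => W_mono _ _ _ _ le_rfl (hg hab)
  choose J hJ using hl
  refine ⟨max D ((Finset.range D).sup J), fun j hj => ?_⟩
  change g _ = g j
  refine le_antisymm (W_inj _ _ (hg hj) fun l => ?_) (hg hj)
  by_cases hlD : l < D
  · have hJl : J l ≤ max D ((Finset.range D).sup J) :=
      le_max_of_le_right (Finset.le_sup (Finset.mem_range.mpr hlD))
    exact ((hJ l _ hJl).symm.trans (hJ l _ (hJl.trans hj))).le
  · have hDl : D ≤ max l j := le_max_of_le_left (not_lt.mp hlD)
    calc W l (g (max D ((Finset.range D).sup J))) ≤ W D (g D) :=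
          W_mono _ _ _ _ (not_lt.mp hlD) (hg (le_max_left _ _))
      _ = W (max l j) (g (max l j)) := hD _ hDl
      _ ≤ W l (g j) := W_mono _ _ _ _ (le_max_left _ _) (hg (le_max_right _ _))

lemma LC.subsingleton_of_subsingleton (I : Ideal R) (n : ℕ) (M : Type) [AddCommGroup M]
    [Module R M] [Subsingleton M] : Subsingleton (LC I n M) := by
  refine subsingleton_of_forall_eq 0 fun z => ?_
  have h := DFunLike.congr_fun (LC.map_id I n M) z
  rw [Subsingleton.elim (LinearMap.id : M →ₗ[R] M) 0, LC.map_zero] at h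
  exact h.symm

lemma injective_smul_quotient_prime {q : Ideal R} [q.IsPrime] {r : R} (hr : r ∉ q) :
    Function.Injective (r • (LinearMap.id : (R ⧸ q) →ₗ[R] R ⧸ q)) := by
  refine (injective_iff_map_eq_zero _).mpr fun v hv => ?_
  obtain ⟨v, rfl⟩ := Ideal.Quotient.mk_surjective v
  rw [Ideal.Quotient.eq_zero_iff_mem]
  exact ((Ideal.IsPrime.mem_or_mem ‹_›
    (Ideal.Quotient.eq_zero_iff_mem.mp
      (show Ideal.Quotient.mk q (r * v) = 0 from hv)))).resolve_left hr

lemma LC.subsingleton_zero_quotient_prime {I q : Ideal R} [q.IsPrime] {r : R} (hrI : r ∈ I)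
    (hr : r ∉ q) : Subsingleton (LC I 0 (R ⧸ q)) := by
  refine subsingleton_of_forall_eq 0 fun z => ?_
  obtain ⟨k, hk⟩ := LC.isIdealTorsion I 0 (R ⧸ q) z r hrI
  have hrk : r ^ k ∉ q := fun h => hr (Ideal.IsPrime.mem_of_pow_mem ‹_› k h)
  refine toSelf_injective I _ (injective_smul_quotient_prime hrk ?_)
  rw [_root_.map_zero, _root_.map_zero, LinearMap.smul_apply, LinearMap.id_apply, ← _root_.map_smul,
    hk, _root_.map_zero]

variable [IsNoetherianRing R]

lemma isArtinian_LC_of_forall_prime {I : Ideal R} {j : ℕ}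
    (h : ∀ p : Ideal R, p.IsPrime → IsArtinian R (LC I j (R ⧸ p)))
    (M : Type) [AddCommGroup M] [Module R M] [Module.Finite R M] : IsArtinian R (LC I j M) := by
  induction ‹Module.Finite R M› using
      IsNoetherianRing.induction_on_isQuotientEquivQuotientPrime (A := R) with
  | subsingleton N =>
    have := LC.subsingleton_of_subsingleton I j N
    infer_instance
  | quotient N p e =>
    have := h p.1 p.2
    exact (LC.congr I j e).isArtinian_iff.mpr this
  | exact N₁ N₂ N₃ f g hf hg hfg h₁ h₃ =>
    exact isArtinian_of_range_eq_ker _ _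
      (LinearMap.exact_iff.mp (LC.exact_map I j hf hg hfg)).symm

lemma isArtinian_LC_maximalIdeal [IsLocalRing R] (j : ℕ) (M : Type) [AddCommGroup M] [Module R M]
    [Module.Finite R M] : IsArtinian R (LC (maximalIdeal R) j M) := by
  have exists_mem : ∀ p : Ideal R, p.IsPrime → p ≠ maximalIdeal R → ∃ r ∈ maximalIdeal R, r ∉ p :=
    fun p hp hne => SetLike.not_le_iff_exists.mp fun h =>
      hne (le_antisymm (le_maximalIdeal hp.ne_top) h)
  induction j generalizing M with
  | zero =>
    refine isArtinian_LC_of_forall_prime (fun p hp => ?_) M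
    by_cases hpm : p = maximalIdeal R
    · have : IsSimpleModule R (R ⧸ p) := by
        rw [isSimpleModule_iff_quot_maximal]
        exact ⟨p, hpm ▸ maximalIdeal.isMaximal R, ⟨LinearEquiv.refl R _⟩⟩
      exact isArtinian_of_injective _ (LC.toSelf_injective (maximalIdeal R) (R ⧸ p))
    · obtain ⟨r, hr, hrp⟩ := exists_mem p hp hpm
      have := LC.subsingleton_zero_quotient_prime hr hrp
      infer_instance
  | succ j ih =>
    refine isArtinian_LC_of_forall_prime (fun p hp => ?_) M
    by_cases hpm : p = maximalIdeal R
    · have := LC.subsingleton_of_isIdealTorsion (I := maximalIdeal R) (M := R ⧸ p) j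
        (.of_smul_eq_zero fun b hb x => by
          obtain ⟨x, rfl⟩ := Ideal.Quotient.mk_surjective x
          exact Ideal.Quotient.eq_zero_iff_mem.mpr (Ideal.mul_mem_right _ _ (hpm ▸ hb)))
      infer_instance
    · obtain ⟨r, hr, hrp⟩ := exists_mem p hp hpm
      refine isArtinian_of_isArtinian_ker_smul r
        (fun v => LC.isIdealTorsion _ _ _ v r hr) ?_
      obtain ⟨δ, -, hδ⟩ := LC.exists_connecting (maximalIdeal R) j
        (injective_smul_quotient_prime hrp)
        (Submodule.mkQ_surjective _) (LinearMap.exact_map_mkQ_range _)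
      rw [← LC.map_smul_id, LinearMap.exact_iff.mp hδ]
      have := ih ((R ⧸ p) ⧸ LinearMap.range (r • (LinearMap.id : (R ⧸ p) →ₗ[R] R ⧸ p)))
      exact isArtinian_of_surjective _ _ δ.surjective_rangeRestrict

end Artinian

section Dimension

variable {R : Type} [CommRing R]

lemma exists_prime_ringKrullDim_quotient_eq {𝔟 : Ideal R} {n : ℕ}
    (h : ringKrullDim (R ⧸ 𝔟) = n) :
    ∃ q : Ideal R, q.IsPrime ∧ 𝔟 ≤ q ∧ ringKrullDim (R ⧸ q) = n := by
  have hup : ∀ q : Ideal R, 𝔟 ≤ q → ringKrullDim (R ⧸ q) ≤ n := fun q hq =>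
    (ringKrullDim_le_of_surjective (Ideal.Quotient.factor hq)
      (Ideal.Quotient.factor_surjective hq)).trans h.le
  rw [ringKrullDim_quotient] at h
  have : Nonempty (PrimeSpectrum.zeroLocus (R := R) 𝔟) := by
    rw [← Order.krullDim_nonneg_iff, h]
    exact Nat.cast_nonneg n
  obtain ⟨l, hl⟩ := Order.le_krullDim_iff.mp h.ge
  refine ⟨l.head.1.asIdeal, l.head.1.2, l.head.2, (hup _ l.head.2).antisymm ?_⟩
  rw [ringKrullDim_quotient, Order.le_krullDim_iff]
  exact ⟨⟨l.length, fun i => ⟨(l i).1, LTSeries.head_le l i⟩, fun i => l.step i⟩, hl⟩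

variable [IsNoetherianRing R] [IsLocalRing R]

lemma ringKrullDim_quotient_sup_span_add_one {q : Ideal R} [q.IsPrime] {r : R}
    (hr : r ∈ maximalIdeal R) (hrq : r ∉ q) :
    ringKrullDim (R ⧸ q ⊔ Ideal.span {r}) + 1 = ringKrullDim (R ⧸ q) := by
  have : IsLocalRing (R ⧸ q) := .of_surjective' (Ideal.Quotient.mk q) Ideal.Quotient.mk_surjective
  rw [← ringKrullDim_eq_of_ringEquiv (DoubleQuot.quotQuotEquivQuotSup q (Ideal.span {r})),
    Ideal.map_span, Set.image_singleton]
  have : IsLocalHom (Ideal.Quotient.mk q) := .of_surjective _ Ideal.Quotient.mk_surjective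
  exact ringKrullDim_quotient_span_singleton_succ_eq_ringKrullDim_of_mem_nonZeroDivisors
    (mem_nonZeroDivisors_of_ne_zero fun h => hrq (Ideal.Quotient.eq_zero_iff_mem.mp h))
    fun h => hr (isUnit_of_map_unit _ _ h)

lemma exists_list_le_radical {𝔟 : Ideal R} (hb : 𝔟 ≠ ⊤) {k : ℕ}
    (h : ringKrullDim (R ⧸ 𝔟) = k) :
    ∃ ys : List R, ys.length = k ∧ (∀ y ∈ ys, y ∈ maximalIdeal R) ∧
      maximalIdeal R ≤ (𝔟 ⊔ Ideal.ofList ys).radical := by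
  have : Nontrivial (R ⧸ 𝔟) := Ideal.Quotient.nontrivial_iff.mpr hb
  have : IsLocalRing (R ⧸ 𝔟) := .of_surjective' (Ideal.Quotient.mk 𝔟) Ideal.Quotient.mk_surjective
  have hloc : IsLocalHom (Ideal.Quotient.mk 𝔟) := .of_surjective _ Ideal.Quotient.mk_surjective
  obtain ⟨s, hs, hcard⟩ :=
    (maximalIdeal (R ⧸ 𝔟)).exists_finset_card_eq_height_of_isNoetherianRing
  have hmem : ∀ r : R, Ideal.Quotient.mk 𝔟 r ∈ maximalIdeal (R ⧸ 𝔟) ↔ r ∈ maximalIdeal R :=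
    map_mem_nonunits_iff (Ideal.Quotient.mk 𝔟)
  have hout : ∀ x : R ⧸ 𝔟, Ideal.Quotient.mk 𝔟 x.out = x := Quotient.out_eq
  refine ⟨s.toList.map Quotient.out, ?_, fun y hy => ?_, ?_⟩
  · rw [List.length_map, Finset.length_toList]
    rw [← IsLocalRing.maximalIdeal_height_eq_ringKrullDim, ← hcard] at h
    exact_mod_cast h
  · obtain ⟨x, hx, rfl⟩ := List.mem_map.mp hy
    exact (hmem _).mp ((hout x).symm ▸ hs.1.2 (Ideal.subset_span (Finset.mem_toList.mp hx)))
  · rw [Ideal.radical_eq_sInf]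
    refine le_sInf fun P ⟨hP, hPp⟩ r hr => ?_
    have hbP : 𝔟 ≤ P := le_sup_left.trans hP
    have hker : RingHom.ker (Ideal.Quotient.mk 𝔟) ≤ P := by rwa [Ideal.mk_ker]
    have := Ideal.map_isPrime_of_surjective Ideal.Quotient.mk_surjective hker
    have hsP : Ideal.span s ≤ P.map (Ideal.Quotient.mk 𝔟) := Ideal.span_le.mpr fun x hx => by
      rw [← hout x]
      exact Ideal.mem_map_of_mem _ (hP (Ideal.mem_sup_right (Ideal.subset_span
        (List.mem_map_of_mem (Finset.mem_toList.mpr hx)))))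
    have := hs.2 ⟨this, hsP⟩ (le_maximalIdeal this.ne_top) ((hmem r).mpr hr)
    rwa [← Ideal.mem_comap, Ideal.comap_map_of_surjective' _ Ideal.Quotient.mk_surjective,
      sup_eq_left.mpr hker] at this

end Dimension

section Nonvanishing

variable {R : Type} [CommRing R]

lemma isIdealTorsion_quotient (𝔟 : Ideal R) : IsIdealTorsion 𝔟 (R ⧸ 𝔟) :=
  .of_smul_eq_zero fun b hb x => by
    obtain ⟨x, rfl⟩ := Ideal.Quotient.mk_surjective x
    exact Ideal.Quotient.eq_zero_iff_mem.mpr (Ideal.mul_mem_right _ _ hb)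

lemma IsIdealTorsion.quotient_range_smul {𝔟 : Ideal R} {M : Type} [AddCommGroup M] [Module R M]
    (h : IsIdealTorsion 𝔟 M) (r : R) :
    IsIdealTorsion (𝔟 ⊔ Ideal.span {r})
      (M ⧸ LinearMap.range (r • (LinearMap.id : M →ₗ[R] M))) :=
  (h.of_surjective _ (Submodule.mkQ_surjective _)).sup (.span_singleton fun x => by
    obtain ⟨x, rfl⟩ := Submodule.mkQ_surjective _ x
    refine ⟨1, ?_⟩
    rw [pow_one, ← map_smul]
    exact (Submodule.Quotient.mk_eq_zero _).mpr ⟨x, rfl⟩)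

variable [IsNoetherianRing R] [IsLocalRing R]

lemma nontrivial_LC_quotient_range_smul {n : ℕ} {q : Ideal R} [q.IsPrime]
    (hq : ringKrullDim (R ⧸ q) = (n + 1 : ℕ))
    (ih : ∀ q' : Ideal R, q'.IsPrime → ringKrullDim (R ⧸ q') = n →
      Nontrivial (LC (maximalIdeal R) n (R ⧸ q')))
    {r : R} (hr : r ∈ maximalIdeal R) (hrq : r ∉ q) :
    (∃ ys : List R, ys.length = n ∧ (∀ y ∈ ys, y ∈ maximalIdeal R) ∧
      maximalIdeal R ≤ (q ⊔ Ideal.span {r} ⊔ Ideal.ofList ys).radical) ∧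
    Nontrivial (LC (maximalIdeal R) n
      ((R ⧸ q) ⧸ LinearMap.range (r • (LinearMap.id : (R ⧸ q) →ₗ[R] R ⧸ q)))) := by
  have hdim : ringKrullDim (R ⧸ q ⊔ Ideal.span {r}) = n := by
    have := ringKrullDim_quotient_sup_span_add_one hr hrq
    rw [hq, Nat.cast_add, Nat.cast_one] at this
    exact ENat.WithBot.add_one_cancel.mp this
  have hne : q ⊔ Ideal.span {r} ≠ ⊤ := fun h =>
    (maximalIdeal.isMaximal R).ne_top (top_le_iff.mp (h ▸ sup_le
      (le_maximalIdeal (Ideal.IsPrime.ne_top ‹_›))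
      ((Ideal.span_singleton_le_iff_mem _).mpr hr)))
  obtain ⟨ys, hlen, hys, hrad⟩ := exists_list_le_radical hne hdim
  refine ⟨⟨ys, hlen, hys, hrad⟩, ?_⟩
  obtain ⟨q', hq', hle, hdim'⟩ := exists_prime_ringKrullDim_quotient_eq hdim
  have := ih q' hq' hdim'
  have hqq' : q ≤ q' := le_sup_left.trans hle
  have hrq' : r ∈ q' := hle (Ideal.mem_sup_right (Ideal.mem_span_singleton_self r))
  let π : (R ⧸ q) ⧸ LinearMap.range (r • (LinearMap.id : (R ⧸ q) →ₗ[R] R ⧸ q)) →ₗ[R] R ⧸ q' :=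
    Submodule.liftQ _ (Submodule.factor hqq') (by
      rintro _ ⟨x, rfl⟩
      obtain ⟨x, rfl⟩ := Ideal.Quotient.mk_surjective x
      exact Ideal.Quotient.eq_zero_iff_mem.mpr (Ideal.mul_mem_right x q' hrq'))
  have hπ : Function.Surjective π := fun c => by
    obtain ⟨c, rfl⟩ := Ideal.Quotient.mk_surjective c
    exact ⟨Submodule.mkQ _ (Ideal.Quotient.mk q c), rfl⟩
  exact (LC.map_surjective hπ (LC.subsingleton_of_length_lt ys hys
    (((isIdealTorsion_quotient q).quotient_range_smul r).of_injective _
      (Submodule.injective_subtype _)) hrad (by lia))).nontrivial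

/-- **Grothendieck nonvanishing** for the local domain `R ⧸ q`. -/
lemma nontrivial_LC_quotient_prime (n : ℕ) (q : Ideal R) (hqp : q.IsPrime)
    (hq : ringKrullDim (R ⧸ q) = n) : Nontrivial (LC (maximalIdeal R) n (R ⧸ q)) := by
  induction n generalizing q with
  | zero =>
    have hmq : maximalIdeal R ≤ q := fun r hr => by
      by_contra hrq
      have h := ringKrullDim_quotient_sup_span_add_one hr hrq
      have hne : q ⊔ Ideal.span {r} ≠ ⊤ := fun h => (maximalIdeal.isMaximal R).ne_top
        (top_le_iff.mp (h ▸ sup_le (le_maximalIdeal hqp.ne_top)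
          ((Ideal.span_singleton_le_iff_mem _).mpr hr)))
      have := Ideal.Quotient.nontrivial_iff.mpr hne
      have hle := add_le_add_left
        (ringKrullDim_nonneg_of_nontrivial (R := R ⧸ q ⊔ Ideal.span {r})) 1
      rw [h, hq] at hle
      rw [zero_add] at hle
      exact absurd hle (by exact_mod_cast Nat.not_succ_le_zero 0)
    exact (LC.zeroEquiv ((isIdealTorsion_quotient q).mono
      (hmq.trans Ideal.le_radical))).toEquiv.nontrivial
  | succ n ih =>
    by_contra hK
    rw [not_nontrivial_iff_subsingleton] at hK
    obtain ⟨r₀, hr₀, hr₀q⟩ : ∃ r ∈ maximalIdeal R, r ∉ q := by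
      by_contra! h
      have hqm : q = maximalIdeal R := le_antisymm (le_maximalIdeal hqp.ne_top) h
      have := ringKrullDim_eq_zero_of_isField
        ((Ideal.Quotient.maximal_ideal_iff_isField_quotient q).mp
          (hqm ▸ maximalIdeal.isMaximal R))
      rw [hq] at this
      exact Nat.succ_ne_zero n (by exact_mod_cast this)
    have key := fun r hr hrq => nontrivial_LC_quotient_range_smul hq ih (r := r) hr hrq
    have hexact : ∀ r, r ∉ q →
        Function.Exact (LC.map (maximalIdeal R) n (r • (LinearMap.id : (R ⧸ q) →ₗ[R] R ⧸ q)))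
          (LC.map (maximalIdeal R) n (Submodule.mkQ _)) := fun r hrq =>
      LC.exact_map _ _ (injective_smul_quotient_prime hrq) (Submodule.mkQ_surjective _)
        (LinearMap.exact_map_mkQ_range _)
    have hsurj : ∀ r, r ∉ q → Function.Surjective (LC.map (maximalIdeal R) n
        (Submodule.mkQ (LinearMap.range (r • (LinearMap.id : (R ⧸ q) →ₗ[R] R ⧸ q))))) := by
      intro r hrq z
      obtain ⟨δ, h, -⟩ := LC.exists_connecting (maximalIdeal R) n
        (injective_smul_quotient_prime hrq)
        (Submodule.mkQ_surjective _) (LinearMap.exact_map_mkQ_range _)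
      exact (h z).mp (Subsingleton.elim _ _)
    have hnot : ∀ s ∈ maximalIdeal R, s ∉ q →
        ¬ ∀ z : LC (maximalIdeal R) n (R ⧸ q), ∃ w : LC (maximalIdeal R) n (R ⧸ q), s • w = z := by
      intro s hs hsq hall
      obtain ⟨-, hnt⟩ := key s hs hsq
      obtain ⟨c, hc⟩ := exists_ne (0 : LC (maximalIdeal R) n
        ((R ⧸ q) ⧸ LinearMap.range (s • (LinearMap.id : (R ⧸ q) →ₗ[R] R ⧸ q))))
      obtain ⟨z, rfl⟩ := hsurj s hsq c
      obtain ⟨w, rfl⟩ := hall z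
      refine hc ((hexact s hsq _).mpr ⟨w, ?_⟩)
      rw [LC.map_smul_id]
      rfl
    have hart := isArtinian_LC_maximalIdeal (R := R) n (R ⧸ q)
    let K := LC (maximalIdeal R) n (R ⧸ q)
    let F : R → Submodule R K := fun r => LinearMap.range (r • (LinearMap.id : K →ₗ[R] K))
    obtain ⟨_, ⟨r, ⟨hr, hrq⟩, rfl⟩, hmin⟩ := IsArtinian.set_has_minimal
      (F '' {r | r ∈ maximalIdeal R ∧ r ∉ q}) ⟨_, r₀, ⟨hr₀, hr₀q⟩, rfl⟩
    obtain ⟨⟨ys, hlen, hys, hrad⟩, hnt⟩ := key r hr hrq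
    have hA := (isIdealTorsion_quotient q).quotient_range_smul r
    cases ys with
    | nil =>
      rw [List.length_nil] at hlen
      subst hlen
      have := LC.subsingleton_zero_quotient_prime hr hrq
      exact hnot r hr hrq fun z => ⟨0, Subsingleton.elim _ _⟩
    | cons s zs =>
      have hs := hys s List.mem_cons_self
      have hzs : ∀ z ∈ zs, z ∈ maximalIdeal R := fun z hz => hys z (List.mem_cons_of_mem _ hz)
      rw [List.length_cons] at hlen
      have hrad' := hrad
      rw [Ideal.ofList_cons, ← sup_assoc] at hrad'
      have hsq : s ∉ q := fun hsq => by
        rw [sup_eq_left.mpr ((Ideal.span_singleton_le_iff_mem _).mpr (Ideal.mem_sup_left hsq))]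
          at hrad'
        exact not_subsingleton_iff_nontrivial.mpr hnt
          (LC.subsingleton_of_length_lt zs hzs hA hrad' (by lia))
      refine hnot s hs hsq fun z => ?_
      obtain ⟨w', hw'⟩ := LC.smul_surjective s
        (LC.subsingleton_of_length_lt zs hzs (hA.quotient_range_smul s) hrad' (by lia))
        (LC.subsingleton_of_length_lt (s :: zs) hys
          (hA.of_injective _ (Submodule.injective_subtype _)) hrad
          (by rw [List.length_cons]; lia))
        (LC.map (maximalIdeal R) n (Submodule.mkQ
          (LinearMap.range (r • (LinearMap.id : (R ⧸ q) →ₗ[R] R ⧸ q)))) z)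
      obtain ⟨w, rfl⟩ := hsurj r hrq w'
      obtain ⟨u, hu⟩ := (hexact r hrq (z - s • w)).mp
        (by rw [_root_.map_sub, _root_.map_smul, hw', sub_self])
      rw [LC.map_smul_id] at hu
      have hle : F (s * r) ≤ F r := by
        rintro _ ⟨v, rfl⟩
        exact ⟨s • v, by simp [smul_smul, mul_comm]⟩
      have hsr : F r ≤ F (s * r) := by
        by_contra hnle
        exact hmin _ ⟨s * r, ⟨Ideal.mul_mem_right _ _ hs,
          fun h => (hqp.mem_or_mem h).elim hsq hrq⟩, rfl⟩ (lt_of_le_not_ge hle hnle)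
      obtain ⟨u', hu'⟩ := hsr ⟨u, rfl⟩
      refine ⟨w + r • u', ?_⟩
      have hu'' : (s * r) • u' = r • u := hu'
      rw [smul_add, smul_smul, hu'', add_comm]
      exact eq_sub_iff_add_eq.mp hu

end Nonvanishing

section Functionals

variable {R : Type} [CommRing R]

lemma exists_pow_smul_eq {N : Type} [AddCommGroup N] [Module R N] {x : R}
    (h : ∀ v : N, ∃ w, x • w = v) (k : ℕ) (v : N) : ∃ w, x ^ k • w = v := by
  induction k generalizing v with
  | zero => exact ⟨v, by simp⟩
  | succ k ih =>
    obtain ⟨u, rfl⟩ := ih v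
    obtain ⟨w, rfl⟩ := h u
    exact ⟨w, by rw [smul_smul, pow_succ]⟩

/-- Gluing: every value of a functional on `T` is attained by a single functional on `N`. -/
lemma exists_linearMap_forall_exists_eq {N T E : Type} [AddCommGroup N] [Module R N]
    [AddCommGroup T] [Module R T] [AddCommGroup E] [Module R E] {x y : R}
    (htor : ∀ v : N, ∃ k : ℕ, x ^ k • v = 0) (hdiv : ∀ v : N, ∃ w, x • w = v)
    (ρ : ℕ → N →ₗ[R] T) (hρ : ∀ a, y • ρ (a + 1) = ρ a) (hρ₀ : ρ 0 = 0)
    (hsurj : ∀ t, ∃ a v, ρ a v = t) (ψ : T →ₗ[R] E) :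
    ∃ φ : N →ₗ[R] E, ∀ t, ∃ w, φ w = ψ t := by
  have htor' : ∀ (v : N) (k l : ℕ), x ^ k • v = 0 → k ≤ l → x ^ l • v = 0 := by
    intro v k l hk hkl
    rw [← Nat.sub_add_cancel hkl, pow_add, mul_smul, hk, smul_zero]
  have hρ' : ∀ b k, b ≤ k → y ^ k • ρ b = 0 := by
    intro b k hbk
    have := eq_pow_smul_of_smul_succ hρ 0 b
    rw [zero_add, hρ₀] at this
    rw [← Nat.sub_add_cancel hbk, pow_add, mul_smul, ← this, smul_zero]
  let F : ℕ → N →ₗ[R] E := fun l => ψ ∘ₗ ρ (l * l) ∘ₗ (x ^ (l * l) • LinearMap.id)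
  have hF : ∀ l v, F l v = ψ (ρ (l * l) (x ^ (l * l) • v)) := fun l v => rfl
  have hfin : ∀ v, (Function.support fun l => F l v).Finite := by
    intro v
    obtain ⟨k, hk⟩ := htor v
    refine (Set.finite_lt_nat k).subset fun l hl => ?_
    by_contra hkl
    refine hl ?_
    change F l v = 0
    rw [hF, htor' v k _ hk ((not_lt.mp hkl).trans (Nat.le_mul_self l)), map_zero, map_zero]
  let φ : N →ₗ[R] E :=
    { toFun := fun v => ∑ᶠ l, F l v
      map_add' := fun v w => by simp_rw [map_add]; exact finsum_add_distrib (hfin v) (hfin w)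
      map_smul' := fun c v => by
        simp_rw [map_smul, RingHom.id_apply]
        exact (smul_finsum' c (hfin v)).symm }
  refine ⟨φ, fun t => ?_⟩
  obtain ⟨a, v, rfl⟩ := hsurj t
  obtain ⟨k, hk⟩ := htor v
  obtain ⟨l, hal, hkl⟩ : ∃ l, a ≤ l ∧ k ≤ l := ⟨max a k, le_max_left _ _, le_max_right _ _⟩
  obtain ⟨v, rfl⟩ := exists_pow_smul_eq hdiv (l * l) v
  have hall : a ≤ l * l := hal.trans (Nat.le_mul_self l)
  refine ⟨y ^ (l * l - a) • v, ?_⟩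
  change ∑ᶠ j, F j (y ^ (l * l - a) • v) = _
  rw [finsum_eq_single _ l fun j hj => ?_]
  · rw [hF, eq_pow_smul_of_smul_succ hρ a (l * l - a), Nat.add_sub_cancel' hall, smul_comm,
      map_smul,
      LinearMap.smul_apply]
  · rw [hF, smul_comm, map_smul]
    rcases lt_or_gt_of_ne hj with hjl | hlj
    · have hle : j * j ≤ l * l - a := by
        have : j * j + l ≤ l * l := by nlinarith
        lia
      rw [← LinearMap.smul_apply, hρ' _ _ hle, LinearMap.zero_apply, map_zero]
    · have hle : k ≤ j * j - l * l := by
        have : l * l + l ≤ j * j := by nlinarith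
        lia
      have hjl : l * l ≤ j * j := Nat.mul_self_le_mul_self hlj.le
      have := htor' _ _ _ hk hle
      rw [smul_smul, ← pow_add, Nat.sub_add_cancel hjl] at this
      rw [this, map_zero, smul_zero, map_zero]

lemma exists_linearMap_ne_zero [IsLocalRing R] {T E : Type} [AddCommGroup T] [Module R T]
    [AddCommGroup E] [Module R E] (hE : IsInjectiveHullOfResidueField R E) [Nontrivial T] :
    ∃ ψ : T →ₗ[R] E, ψ ≠ 0 := by
  obtain ⟨hinj, f, hf, -⟩ := hE
  obtain ⟨t, ht⟩ := exists_ne (0 : T)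
  let u := LinearMap.toSpanSingleton R T t
  have hle : LinearMap.ker u ≤ LinearMap.ker (f ∘ₗ Algebra.linearMap R (ResidueField R)) := by
    intro r hr
    have hrm : r ∈ maximalIdeal R := fun hu => ht ((hu.smul_eq_zero).mp hr)
    change f (residue R r) = 0
    rw [(residue_eq_zero_iff r).mpr hrm, map_zero]
  obtain ⟨ψ, hψ⟩ := Module.Injective.out ((LinearMap.ker u).liftQ u le_rfl)
    (LinearMap.ker_eq_bot.mp (Submodule.ker_liftQ_eq_bot _ _ _ le_rfl))
    ((LinearMap.ker u).liftQ _ hle)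
  refine ⟨ψ, fun h => ?_⟩
  have h1 := hψ (Submodule.Quotient.mk 1)
  rw [h, LinearMap.zero_apply] at h1
  have : f (algebraMap R (ResidueField R) 1) = 0 := h1.symm
  rw [map_one] at this
  exact one_ne_zero (hf (this.trans (map_zero f).symm))

end Functionals

section Final

variable {R : Type} [CommRing R] [IsNoetherianRing R]

lemma LC.exists_smul_eq_of_cons (x : R) (xs : List R) (M : Type) [AddCommGroup M] [Module R M]
    (z : LC (Ideal.ofList (x :: xs)) (x :: xs).length M) :
    ∃ w : LC (Ideal.ofList (x :: xs)) (x :: xs).length M, x • w = z := by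
  have hxs : ∀ y ∈ x :: xs, y ∈ Ideal.ofList (x :: xs) := fun y hy => Ideal.subset_span hy
  refine LC.smul_surjective x ?_ ?_ z
  · refine LC.subsingleton_of_length_lt xs (fun y hy => hxs y (List.mem_cons_of_mem _ hy))
      ((IsIdealTorsion.bot (R := R) (M := M)).quotient_range_smul x) ?_ (by simp)
    rw [bot_sup_eq, ← Ideal.ofList_cons]
    exact Ideal.le_radical
  · refine LC.subsingleton_of_length_lt (x :: xs) hxs .bot ?_ (by simp)
    rw [bot_sup_eq]
    exact Ideal.le_radical

variable [IsLocalRing R]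

lemma exists_list_of_notMem {q : Ideal R} [q.IsPrime] {n : ℕ} (hq : ringKrullDim (R ⧸ q) = n)
    {r : R} (hr : r ∈ maximalIdeal R) (hrq : r ∉ q) :
    ∃ ys : List R, ys.length < n ∧ (∀ y ∈ ys, y ∈ maximalIdeal R) ∧
      maximalIdeal R ≤ (q ⊔ Ideal.span {r} ⊔ Ideal.ofList ys).radical := by
  have hne : q ⊔ Ideal.span {r} ≠ ⊤ := fun h =>
    (maximalIdeal.isMaximal R).ne_top (top_le_iff.mp (h ▸ sup_le
      (le_maximalIdeal (Ideal.IsPrime.ne_top ‹_›))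
      ((Ideal.span_singleton_le_iff_mem _).mpr hr)))
  have hdim := ringKrullDim_quotient_sup_span_add_one hr hrq
  rw [hq] at hdim
  cases n with
  | zero =>
    have := Ideal.Quotient.nontrivial_iff.mpr hne
    have h := add_le_add_left (ringKrullDim_nonneg_of_nontrivial (R := R ⧸ q ⊔ Ideal.span {r})) 1
    rw [hdim, zero_add] at h
    exact absurd (by exact_mod_cast h) (Nat.not_succ_le_zero 0)
  | succ k =>
    rw [Nat.cast_add, Nat.cast_one] at hdim
    obtain ⟨ys, hlen, hys⟩ := exists_list_le_radical hne (ENat.WithBot.add_one_cancel.mp hdim)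
    exact ⟨ys, by lia, hys⟩

/-- An element outside the prime `q` acts surjectively on the top local cohomology of `R ⧸ q`. -/
lemma LC.exists_smul_eq_of_notMem {q : Ideal R} [q.IsPrime] {n : ℕ}
    (hq : ringKrullDim (R ⧸ q) = n) {c : R} (hc : c ∉ q)
    (z : LC (maximalIdeal R) n (R ⧸ q)) : ∃ w : LC (maximalIdeal R) n (R ⧸ q), c • w = z := by
  by_cases hcm : c ∈ maximalIdeal R
  · obtain ⟨ys, hlen, hys, hrad⟩ := exists_list_of_notMem hq hcm hc
    refine LC.smul_surjective c (LC.subsingleton_of_length_lt ys hys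
      ((isIdealTorsion_quotient q).quotient_range_smul c) hrad hlen) ?_ z
    rw [LinearMap.ker_eq_bot.mpr (injective_smul_quotient_prime hc)]
    exact LC.subsingleton_of_subsingleton _ _ _
  · obtain ⟨u, rfl⟩ := not_not.mp hcm
    exact ⟨(↑u⁻¹ : R) • z, by rw [smul_smul, Units.mul_inv, one_smul]⟩

end Final

section MatlisDual

variable {R : Type} [CommRing R] [IsNoetherianRing R] [IsLocalRing R]

/-- The Matlis dual of `H^i_{(x, xs)}(R ⧸ q)` has an element whose annihilator is contained in
`q`. -/
lemma exists_linearMap_LC_quotient {q : Ideal R} [q.IsPrime] (x y : R) (xs ys : List R)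
    (hxs : ∀ z ∈ x :: xs, z ∈ maximalIdeal R) (hys : ∀ z ∈ y :: ys, z ∈ maximalIdeal R)
    (hdim : ringKrullDim (R ⧸ q) = ((x :: xs).length + (y :: ys).length : ℕ))
    (hrad : maximalIdeal R ≤ (q ⊔ Ideal.ofList ((x :: xs) ++ (y :: ys))).radical)
    {E : Type} [AddCommGroup E] [Module R E] (hE : IsInjectiveHullOfResidueField R E) :
    ∃ φ : LC (Ideal.ofList (x :: xs)) (x :: xs).length (R ⧸ q) →ₗ[R] E,
      ∀ c : R, c • φ = 0 → c ∈ q := by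
  obtain ⟨N, _, _, -, -, -, -, hN⟩ := exists_iterated_localizationQuotient (x :: xs) (R ⧸ q)
  obtain ⟨hNtor, hN⟩ := hN q (isIdealTorsion_quotient q)
  obtain ⟨T, _, _, ρ, hρ, hρ₀, hsurj, hT⟩ := exists_iterated_localizationQuotient (y :: ys) N
  obtain ⟨hTtor, hT⟩ := hT _ hNtor
  have hrad' := hrad
  rw [Ideal.ofList_append, ← sup_assoc] at hrad'
  obtain ⟨e₁⟩ := hN (Ideal.ofList (x :: xs)) [] (fun z hz => Ideal.subset_span hz) (by simp)
    (by rw [List.append_nil]; exact le_sup_right.trans Ideal.le_radical)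
  obtain ⟨e₂⟩ := hN (maximalIdeal R) (y :: ys) hxs hys hrad
  obtain ⟨e₃⟩ := hT (maximalIdeal R) [] hys (by simp) (by rwa [List.append_nil])
  let e : LC (Ideal.ofList (x :: xs)) (x :: xs).length (R ⧸ q) ≃ₗ[R] N :=
    e₁ ≪≫ₗ LC.zeroEquiv (hNtor.mono (le_sup_right.trans Ideal.le_radical))
  let e' : LC (maximalIdeal R) ((x :: xs).length + (y :: ys).length) (R ⧸ q) ≃ₗ[R] T :=
    e₂ ≪≫ₗ e₃ ≪≫ₗ LC.zeroEquiv (hTtor.mono hrad')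
  have := nontrivial_LC_quotient_prime _ q ‹_› hdim
  have : Nontrivial T := e'.symm.toEquiv.nontrivial
  obtain ⟨ψ, hψ⟩ := exists_linearMap_ne_zero (T := T) hE
  obtain ⟨φ, hφ⟩ := exists_linearMap_forall_exists_eq (x := x) (y := (y :: ys).prod)
    (fun v => hNtor v x (Ideal.mem_sup_right (Ideal.subset_span List.mem_cons_self)))
    (fun v => by
      obtain ⟨w, hw⟩ := LC.exists_smul_eq_of_cons x xs (R ⧸ q) (e.symm v)
      exact ⟨e w, by rw [← map_smul, hw, e.apply_symm_apply]⟩)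
    ρ hρ (hρ₀ (List.cons_ne_nil _ _)) hsurj ψ
  refine ⟨φ ∘ₗ e.toLinearMap, fun c hc => ?_⟩
  by_contra hcq
  refine hψ (LinearMap.ext fun t => ?_)
  obtain ⟨w, hw⟩ := LC.exists_smul_eq_of_notMem hdim hcq (e'.symm t)
  obtain ⟨v, hv⟩ := hφ (e' w)
  have hcv : c • φ (e (e.symm v)) = 0 := LinearMap.congr_fun hc (e.symm v)
  rw [e.apply_symm_apply, hv, ← map_smul, ← map_smul, hw, e'.apply_symm_apply] at hcv
  exact hcv

/-- The Matlis dual of `H^i_{(x, xs)}(R)` has `q` as an associated prime. -/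
lemma isAssociatedPrime_dual_LC {q : Ideal R} [hq : q.IsPrime] (x y : R) (xs ys : List R)
    (hxs : ∀ z ∈ x :: xs, z ∈ maximalIdeal R) (hys : ∀ z ∈ y :: ys, z ∈ maximalIdeal R)
    (hdim : ringKrullDim (R ⧸ q) = ((x :: xs).length + (y :: ys).length : ℕ))
    (hrad : maximalIdeal R ≤ (q ⊔ Ideal.ofList ((x :: xs) ++ (y :: ys))).radical)
    {E : Type} [AddCommGroup E] [Module R E] (hE : IsInjectiveHullOfResidueField R E) :
    IsAssociatedPrime q (LC (Ideal.ofList (x :: xs)) (x :: xs).length R →ₗ[R] E) := by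
  obtain ⟨φ, hφ⟩ := exists_linearMap_LC_quotient x y xs ys hxs hys hdim hrad hE
  have hsurj : Function.Surjective
      (LC.map (Ideal.ofList (x :: xs)) (x :: xs).length (Submodule.mkQ q)) :=
    LC.map_surjective (Submodule.mkQ_surjective q)
      (LC.subsingleton_of_length_lt (x :: xs) (fun z hz => Ideal.subset_span hz) .bot
        (by rw [bot_sup_eq]; exact Ideal.le_radical) (Nat.lt_succ_self _))
  refine isAssociatedPrime_iff.mpr ⟨hq,
    φ ∘ₗ LC.map (Ideal.ofList (x :: xs)) (x :: xs).length (Submodule.mkQ q), ?_⟩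
  ext c
  rw [Submodule.mem_colon_singleton, Submodule.mem_bot]
  refine ⟨fun hc => ?_, fun hc => hφ c (LinearMap.ext fun z => ?_)⟩
  · have hzero : c • (LinearMap.id : (R ⧸ q) →ₗ[R] R ⧸ q) = 0 := LinearMap.ext fun v => by
      obtain ⟨v, rfl⟩ := Ideal.Quotient.mk_surjective v
      exact Ideal.Quotient.eq_zero_iff_mem.mpr (Ideal.mul_mem_right _ _ hc)
    have hLC : c • (LinearMap.id :
        LC (Ideal.ofList (x :: xs)) (x :: xs).length (R ⧸ q) →ₗ[R] _) = 0 := by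
      rw [← LC.map_smul_id, hzero, LC.map_zero]
    refine LinearMap.ext fun z => ?_
    have := LinearMap.congr_fun hLC
      (LC.map (Ideal.ofList (x :: xs)) (x :: xs).length (Submodule.mkQ q) z)
    change c • φ _ = 0
    rw [← map_smul]
    exact (congrArg φ this).trans (map_zero φ)
  · obtain ⟨z, rfl⟩ := hsurj z
    exact LinearMap.congr_fun hc z

end MatlisDual

lemma Ideal.ofList_ofFn {R : Type} [CommRing R] {n : ℕ} (x : Fin n → R) :
    Ideal.ofList (List.ofFn x) = Ideal.span (Set.range x) :=
  congrArg Ideal.span (Set.ext fun r => by simp [List.mem_ofFn])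

/-- Theorem 2.2.3, second inclusion: Let `(R,m)` be a noetherian local ring of
mixed characteristic with `p = char(R/m)` (so `char R = 0` and `char (R/m) = p > 0`),
`i ≥ 1` and `x_1,…,x_i ∈ R`.  Then every prime `q` such that `p, x_1,…,x_i` is part of a
system of parameters for `R/q` is an associated prime of `D(H^i_{(x_1,…,x_i)R}(R))`. -/
theorem stmt11 (R : Type) [CommRing R] [IsLocalRing R] [IsNoetherianRing R] [CharZero R]
    (p : ℕ) (hp : p.Prime) [CharP (ResidueField R) p]
    (i : ℕ) (hi : 1 ≤ i) (x : Fin i → R)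
    (E : Type) [AddCommGroup E] [Module R E] (hE : IsInjectiveHullOfResidueField R E) :
    { q : Ideal R | q.IsPrime ∧ IsPartOfSystemOfParameters q (Fin.cons (p : R) x) } ⊆
      associatedPrimes R
        (LocalCohomologyModule (Ideal.span (Set.range x)) i R →ₗ[R] E) := by
  rintro q ⟨hq, n, hn, y, hyx, hdim, hrad⟩
  obtain ⟨i, rfl⟩ := Nat.exists_eq_add_of_le' hi
  obtain ⟨k, rfl⟩ := Nat.exists_eq_add_of_le hn
  have hym : ∀ j, y j ∈ maximalIdeal R := fun j =>
    hrad ▸ Ideal.le_radical (Ideal.mem_sup_right (Ideal.subset_span ⟨j, rfl⟩))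
  have hy₀ : y (Fin.castLE hn 0) = (p : R) := hyx 0
  have hy₁ : ∀ j : Fin (i + 1), y (Fin.castLE hn j.succ) = x j := fun j => hyx j.succ
  let xs : List R := List.ofFn fun j : Fin i => x j.succ
  let ys : List R := List.ofFn fun j : Fin k => y (Fin.natAdd (i + 1 + 1) j)
  have hcons : x 0 :: xs = List.ofFn x := List.ofFn_succ.symm
  have hlen : (x 0 :: xs).length = i + 1 := by rw [hcons, List.length_ofFn]
  have hmem : ∀ j, y j ∈ (x 0 :: xs) ++ ((p : R) :: ys) := fun j => by
    rw [hcons]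
    refine Fin.addCases (fun j => ?_) (fun j => ?_) j
    · refine Fin.cases ?_ (fun j => ?_) j
      · exact List.mem_append_right _ (hy₀ ▸ List.mem_cons_self)
      · exact List.mem_append_left _ ((List.mem_ofFn' x _).mpr ⟨j, (hy₁ j).symm⟩)
    · exact List.mem_append_right _ (List.mem_cons_of_mem _ ((List.mem_ofFn' _ _).mpr ⟨j, rfl⟩))
  have key := isAssociatedPrime_dual_LC (q := q) (x 0) (p : R) xs ys
    (fun z hz => by
      rw [hcons, List.mem_ofFn'] at hz
      obtain ⟨j, rfl⟩ := hz
      exact hy₁ j ▸ hym _)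
    (fun z hz => by
      rcases List.mem_cons.mp hz with rfl | hz
      · exact hy₀ ▸ hym _
      · obtain ⟨j, rfl⟩ := (List.mem_ofFn' _ _).mp hz
        exact hym _)
    (by rw [hdim, hlen, List.length_cons, List.length_ofFn]; congr 1; lia)
    (by
      rw [← hrad]
      refine Ideal.radical_mono (sup_le_sup_left (Ideal.span_le.mpr ?_) q)
      rintro _ ⟨j, rfl⟩
      exact Ideal.subset_span (hmem j))
    hE
  rw [hlen, hcons, Ideal.ofList_ofFn] at key
  exact key
end
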